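/- There exists a positive constant c₁ such that for infinitely many primes p there exist primes q and r with p < q < r and A(pqr) > 2p/3 − c₁·√p. -/

import Mathlib

/-- The height `A(n)` of the `n`-th cyclotomic polynomial. -/
noncomputable def cycHeight (n : ℕ) : ℕ :=
  (Finset.range ((Polynomial.cyclotomic n ℤ).natDegree + 1)).sup
    fun k => ((Polynomial.cyclotomic n ℤ).coeff k).natAbs

section LargeSieve

open Finset

/-- The additive character `t ↦ exp (2πit)`. -/
noncomputable def unitExp (t : ℝ) : ℂ := Complex.exp (Complex.I * ((2 * Real.pi * t : ℝ) : ℂ))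

lemma unitExp_add (s t : ℝ) : unitExp (s + t) = unitExp s * unitExp t := by
  unfold unitExp
  rw [← Complex.exp_add]
  congr 1
  push_cast
  ring

lemma unitExp_int (k : ℤ) : unitExp k = 1 := by
  unfold unitExp
  rw [Complex.exp_eq_one_iff]
  exact ⟨k, by push_cast; ring⟩

lemma unitExp_zero : unitExp 0 = 1 := by simpa using unitExp_int 0

lemma norm_unitExp (t : ℝ) : ‖unitExp t‖ = 1 := by
  unfold unitExp
  rw [mul_comm]
  exact Complex.norm_exp_ofReal_mul_I _

lemma unitExp_conj (t : ℝ) : (starRingEnd ℂ) (unitExp t) = unitExp (-t) := by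
  unfold unitExp
  rw [← Complex.exp_conj, map_mul, Complex.conj_I, Complex.conj_ofReal]
  congr 1
  push_cast
  ring

lemma unitExp_nat_mul (n : ℕ) (t : ℝ) : unitExp (n * t) = unitExp t ^ n := by
  induction n with
  | zero => simp [unitExp_zero]
  | succ n ih => rw [pow_succ, ← ih, ← unitExp_add]; congr 1; push_cast; ring

lemma unitExp_sub_int (t : ℝ) (k : ℤ) : unitExp (t - k) = unitExp t := by
  have := unitExp_add (t - k) k
  rw [unitExp_int, mul_one] at this
  rw [← this]; congr 1; ring

lemma norm_sum_unitExp_le_card (H : ℕ) (t : ℝ) :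
    ‖∑ i ∈ range H, unitExp (i * t)‖ ≤ H := by
  refine (norm_sum_le _ _).trans ?_
  simp [norm_unitExp]

lemma norm_unitExp_sub_one_ge (t : ℝ) (ht : |t| ≤ 1 / 2) : 4 * |t| ≤ ‖unitExp t - 1‖ := by
  unfold unitExp
  rw [Complex.norm_exp_I_mul_ofReal_sub_one]
  rw [Real.norm_eq_abs, abs_mul, abs_of_pos (by norm_num : (0 : ℝ) < 2)]
  have h := Real.mul_abs_le_abs_sin (x := 2 * Real.pi * t / 2) (by
    rw [mul_div_assoc, abs_mul, abs_of_pos (by positivity : 0 < 2 * Real.pi), abs_div]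
    have := Real.pi_pos
    norm_num
    nlinarith)
  have h2 : 2 / Real.pi * |2 * Real.pi * t / 2| = 2 * |t| := by
    have := Real.pi_pos
    rw [show 2 * Real.pi * t / 2 = Real.pi * t by ring, abs_mul, abs_of_pos this]
    field_simp
  linarith

lemma norm_sum_unitExp_mul_le (H : ℕ) (t : ℝ) (ht : |t| ≤ 1 / 2) :
    2 * |t| * ‖∑ i ∈ range H, unitExp (i * t)‖ ≤ 1 := by
  have h1 : (∑ i ∈ range H, unitExp (i * t)) * (unitExp t - 1) = unitExp t ^ H - 1 := by
    simp_rw [unitExp_nat_mul]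
    exact geom_sum_mul _ _
  have h2 : ‖unitExp t ^ H - 1‖ ≤ 2 := by
    refine (norm_sub_le _ _).trans ?_
    simp [norm_pow, norm_unitExp]
    norm_num
  rw [← h1, norm_mul] at h2
  have h3 := norm_unitExp_sub_one_ge t ht
  nlinarith [norm_nonneg (∑ i ∈ range H, unitExp (i * t))]

lemma sum_two_div_le (S : Finset ℕ) : ∑ n ∈ S, (2 : ℝ) / ((n + 1) * (n + 2)) ≤ 2 := by
  have h : ∀ L : ℕ, ∑ n ∈ range L, (2 : ℝ) / ((n + 1) * (n + 2)) = 2 - 2 / (L + 1) := by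
    intro L
    induction L with
    | zero => norm_num
    | succ L ih =>
      rw [sum_range_succ, ih]
      push_cast
      field_simp
      ring
  obtain ⟨L, hL⟩ := S.exists_nat_subset_range
  calc _ ≤ ∑ n ∈ range L, (2 : ℝ) / ((n + 1) * (n + 2)) :=
        sum_le_sum_of_subset_of_nonneg hL (fun _ _ _ => by positivity)
    _ ≤ 2 := by rw [h]; have : (0 : ℝ) ≤ 2 / (L + 1) := by positivity
                linarith

lemma norm_sq_sum_unitExp_le (H n : ℕ) (δ t : ℝ) (hδ : 0 < δ) (hH : 1 ≤ H * δ)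
    (ht : |t| ≤ 1 / 2) (hn : n * δ ≤ |t|) :
    ‖∑ i ∈ range H, unitExp (i * t)‖ ^ 2 ≤ (H : ℝ) ^ 2 * (2 / ((n + 1) * (n + 2))) := by
  have h1 := norm_sum_unitExp_le_card H t
  have h2 := norm_sum_unitExp_mul_le H t ht
  set D := ‖∑ i ∈ range H, unitExp (i * t)‖
  have hD : 0 ≤ D := norm_nonneg _
  rcases Nat.eq_zero_or_pos n with rfl | hn0
  · norm_num
    nlinarith
  · have hn1 : (1 : ℝ) ≤ n := by exact_mod_cast hn0
    have h3 : 2 * n * D ≤ H := by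
      have : 2 * (n * δ) * D ≤ 1 := by
        refine le_trans ?_ h2
        gcongr
      have h4 : 2 * n * D * δ ≤ H * δ := by nlinarith
      exact le_of_mul_le_mul_right h4 hδ
    have h4 : 4 * (n : ℝ) ^ 2 * D ^ 2 ≤ H ^ 2 := by
      have : (2 * n * D) ^ 2 ≤ (H : ℝ) ^ 2 := by gcongr
      nlinarith
    have h5 : D ^ 2 * ((n + 1) * (n + 2)) ≤ (H : ℝ) ^ 2 * 2 := by
      have : ((n : ℝ) + 1) * (n + 2) ≤ 8 * n ^ 2 := by nlinarith
      nlinarith [sq_nonneg D]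
    rw [← mul_div_assoc, le_div_iff₀ (by positivity)]
    exact h5

lemma sum_norm_sq_kernel_le {ι : Type*} (s : Finset ι) (θ : ι → ℝ) (δ : ℝ) (hδ : 0 < δ)
    (hsep : ∀ r ∈ s, ∀ t ∈ s, r ≠ t → ∀ k : ℤ, δ ≤ |θ r - θ t - k|)
    (H : ℕ) (hH : 1 ≤ H * δ) (x : ℝ) :
    ∑ r ∈ s, ‖∑ i ∈ range H, unitExp (i * (x - θ r))‖ ^ 2 ≤ 4 * (H : ℝ) ^ 2 := by
  classical
  set u : ι → ℝ := fun r => (x - θ r) - round (x - θ r) with hu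
  have hu2 : ∀ r, |u r| ≤ 1 / 2 := fun r => abs_sub_round _
  have hker : ∀ r, ∑ i ∈ range H, unitExp (i * (x - θ r)) = ∑ i ∈ range H, unitExp (i * u r) := by
    intro r
    refine sum_congr rfl fun i _ => ?_
    have := unitExp_sub_int (i * (x - θ r)) (i * round (x - θ r))
    rw [← this]
    congr 1
    simp only [hu]
    push_cast
    ring
  have hsep' : ∀ r ∈ s, ∀ t ∈ s, r ≠ t → δ ≤ |u r - u t| := by
    intro r hr t ht hrt
    have := hsep t ht r hr hrt.symm (round (x - θ r) - round (x - θ t))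
    refine this.trans (le_of_eq ?_)
    congr 1
    simp only [hu]
    push_cast
    ring
  have key : ∀ T ⊆ s, ∀ σ : ℝ, (σ = 1 ∨ σ = -1) → (∀ r ∈ T, 0 ≤ σ * u r) →
      ∑ r ∈ T, ‖∑ i ∈ range H, unitExp (i * (x - θ r))‖ ^ 2 ≤ 2 * (H : ℝ) ^ 2 := by
    intro T hT σ hσ hpos
    set j : ι → ℕ := fun r => ⌊σ * u r / δ⌋₊ with hj
    have habs : ∀ r ∈ T, |u r| = σ * u r := by
      intro r hr
      have := hpos r hr
      rcases hσ with rfl | rfl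
      · rw [one_mul] at *; exact abs_of_nonneg this
      · rw [abs_of_nonpos (by linarith)]; ring
    have hinj : Set.InjOn j T := by
      intro r hr t ht hrt
      by_contra hne
      have h1 := hsep' r (hT hr) t (hT ht) hne
      have hr0 : 0 ≤ σ * u r / δ := div_nonneg (hpos r hr) hδ.le
      have ht0 : 0 ≤ σ * u t / δ := div_nonneg (hpos t ht) hδ.le
      have a1 := Nat.floor_le hr0
      have a2 := Nat.lt_floor_add_one (σ * u r / δ)
      have b1 := Nat.floor_le ht0
      have b2 := Nat.lt_floor_add_one (σ * u t / δ)
      simp only [hj] at hrt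
      rw [hrt] at a1 a2
      have h2 : |σ * u r / δ - σ * u t / δ| < 1 := by
        rw [abs_lt]; constructor <;> linarith
      rw [← sub_div, ← mul_sub, abs_div, abs_mul, abs_of_pos hδ, div_lt_one hδ] at h2
      have : |σ| = 1 := by rcases hσ with rfl | rfl <;> simp
      rw [this, one_mul] at h2
      linarith
    calc ∑ r ∈ T, ‖∑ i ∈ range H, unitExp (i * (x - θ r))‖ ^ 2
        ≤ ∑ r ∈ T, (H : ℝ) ^ 2 * (2 / ((j r + 1) * (j r + 2))) := by
          refine sum_le_sum fun r hr => ?_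
          rw [hker]
          refine norm_sq_sum_unitExp_le H (j r) δ (u r) hδ hH (hu2 r) ?_
          rw [habs r hr, ← le_div_iff₀ hδ]
          exact Nat.floor_le (div_nonneg (hpos r hr) hδ.le)
      _ = (H : ℝ) ^ 2 * ∑ n ∈ T.image j, (2 : ℝ) / ((n + 1) * (n + 2)) := by
          rw [sum_image hinj, mul_sum]
      _ ≤ (H : ℝ) ^ 2 * 2 := by gcongr; exact sum_two_div_le _
      _ = _ := by ring
  rw [← sum_filter_add_sum_filter_not s (fun r => 0 ≤ u r)]
  have h1 := key _ (filter_subset (fun r => 0 ≤ u r) s) 1 (Or.inl rfl) (by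
    intro r hr; rw [one_mul]; exact (mem_filter.1 hr).2)
  have h2 := key _ (filter_subset (fun r => ¬ 0 ≤ u r) s) (-1) (Or.inr rfl) (by
    intro r hr; have := (mem_filter.1 hr).2; linarith)
  linarith

lemma large_sieve_dual {ι : Type*} (s : Finset ι) (θ : ι → ℝ) (δ : ℝ) (hδ : 0 < δ)
    (hsep : ∀ r ∈ s, ∀ t ∈ s, r ≠ t → ∀ k : ℤ, δ ≤ |θ r - θ t - k|)
    (H N : ℕ) (hH : 1 ≤ H * δ) (hN : 2 * N ≤ H) (c : ι → ℂ) :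
    ∑ n ∈ range N, ‖∑ r ∈ s, c r * unitExp (n * θ r)‖ ^ 2 ≤ 8 * H * ∑ r ∈ s, ‖c r‖ ^ 2 := by
  have hHpos : (0 : ℝ) < H := by
    rcases Nat.eq_zero_or_pos H with rfl | h
    · norm_num at hH
    · exact_mod_cast h
  set T : ℝ → ℂ := fun y => ∑ r ∈ s, c r * unitExp (y * θ r) with hT
  set K : ι → ι → ℝ := fun r t => ‖∑ i ∈ range H, unitExp (i * (θ r - θ t))‖ ^ 2 with hK
  have hKsymm : ∀ r t, K r t = K t r := by
    intro r t
    simp only [hK]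
    rw [← Complex.norm_conj, map_sum]
    congr 2
    refine sum_congr rfl fun i _ => ?_
    rw [unitExp_conj]; congr 1; ring
  -- lower bound
  have hlow : ((H : ℝ) / 2) * ∑ n ∈ range N, ‖T n‖ ^ 2 ≤
      ∑ i ∈ range H, ∑ j ∈ range H, ‖T ((i : ℝ) - j)‖ ^ 2 := by
    rw [sum_comm]
    have h1 : ∀ j ∈ range (H - N), ∑ n ∈ range N, ‖T n‖ ^ 2 ≤
        ∑ i ∈ range H, ‖T ((i : ℝ) - j)‖ ^ 2 := by
      intro j hj
      rw [mem_range] at hj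
      calc ∑ n ∈ range N, ‖T n‖ ^ 2 = ∑ i ∈ (range N).image (fun n => n + j),
            ‖T ((i : ℝ) - j)‖ ^ 2 := by
            rw [sum_image (by intro a _ b _ h; simpa using h)]
            refine sum_congr rfl fun n _ => ?_
            push_cast
            rw [add_sub_cancel_right]
        _ ≤ _ := by
            refine sum_le_sum_of_subset_of_nonneg ?_ (fun _ _ _ => by positivity)
            intro i hi
            simp only [mem_image, mem_range] at hi ⊢
            omega
    calc ((H : ℝ) / 2) * ∑ n ∈ range N, ‖T n‖ ^ 2 ≤
          ((H - N : ℕ) : ℝ) * ∑ n ∈ range N, ‖T n‖ ^ 2 := by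
          have : (H : ℝ) / 2 ≤ ((H - N : ℕ) : ℝ) := by
            rw [Nat.cast_sub (by omega)]
            have : (2 : ℝ) * N ≤ H := by exact_mod_cast hN
            linarith
          gcongr
      _ = ∑ j ∈ range (H - N), ∑ n ∈ range N, ‖T n‖ ^ 2 := by simp
      _ ≤ ∑ j ∈ range (H - N), ∑ i ∈ range H, ‖T ((i : ℝ) - j)‖ ^ 2 := sum_le_sum h1
      _ ≤ _ := sum_le_sum_of_subset_of_nonneg (range_subset_range.2 (by omega))
          (fun _ _ _ => by positivity)
  -- expansion
  have hexp : ((∑ i ∈ range H, ∑ j ∈ range H, ‖T ((i : ℝ) - j)‖ ^ 2 : ℝ) : ℂ) =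
      ∑ r ∈ s, ∑ t ∈ s, c r * (starRingEnd ℂ) (c t) * (K r t : ℂ) := by
    have hT2 : ∀ i j : ℕ, ((‖T ((i : ℝ) - j)‖ ^ 2 : ℝ) : ℂ) =
        ∑ r ∈ s, ∑ t ∈ s, c r * (starRingEnd ℂ) (c t) *
          (unitExp (i * (θ r - θ t)) * unitExp (-(j * (θ r - θ t)))) := by
      intro i j
      push_cast
      rw [← Complex.mul_conj']
      simp only [hT]
      rw [map_sum, sum_mul_sum]
      refine sum_congr rfl fun r _ => sum_congr rfl fun t _ => ?_
      rw [map_mul, unitExp_conj, ← unitExp_add, mul_mul_mul_comm, ← unitExp_add]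
      congr 2
      ring
    rw [Complex.ofReal_sum]
    simp_rw [Complex.ofReal_sum, hT2]
    simp_rw [sum_comm (s := range H) (t := s)]
    refine sum_congr rfl fun r _ => sum_congr rfl fun t _ => ?_
    simp_rw [← mul_sum]
    congr 1
    simp only [hK]
    push_cast
    rw [← Complex.mul_conj', map_sum, sum_mul_sum]
    refine sum_congr rfl fun i _ => ?_
    rw [mul_sum]
    refine sum_congr rfl fun j _ => ?_
    rw [unitExp_conj]
  have hup : ∑ i ∈ range H, ∑ j ∈ range H, ‖T ((i : ℝ) - j)‖ ^ 2 ≤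
      4 * (H : ℝ) ^ 2 * ∑ r ∈ s, ‖c r‖ ^ 2 := by
    have h0 : (0 : ℝ) ≤ ∑ i ∈ range H, ∑ j ∈ range H, ‖T ((i : ℝ) - j)‖ ^ 2 := by positivity
    calc ∑ i ∈ range H, ∑ j ∈ range H, ‖T ((i : ℝ) - j)‖ ^ 2
        = ‖((∑ i ∈ range H, ∑ j ∈ range H, ‖T ((i : ℝ) - j)‖ ^ 2 : ℝ) : ℂ)‖ := by
          rw [Complex.norm_real, Real.norm_of_nonneg h0]
      _ ≤ ∑ r ∈ s, ∑ t ∈ s, ‖c r‖ * ‖c t‖ * K r t := by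
          rw [hexp]
          refine (norm_sum_le _ _).trans (sum_le_sum fun r _ => ?_)
          refine (norm_sum_le _ _).trans (sum_le_sum fun t _ => ?_)
          rw [norm_mul, norm_mul, Complex.norm_conj, Complex.norm_real, Real.norm_of_nonneg]
          positivity
      _ ≤ ∑ r ∈ s, ∑ t ∈ s, (‖c r‖ ^ 2 / 2 * K r t + ‖c t‖ ^ 2 / 2 * K r t) := by
          refine sum_le_sum fun r _ => sum_le_sum fun t _ => ?_
          rw [← add_mul]
          have : 0 ≤ K r t := by positivity
          gcongr
          nlinarith [sq_nonneg (‖c r‖ - ‖c t‖)]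
      _ = ∑ r ∈ s, ‖c r‖ ^ 2 * ∑ t ∈ s, K r t := by
          simp_rw [sum_add_distrib]
          rw [sum_comm (f := fun r t => ‖c t‖ ^ 2 / 2 * K r t)]
          rw [← sum_add_distrib]
          refine sum_congr rfl fun r _ => ?_
          rw [mul_sum, ← sum_add_distrib]
          refine sum_congr rfl fun t _ => ?_
          rw [hKsymm t r]; ring
      _ ≤ ∑ r ∈ s, ‖c r‖ ^ 2 * (4 * (H : ℝ) ^ 2) := by
          refine sum_le_sum fun r _ => ?_
          gcongr
          exact sum_norm_sq_kernel_le s θ δ hδ hsep H hH (θ r)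
      _ = _ := by rw [← sum_mul, mul_comm]
  have h := hlow.trans hup
  have : (H : ℝ) / 2 * ∑ n ∈ range N, ‖T n‖ ^ 2 ≤ (H : ℝ) / 2 * (8 * H * ∑ r ∈ s, ‖c r‖ ^ 2) := by
    refine h.trans (le_of_eq ?_)
    ring
  exact le_of_mul_le_mul_left this (by positivity)

lemma large_sieve_separated {ι : Type*} (s : Finset ι) (θ : ι → ℝ) (δ : ℝ) (hδ : 0 < δ)
    (hsep : ∀ r ∈ s, ∀ t ∈ s, r ≠ t → ∀ k : ℤ, δ ≤ |θ r - θ t - k|)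
    (H N : ℕ) (hH : 1 ≤ H * δ) (hN : 2 * N ≤ H) (α : ℕ → ℂ) :
    ∑ r ∈ s, ‖∑ n ∈ range N, α n * unitExp (n * θ r)‖ ^ 2 ≤
      8 * H * ∑ n ∈ range N, ‖α n‖ ^ 2 := by
  set S : ι → ℂ := fun r => ∑ n ∈ range N, α n * unitExp (n * θ r) with hS
  set c : ι → ℂ := fun r => (starRingEnd ℂ) (S r) with hc
  have hd := large_sieve_dual s θ δ hδ hsep H N hH hN c
  have hcS : ∀ r, ‖c r‖ = ‖S r‖ := fun r => Complex.norm_conj _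
  simp_rw [hcS] at hd
  set A := ∑ r ∈ s, ‖S r‖ ^ 2 with hA
  set E := ∑ n ∈ range N, ‖α n‖ ^ 2 with hE
  set T : ℕ → ℂ := fun n => ∑ r ∈ s, c r * unitExp (n * θ r) with hT
  have hA0 : 0 ≤ A := by positivity
  have h1 : (A : ℂ) = ∑ n ∈ range N, α n * T n := by
    simp only [hA, hT]
    push_cast
    simp_rw [mul_sum]
    rw [sum_comm]
    refine sum_congr rfl fun r _ => ?_
    rw [← Complex.conj_mul']
    change c r * ∑ n ∈ range N, α n * unitExp (n * θ r) = _
    rw [mul_sum]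
    refine sum_congr rfl fun n _ => ?_
    ring
  have h2 : A ≤ ∑ n ∈ range N, ‖α n‖ * ‖T n‖ := by
    have : A = ‖(A : ℂ)‖ := by rw [Complex.norm_real, Real.norm_of_nonneg hA0]
    rw [this, h1]
    refine (norm_sum_le _ _).trans (le_of_eq ?_)
    simp_rw [norm_mul]
  have h3 : A ^ 2 ≤ E * (8 * H * A) := by
    calc A ^ 2 ≤ (∑ n ∈ range N, ‖α n‖ * ‖T n‖) ^ 2 := by gcongr
      _ ≤ E * ∑ n ∈ range N, ‖T n‖ ^ 2 := sum_mul_sq_le_sq_mul_sq _ _ _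
      _ ≤ _ := by gcongr
  rcases hA0.eq_or_lt with h0 | h0
  · rw [← h0]; positivity
  · have : A * A ≤ A * (8 * H * E) := by nlinarith
    exact le_of_mul_le_mul_left this h0

lemma farey_separated {q₁ q₂ a₁ a₂ Q : ℕ} (h1 : 0 < q₁) (h2 : 0 < q₂) (h1Q : q₁ ≤ Q)
    (h2Q : q₂ ≤ Q) (ha1 : a₁ < q₁) (ha2 : a₂ < q₂) (hc1 : a₁.Coprime q₁) (hc2 : a₂.Coprime q₂)
    (hne : ¬ (q₁ = q₂ ∧ a₁ = a₂)) (k : ℤ) :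
    1 / (Q : ℝ) ^ 2 ≤ |(a₁ : ℝ) / q₁ - a₂ / q₂ - k| := by
  have hq1 : (0 : ℝ) < q₁ := by exact_mod_cast h1
  have hq2 : (0 : ℝ) < q₂ := by exact_mod_cast h2
  have hQ : (0 : ℝ) < Q := by exact_mod_cast h1.trans_le h1Q
  set z : ℤ := a₁ * q₂ - a₂ * q₁ - k * (q₁ * q₂) with hz
  have hzr : (a₁ : ℝ) / q₁ - a₂ / q₂ - k = z / (q₁ * q₂) := by
    rw [hz]; push_cast; field_simp
  have hz0 : z ≠ 0 := by
    intro h0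
    apply hne
    have e1 : (q₁ : ℤ) ∣ q₂ := by
      have : (q₁ : ℤ) ∣ q₂ * a₁ := ⟨a₂ + k * q₂, by linarith⟩
      exact IsCoprime.dvd_of_dvd_mul_right (Nat.isCoprime_iff_coprime.2 hc1.symm) this
    have e2 : (q₂ : ℤ) ∣ q₁ := by
      have : (q₂ : ℤ) ∣ q₁ * a₂ := ⟨a₁ - k * q₁, by linarith⟩
      exact IsCoprime.dvd_of_dvd_mul_right (Nat.isCoprime_iff_coprime.2 hc2.symm) this
    have e : q₁ = q₂ := Nat.dvd_antisymm (by exact_mod_cast e1) (by exact_mod_cast e2)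
    subst e
    refine ⟨rfl, ?_⟩
    have : (q₁ : ℤ) * (a₁ - a₂ - k * q₁) = 0 := by linarith
    rcases mul_eq_zero.1 this with h | h
    · exact absurd h (by exact_mod_cast h1.ne')
    · have hk : k = 0 := by
        by_contra hk
        rcases lt_or_gt_of_ne hk with hk | hk
        · have : k * q₁ ≤ -1 * q₁ := by
            apply mul_le_mul_of_nonneg_right <;> omega
          omega
        · have : 1 * (q₁ : ℤ) ≤ k * q₁ := by
            apply mul_le_mul_of_nonneg_right <;> omega
          omega
      subst hk
      omega
  rw [hzr, abs_div, abs_of_pos (by positivity : (0 : ℝ) < q₁ * q₂)]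
  have hz1 : (1 : ℝ) ≤ |(z : ℝ)| := by
    have := Int.one_le_abs hz0
    exact_mod_cast this
  have hqq : (q₁ : ℝ) * q₂ ≤ Q ^ 2 := by
    rw [sq]
    have : (q₁ : ℝ) ≤ Q := by exact_mod_cast h1Q
    have : (q₂ : ℝ) ≤ Q := by exact_mod_cast h2Q
    gcongr
  gcongr

/-- The additive large sieve inequality. -/
theorem large_sieve (N Q : ℕ) (α : ℕ → ℂ) :
    ∑ q ∈ Icc 1 Q, ∑ a ∈ (range q).filter (fun a => a.Coprime q),
      ‖∑ n ∈ range N, α n * unitExp (n * ((a : ℝ) / q))‖ ^ 2 ≤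
      16 * (N + (Q : ℝ) ^ 2) * ∑ n ∈ range N, ‖α n‖ ^ 2 := by
  rcases Nat.eq_zero_or_pos Q with rfl | hQ
  · simp; positivity
  have hQr : (0 : ℝ) < Q := by exact_mod_cast hQ
  rw [sum_sigma' (f := fun q a : ℕ => ‖∑ n ∈ range N, α n * unitExp (n * ((a : ℝ) / q))‖ ^ 2)]
  refine (large_sieve_separated _ (fun x : (_ : ℕ) × ℕ => (x.2 : ℝ) / x.1) (1 / (Q : ℝ) ^ 2)
    (by positivity) ?_ (2 * N + Q ^ 2) N ?_ (by omega) α).trans ?_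
  · rintro ⟨q₁, a₁⟩ h1 ⟨q₂, a₂⟩ h2 hne k
    simp only [mem_sigma, mem_Icc, mem_filter, mem_range] at h1 h2
    refine farey_separated (by omega) (by omega) (by omega) (by omega) h1.2.1 h2.2.1 h1.2.2
      h2.2.2 ?_ k
    rintro ⟨rfl, rfl⟩
    exact hne rfl
  · rw [mul_one_div, le_div_iff₀ (by positivity)]
    push_cast
    have : (0 : ℝ) ≤ N := by positivity
    linarith
  · have : (0 : ℝ) ≤ ∑ n ∈ range N, ‖α n‖ ^ 2 := by positivity
    refine mul_le_mul_of_nonneg_right ?_ this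
    push_cast
    nlinarith [sq_nonneg (Q : ℝ)]

end LargeSieve

section CharacterSums

open Finset

lemma stdAddChar_natCast_mul (f : ℕ) [NeZero f] (n : ℕ) (a : ZMod f) :
    ZMod.stdAddChar (a * (n : ZMod f)) = unitExp (n * ((a.val : ℝ) / f)) := by
  have h : a * (n : ZMod f) = (((a.val * n : ℕ) : ℤ) : ZMod f) := by
    push_cast
    rw [ZMod.natCast_val, ZMod.cast_id]
  rw [h, ZMod.stdAddChar_coe, unitExp]
  congr 1
  push_cast
  ring

lemma zmod_parseval (f : ℕ) [NeZero f] (u : ZMod f → ℂ) :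
    ∑ k : ZMod f, ‖∑ a, u a * ZMod.stdAddChar (a * k)‖ ^ 2 = f * ∑ a, ‖u a‖ ^ 2 := by
  have key : ∀ k : ZMod f, ((‖∑ a, u a * ZMod.stdAddChar (a * k)‖ ^ 2 : ℝ) : ℂ) =
      ∑ a, ∑ b, u a * (starRingEnd ℂ) (u b) * ZMod.stdAddChar (k * (a - b)) := by
    intro k
    push_cast
    rw [← Complex.mul_conj', map_sum, sum_mul_sum]
    refine sum_congr rfl fun a _ => sum_congr rfl fun b _ => ?_
    rw [map_mul (starRingEnd ℂ), ← AddChar.map_neg_eq_conj, mul_mul_mul_comm, ← AddChar.map_add_eq_mul]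
    congr 2
    ring
  apply Complex.ofReal_injective
  rw [Complex.ofReal_sum]
  simp_rw [key]
  rw [sum_comm]
  push_cast
  rw [mul_sum]
  refine sum_congr rfl fun a _ => ?_
  rw [sum_comm]
  simp_rw [← mul_sum, AddChar.sum_mulShift _ (ZMod.isPrimitive_stdAddChar f), sub_eq_zero]
  rw [sum_eq_single a]
  · rw [if_pos rfl, ZMod.card, Complex.mul_conj']
    ring
  · intro b _ hb
    rw [if_neg hb.symm]; simp
  · simp

lemma sum_norm_sq_char_sum (f : ℕ) [NeZero f] (u : ZMod f → ℂ) :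
    ∑ χ : DirichletCharacter ℂ f, ‖∑ a, χ a * u a‖ ^ 2 =
      f.totient * ∑ a : (ZMod f)ˣ, ‖u a‖ ^ 2 := by
  have hu : ∀ χ : DirichletCharacter ℂ f, ∑ a, χ a * u a = ∑ a : (ZMod f)ˣ, χ a * u a := by
    intro χ
    symm
    refine sum_of_injOn (fun a : (ZMod f)ˣ => (a : ZMod f)) ?_ ?_ ?_ ?_
    · intro a _ b _ h; exact Units.ext h
    · intro a _; simp
    · intro a _ ha
      rw [χ.map_nonunit, zero_mul]
      intro h
      exact ha ⟨h.unit, by simp, h.unit_spec⟩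
    · intro a _; rfl
  have key : ∀ χ : DirichletCharacter ℂ f, ((‖∑ a, χ a * u a‖ ^ 2 : ℝ) : ℂ) =
      ∑ a : (ZMod f)ˣ, ∑ b : (ZMod f)ˣ, u a * (starRingEnd ℂ) (u b) *
        (χ ((b : ZMod f)⁻¹) * χ a) := by
    intro χ
    push_cast
    rw [hu, ← Complex.mul_conj', map_sum, sum_mul_sum]
    refine sum_congr rfl fun a _ => sum_congr rfl fun b _ => ?_
    have : (starRingEnd ℂ) (χ b) = χ ((b : ZMod f)⁻¹) := by
      have h1 := MulChar.star_apply χ (b : ZMod f)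
      rw [MulChar.star_eq_inv, MulChar.inv_apply, ZMod.inv_coe_unit] at *
      simpa using h1.symm
    rw [map_mul, this]
    ring
  apply Complex.ofReal_injective
  rw [Complex.ofReal_sum]
  simp_rw [key]
  rw [sum_comm]
  push_cast
  rw [mul_sum]
  refine sum_congr rfl fun a _ => ?_
  rw [sum_comm]
  simp_rw [← mul_sum]
  rw [sum_eq_single a]
  · rw [DirichletCharacter.sum_char_inv_mul_char_eq ℂ a.isUnit, if_pos rfl, Complex.mul_conj']
    ring
  · intro b _ hb
    rw [DirichletCharacter.sum_char_inv_mul_char_eq ℂ b.isUnit, if_neg, mul_zero]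
    intro h
    exact hb (Units.ext h)
  · simp

lemma norm_sq_gaussSum_of_isPrimitive (f : ℕ) [NeZero f] (χ : DirichletCharacter ℂ f)
    (hχ : χ.IsPrimitive) : ‖gaussSum χ ZMod.stdAddChar‖ ^ 2 = f := by
  have hsum : ∀ χ : DirichletCharacter ℂ f, ∑ a, ‖χ a‖ ^ 2 = f.totient := by
    intro χ
    have : ∑ a, ‖χ a‖ ^ 2 = ∑ a : (ZMod f)ˣ, (1 : ℝ) := by
      symm
      refine sum_of_injOn (fun a : (ZMod f)ˣ => (a : ZMod f)) ?_ ?_ ?_ ?_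
      · intro a _ b _ h; exact Units.ext h
      · intro a _; simp
      · intro a _ ha
        rw [χ.map_nonunit]
        · simp
        intro h
        exact ha ⟨h.unit, by simp, h.unit_spec⟩
      · intro a _; simp [DirichletCharacter.unit_norm_eq_one]
    rw [this]
    simp [ZMod.card_units_eq_totient]
  have h := zmod_parseval f (fun a => χ a)
  have h2 : ∀ k : ZMod f, ∑ a, χ a * ZMod.stdAddChar (a * k) =
      χ⁻¹ k * gaussSum χ ZMod.stdAddChar := by
    intro k
    rw [← gaussSum_mulShift_of_isPrimitive _ hχ]
    unfold gaussSum
    refine sum_congr rfl fun a _ => ?_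
    rw [AddChar.mulShift_apply, mul_comm k]
  simp_rw [h2, norm_mul, mul_pow] at h
  rw [← sum_mul, hsum, hsum, mul_comm] at h
  have hφ : (0 : ℝ) < f.totient := by
    exact_mod_cast Nat.totient_pos.2 (NeZero.pos f)
  exact mul_right_cancel₀ hφ.ne' h

lemma sum_units_eq_sum_coprime (f : ℕ) [NeZero f] (G : ℕ → ℝ) :
    ∑ a : (ZMod f)ˣ, G (a : ZMod f).val = ∑ a ∈ (range f).filter (fun a => a.Coprime f), G a := by
  refine sum_bij (fun a _ => (a : ZMod f).val) ?_ ?_ ?_ ?_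
  · intro a _
    simp only [mem_filter, mem_range]
    exact ⟨ZMod.val_lt _, ZMod.val_coe_unit_coprime a⟩
  · intro a _ b _ h
    exact Units.ext (ZMod.val_injective f h)
  · intro b hb
    simp only [mem_filter, mem_range] at hb
    refine ⟨ZMod.unitOfCoprime b hb.2, mem_univ _, ?_⟩
    rw [ZMod.coe_unitOfCoprime, ZMod.val_natCast, Nat.mod_eq_of_lt hb.1]
  · intro a _; rfl

open Classical in
/-- Mean squares of sums over primitive characters are controlled by exponential sums at reduced
fractions. -/
theorem sum_primitive_le (f : ℕ) [NeZero f] (N : ℕ) (α : ℕ → ℂ) :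
    ∑ χ ∈ univ.filter (fun χ : DirichletCharacter ℂ f => χ.IsPrimitive),
      ‖∑ n ∈ range N, α n * χ (n : ZMod f)‖ ^ 2 ≤
    ∑ a ∈ (range f).filter (fun a => a.Coprime f),
      ‖∑ n ∈ range N, α n * unitExp (n * ((a : ℝ) / f))‖ ^ 2 := by
  set S : ZMod f → ℂ := fun a => ∑ n ∈ range N, α n * ZMod.stdAddChar (a * (n : ZMod f)) with hS
  have hf : (0 : ℝ) < f := by exact_mod_cast NeZero.pos f
  have h1 : ∀ χ : DirichletCharacter ℂ f, χ.IsPrimitive →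
      (f : ℝ) * ‖∑ n ∈ range N, α n * χ (n : ZMod f)‖ ^ 2 = ‖∑ a, χ⁻¹ a * S a‖ ^ 2 := by
    intro χ hχ
    have hχ' : χ⁻¹.IsPrimitive := by
      rw [DirichletCharacter.isPrimitive_def, DirichletCharacter.conductor_inv]; exact hχ
    rw [← norm_sq_gaussSum_of_isPrimitive f χ⁻¹ hχ', ← mul_pow, ← norm_mul]
    congr 2
    simp only [hS]
    simp_rw [mul_sum]
    rw [sum_comm]
    refine sum_congr rfl fun n _ => ?_
    have h2 := gaussSum_mulShift_of_isPrimitive ZMod.stdAddChar hχ' (n : ZMod f)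
    rw [inv_inv] at h2
    rw [mul_left_comm, mul_comm (gaussSum _ _), ← h2]
    unfold gaussSum
    rw [mul_sum]
    refine sum_congr rfl fun a _ => ?_
    rw [AddChar.mulShift_apply, mul_comm (n : ZMod f)]
    ring
  have h2 : (f : ℝ) * ∑ χ ∈ univ.filter (fun χ : DirichletCharacter ℂ f => χ.IsPrimitive),
      ‖∑ n ∈ range N, α n * χ (n : ZMod f)‖ ^ 2 ≤ f * ∑ a : (ZMod f)ˣ, ‖S a‖ ^ 2 := by
    rw [mul_sum, sum_congr rfl fun χ hχ => h1 χ (mem_filter.1 hχ).2]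
    calc _ ≤ ∑ χ : DirichletCharacter ℂ f, ‖∑ a, χ⁻¹ a * S a‖ ^ 2 :=
          sum_le_sum_of_subset_of_nonneg (filter_subset _ _) (fun _ _ _ => by positivity)
      _ = ∑ χ : DirichletCharacter ℂ f, ‖∑ a, χ a * S a‖ ^ 2 :=
          Equiv.sum_comp (Equiv.inv _) (fun χ : DirichletCharacter ℂ f => ‖∑ a, χ a * S a‖ ^ 2)
      _ = f.totient * ∑ a : (ZMod f)ˣ, ‖S a‖ ^ 2 := sum_norm_sq_char_sum f S
      _ ≤ _ := by
          gcongr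
          exact Nat.totient_le f
  refine (le_of_mul_le_mul_left h2 hf).trans (le_of_eq ?_)
  rw [← sum_units_eq_sum_coprime f
    (fun a => ‖∑ n ∈ range N, α n * unitExp (n * ((a : ℝ) / f))‖ ^ 2)]
  refine sum_congr rfl fun a _ => ?_
  simp only [hS]
  simp_rw [stdAddChar_natCast_mul]

end CharacterSums

section BilinearForms

open Finset

/-- The difference between the indicator of a residue class and its mean over reduced classes. -/
noncomputable def apKer (m : ℕ) (h : ZMod m) (n : ℕ) : ℝ :=
  (if (n : ZMod m) = h then 1 else 0) - (if n.Coprime m then 1 else 0) / m.totient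

lemma apKer_eq_sum_char (m : ℕ) [NeZero m] (h : ZMod m) (hh : IsUnit h) (n : ℕ) :
    (apKer m h n : ℂ) = (1 / m.totient : ℂ) *
      ∑ χ ∈ univ.erase (1 : DirichletCharacter ℂ m), χ h⁻¹ * χ (n : ZMod m) := by
  have hφ : (m.totient : ℂ) ≠ 0 := by
    exact_mod_cast (Nat.totient_pos.2 (NeZero.pos m)).ne'
  have h1 := DirichletCharacter.sum_char_inv_mul_char_eq ℂ hh (n : ZMod m)
  rw [← add_sum_erase _ _ (mem_univ (1 : DirichletCharacter ℂ m))] at h1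
  have hinv : IsUnit (h⁻¹) := by
    obtain ⟨u, rfl⟩ := hh
    rw [ZMod.inv_coe_unit]; exact Units.isUnit _
  have h2 : (1 : DirichletCharacter ℂ m) h⁻¹ * (1 : DirichletCharacter ℂ m) (n : ZMod m) =
      if n.Coprime m then 1 else 0 := by
    rw [MulChar.one_apply hinv, one_mul]
    split_ifs with hc
    · rw [MulChar.one_apply ((ZMod.isUnit_iff_coprime n m).2 hc)]
    · rw [MulChar.map_nonunit _ (fun hu => hc ((ZMod.isUnit_iff_coprime n m).1 hu))]
  rw [h2] at h1
  rw [← eq_sub_iff_add_eq'] at h1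
  rw [h1, apKer]
  simp only [eq_comm (a := h)]
  push_cast
  split_ifs <;> field_simp <;> simp

open Classical in
/-- The finite set of primitive characters of level `f`. -/
noncomputable def primChars (f : ℕ) : Finset (DirichletCharacter ℂ f) :=
  if h : f = 0 then ∅ else
    haveI : NeZero f := ⟨h⟩
    univ.filter (fun χ => χ.IsPrimitive)

lemma mem_primChars {f : ℕ} (hf : f ≠ 0) (χ : DirichletCharacter ℂ f) :
    χ ∈ primChars f ↔ χ.IsPrimitive := by
  unfold primChars
  rw [dif_neg hf]
  simp

/-- Character sum over integers coprime to `e`. -/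
noncomputable def charSum {f : ℕ} (χ : DirichletCharacter ℂ f) (e N : ℕ) (α : ℕ → ℂ) : ℂ :=
  ∑ k ∈ range N, (if k.Coprime e then α k else 0) * χ (k : ZMod f)

lemma sum_primChars_sq_le (Q e N : ℕ) (α : ℕ → ℂ) :
    ∑ f ∈ Icc 1 Q, ∑ χ ∈ primChars f, ‖charSum χ e N α‖ ^ 2 ≤
      16 * (N + (Q : ℝ) ^ 2) * ∑ n ∈ range N, ‖α n‖ ^ 2 := by
  calc _ ≤ ∑ f ∈ Icc 1 Q, ∑ a ∈ (range f).filter (fun a => a.Coprime f),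
      ‖∑ n ∈ range N, (if n.Coprime e then α n else 0) * unitExp (n * ((a : ℝ) / f))‖ ^ 2 := by
        refine sum_le_sum fun f hf => ?_
        have hf0 : f ≠ 0 := by have := (mem_Icc.1 hf).1; omega
        have : NeZero f := ⟨hf0⟩
        have := sum_primitive_le f N (fun n => if n.Coprime e then α n else 0)
        unfold primChars
        rw [dif_neg hf0]
        exact this
    _ ≤ 16 * (N + (Q : ℝ) ^ 2) * ∑ n ∈ range N, ‖(if n.Coprime e then α n else 0)‖ ^ 2 :=
        large_sieve N Q _
    _ ≤ _ := by
        gcongr with n _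
        split_ifs
        · exact le_rfl
        · simp

lemma charSum_changeLevel {m : ℕ} (χ : DirichletCharacter ℂ m) (N : ℕ) (α : ℕ → ℂ) :
    ∑ k ∈ range N, α k * χ (k : ZMod m) =
      charSum χ.primitiveCharacter (m / χ.conductor) N α := by
  unfold charSum
  refine sum_congr rfl fun k _ => ?_
  have hm : m = χ.conductor * (m / χ.conductor) :=
    (Nat.mul_div_cancel' χ.conductor_dvd_level).symm
  by_cases hk : k.Coprime m
  · have hk' : k.Coprime (m / χ.conductor) := by
      rw [hm] at hk; exact hk.coprime_mul_left_right
    rw [if_pos hk']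
    have h := χ.primitiveCharacter_apply_of_isCoprime (a := (k : ℤ))
      (Nat.isCoprime_iff_coprime.2 hk)
    push_cast at h
    rw [h]
  · rw [χ.map_nonunit (fun hu => hk ((ZMod.isUnit_iff_coprime k m).1 hu)), mul_zero]
    by_cases hk' : k.Coprime (m / χ.conductor)
    · have : ¬ k.Coprime χ.conductor := by
        intro h
        apply hk
        rw [hm]
        exact Nat.Coprime.mul_right h hk'
      rw [MulChar.map_nonunit _ (fun hu => this ((ZMod.isUnit_iff_coprime k _).1 hu)), mul_zero]
    · rw [if_neg hk', zero_mul]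

/-- Sum over primitive characters of products of two character sums. -/
noncomputable def primProd (f e N₁ N₂ : ℕ) (α β : ℕ → ℂ) : ℝ :=
  ∑ χ ∈ primChars f, ‖charSum χ e N₁ α‖ * ‖charSum χ e N₂ β‖

lemma primProd_nonneg (f e N₁ N₂ : ℕ) (α β : ℕ → ℂ) : 0 ≤ primProd f e N₁ N₂ α β :=
  sum_nonneg fun _ _ => by positivity

lemma sum_nontrivial_le (m : ℕ) [NeZero m] (N₁ N₂ : ℕ) (α β : ℕ → ℂ) :
    ∑ χ ∈ univ.erase (1 : DirichletCharacter ℂ m),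
      ‖∑ k ∈ range N₁, α k * χ (k : ZMod m)‖ * ‖∑ k ∈ range N₂, β k * χ (k : ZMod m)‖ ≤
    ∑ f ∈ m.divisors.erase 1, primProd f (m / f) N₁ N₂ α β := by
  classical
  unfold primProd
  rw [sum_sigma' (f := fun f (χ : DirichletCharacter ℂ f) =>
    ‖charSum χ (m / f) N₁ α‖ * ‖charSum χ (m / f) N₂ β‖)]
  set φ : DirichletCharacter ℂ m → (Σ f : ℕ, DirichletCharacter ℂ f) :=
    fun χ => ⟨χ.conductor, χ.primitiveCharacter⟩ with hφ
  have hinj : Function.Injective φ := by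
    have : Function.LeftInverse (fun s : (Σ f : ℕ, DirichletCharacter ℂ f) =>
        if h : s.1 ∣ m then DirichletCharacter.changeLevel h s.2 else 1) φ := by
      intro χ
      simp only [hφ]
      rw [dif_pos χ.conductor_dvd_level, χ.changeLevel_primitiveCharacter]
    exact this.injective
  calc _ = ∑ χ ∈ univ.erase (1 : DirichletCharacter ℂ m),
        ‖charSum (φ χ).2 (m / (φ χ).1) N₁ α‖ * ‖charSum (φ χ).2 (m / (φ χ).1) N₂ β‖ := by
        refine sum_congr rfl fun χ _ => ?_
        rw [charSum_changeLevel, charSum_changeLevel]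
    _ = ∑ s ∈ (univ.erase (1 : DirichletCharacter ℂ m)).image φ,
        ‖charSum s.2 (m / s.1) N₁ α‖ * ‖charSum s.2 (m / s.1) N₂ β‖ := by
        rw [sum_image fun a _ b _ h => hinj h]
    _ ≤ _ := by
        refine sum_le_sum_of_subset_of_nonneg ?_ (fun _ _ _ => by positivity)
        intro s hs
        obtain ⟨χ, hχ, rfl⟩ := mem_image.1 hs
        simp only [hφ, mem_sigma, mem_erase, Nat.mem_divisors]
        refine ⟨⟨?_, χ.conductor_dvd_level, NeZero.ne m⟩, ?_⟩
        · intro h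
          exact (mem_erase.1 hχ).1 (χ.eq_one_iff_conductor_eq_one.2 h)
        · rw [mem_primChars χ.conductor_ne_zero]
          exact χ.primitiveCharacter_isPrimitive

lemma norm_bilinear_apKer_le (m : ℕ) [NeZero m] (h : ZMod m) (hh : IsUnit h) (N₁ N₂ : ℕ)
    (α β : ℕ → ℂ) :
    ‖∑ k ∈ range N₁, ∑ l ∈ range N₂, α k * β l * (apKer m h (k * l) : ℂ)‖ ≤
      1 / m.totient * ∑ f ∈ m.divisors.erase 1, primProd f (m / f) N₁ N₂ α β := by
  have h1 : ∑ k ∈ range N₁, ∑ l ∈ range N₂, α k * β l * (apKer m h (k * l) : ℂ) =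
      (1 / m.totient : ℂ) * ∑ χ ∈ univ.erase (1 : DirichletCharacter ℂ m), χ h⁻¹ *
        ((∑ k ∈ range N₁, α k * χ (k : ZMod m)) * ∑ k ∈ range N₂, β k * χ (k : ZMod m)) := by
    simp_rw [apKer_eq_sum_char m h hh, sum_mul_sum, mul_sum]
    simp_rw [sum_comm (s := univ.erase (1 : DirichletCharacter ℂ m)) (t := range N₁)]
    refine sum_congr rfl fun k _ => ?_
    rw [sum_comm]
    refine sum_congr rfl fun χ _ => sum_congr rfl fun l _ => ?_
    push_cast
    rw [map_mul]
    ring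
  rw [h1, norm_mul]
  have h2 : ‖(1 / m.totient : ℂ)‖ = 1 / m.totient := by simp
  rw [h2]
  gcongr
  refine le_trans ?_ (sum_nontrivial_le m N₁ N₂ α β)
  refine (norm_sum_le _ _).trans (sum_le_sum fun χ _ => ?_)
  rw [norm_mul, norm_mul]
  refine mul_le_of_le_one_left (by positivity) (χ.norm_le_one _)

lemma sum_biUnion_le_sum_sum {ι κ : Type*} [DecidableEq κ] (s : Finset ι) (t : ι → Finset κ)
    (g : κ → ℝ) (hg : ∀ x, 0 ≤ g x) :
    ∑ x ∈ s.biUnion t, g x ≤ ∑ i ∈ s, ∑ x ∈ t i, g x := by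
  classical
  induction s using Finset.induction_on with
  | empty => simp
  | insert a s ha ih =>
    rw [biUnion_insert, sum_insert ha]
    have h := sum_union_inter (s₁ := t a) (s₂ := s.biUnion t) (f := g)
    have h2 : 0 ≤ ∑ x ∈ t a ∩ s.biUnion t, g x := sum_nonneg fun x _ => hg x
    linarith

lemma sum_primProd_block_le (F e N₁ N₂ : ℕ) (hF : 0 < F) (α β : ℕ → ℂ) :
    ∑ f ∈ Ioc F (2 * F), (1 / (f : ℝ)) * primProd f e N₁ N₂ α β ≤
      16 * (√(N₁ : ℝ) * √(N₂ : ℝ) / F + 2 * √(N₁ : ℝ) + 2 * √(N₂ : ℝ) + 4 * F) *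
        (√(∑ n ∈ range N₁, ‖α n‖ ^ 2) * √(∑ n ∈ range N₂, ‖β n‖ ^ 2)) := by
  have hFr : (0 : ℝ) < F := by exact_mod_cast hF
  have hsub : Ioc F (2 * F) ⊆ Icc 1 (2 * F) := by
    intro x hx; simp only [mem_Ioc, mem_Icc] at *; omega
  have key : ∀ N : ℕ, ∀ γ : ℕ → ℂ,
      √(∑ f ∈ Ioc F (2 * F), ∑ χ ∈ primChars f, ‖charSum χ e N γ‖ ^ 2) ≤
        4 * (√(N : ℝ) + 2 * F) * √(∑ n ∈ range N, ‖γ n‖ ^ 2) := by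
    intro N γ
    have h1 : ∑ f ∈ Ioc F (2 * F), ∑ χ ∈ primChars f, ‖charSum χ e N γ‖ ^ 2 ≤
        16 * (N + ((2 * F : ℕ) : ℝ) ^ 2) * ∑ n ∈ range N, ‖γ n‖ ^ 2 :=
      (sum_le_sum_of_subset_of_nonneg hsub fun _ _ _ => by positivity).trans
        (sum_primChars_sq_le (2 * F) e N γ)
    apply Real.sqrt_le_iff.2
    refine ⟨by positivity, h1.trans ?_⟩
    rw [mul_pow, mul_pow, Real.sq_sqrt (by positivity : 0 ≤ ∑ n ∈ range N, ‖γ n‖ ^ 2)]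
    refine mul_le_mul_of_nonneg_right ?_ (by positivity)
    have h2 := Real.sq_sqrt (by positivity : (0 : ℝ) ≤ N)
    have h3 : (0 : ℝ) ≤ √(N : ℝ) * F := by positivity
    push_cast
    nlinarith
  calc _ ≤ ∑ f ∈ Ioc F (2 * F), (1 / (F : ℝ)) * primProd f e N₁ N₂ α β := by
        refine sum_le_sum fun f hf => ?_
        have : (F : ℝ) ≤ f := by exact_mod_cast (mem_Ioc.1 hf).1.le
        have := primProd_nonneg f e N₁ N₂ α β
        gcongr
    _ = (1 / (F : ℝ)) * ∑ x ∈ (Ioc F (2 * F)).sigma primChars,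
        ‖charSum x.2 e N₁ α‖ * ‖charSum x.2 e N₂ β‖ := by
        rw [← mul_sum, sum_sigma]; rfl
    _ ≤ (1 / (F : ℝ)) * (√(∑ x ∈ (Ioc F (2 * F)).sigma primChars, ‖charSum x.2 e N₁ α‖ ^ 2) *
        √(∑ x ∈ (Ioc F (2 * F)).sigma primChars, ‖charSum x.2 e N₂ β‖ ^ 2)) := by
        gcongr
        exact Real.sum_mul_le_sqrt_mul_sqrt _ _ _
    _ ≤ (1 / (F : ℝ)) * ((4 * (√(N₁ : ℝ) + 2 * F) * √(∑ n ∈ range N₁, ‖α n‖ ^ 2)) *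
        (4 * (√(N₂ : ℝ) + 2 * F) * √(∑ n ∈ range N₂, ‖β n‖ ^ 2))) := by
        rw [sum_sigma, sum_sigma]
        gcongr
        · exact key N₁ α
        · exact key N₂ β
    _ = _ := by field_simp; ring

lemma sum_primProd_le (R Y e N₁ N₂ : ℕ) (hR : 0 < R) (α β : ℕ → ℂ) :
    ∑ f ∈ Ioc R Y, (1 / (f : ℝ)) * primProd f e N₁ N₂ α β ≤
      ((Nat.log 2 Y + 1 : ℕ) : ℝ) *
      (16 * (√(N₁ : ℝ) * √(N₂ : ℝ) / R + 2 * √(N₁ : ℝ) + 2 * √(N₂ : ℝ) + 4 * Y) *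
        (√(∑ n ∈ range N₁, ‖α n‖ ^ 2) * √(∑ n ∈ range N₂, ‖β n‖ ^ 2))) := by
  classical
  have hRr : (0 : ℝ) < R := by exact_mod_cast hR
  have hG : ∀ f : ℕ, 0 ≤ (1 / (f : ℝ)) * primProd f e N₁ N₂ α β := fun f =>
    mul_nonneg (by positivity) (primProd_nonneg _ _ _ _ _ _)
  set I := (range (Nat.log 2 Y + 1)).filter (fun i => R * 2 ^ i < Y) with hI
  have hsub : Ioc R Y ⊆ I.biUnion (fun i => Ioc (R * 2 ^ i) (2 * (R * 2 ^ i))) := by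
    intro f hf
    rw [mem_Ioc] at hf
    rw [mem_biUnion]
    set i := Nat.log 2 ((f - 1) / R) with hi
    have h1 : (f - 1) / R ≠ 0 := by
      have : 1 ≤ (f - 1) / R := by
        rw [Nat.le_div_iff_mul_le hR]; omega
      omega
    have h2 : 2 ^ i ≤ (f - 1) / R := Nat.pow_log_le_self 2 h1
    have h3 : (f - 1) / R < 2 ^ (i + 1) := Nat.lt_pow_succ_log_self (by norm_num) _
    rw [Nat.le_div_iff_mul_le hR] at h2
    rw [Nat.div_lt_iff_lt_mul hR] at h3
    have h4 : R * 2 ^ i = 2 ^ i * R := mul_comm _ _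
    have h5 : 2 * (R * 2 ^ i) = 2 ^ (i + 1) * R := by ring
    refine ⟨i, ?_, ?_⟩
    · rw [hI, mem_filter, mem_range]
      refine ⟨?_, by omega⟩
      have : i ≤ Nat.log 2 Y := Nat.log_mono_right ((Nat.div_le_self _ _).trans (by omega))
      omega
    · rw [mem_Ioc]; omega
  calc _ ≤ ∑ f ∈ I.biUnion (fun i => Ioc (R * 2 ^ i) (2 * (R * 2 ^ i))),
        (1 / (f : ℝ)) * primProd f e N₁ N₂ α β :=
        sum_le_sum_of_subset_of_nonneg hsub fun f _ _ => hG f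
    _ ≤ ∑ i ∈ I, ∑ f ∈ Ioc (R * 2 ^ i) (2 * (R * 2 ^ i)),
        (1 / (f : ℝ)) * primProd f e N₁ N₂ α β := sum_biUnion_le_sum_sum _ _ _ hG
    _ ≤ ∑ i ∈ I,
      (16 * (√(N₁ : ℝ) * √(N₂ : ℝ) / R + 2 * √(N₁ : ℝ) + 2 * √(N₂ : ℝ) + 4 * Y) *
        (√(∑ n ∈ range N₁, ‖α n‖ ^ 2) * √(∑ n ∈ range N₂, ‖β n‖ ^ 2))) := by
        refine sum_le_sum fun i hi => ?_
        rw [hI, mem_filter] at hi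
        refine (sum_primProd_block_le (R * 2 ^ i) e N₁ N₂ (by positivity) α β).trans ?_
        have h1 : ((R * 2 ^ i : ℕ) : ℝ) ≤ Y := by exact_mod_cast hi.2.le
        have h2 : (R : ℝ) ≤ ((R * 2 ^ i : ℕ) : ℝ) := by
          exact_mod_cast Nat.le_mul_of_pos_right R (by positivity)
        gcongr
    _ ≤ _ := by
        rw [sum_const, nsmul_eq_mul]
        gcongr
        refine (card_filter_le _ _).trans ?_
        rw [card_range]

/-- Bilinear forms are equidistributed in residue classes on average over moduli without small
prime factors. -/
theorem bilinear_average (M : Finset ℕ) (R Y N₁ N₂ : ℕ) (hR : 0 < R) (h : ∀ m, ZMod m)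
    (hh : ∀ m ∈ M, IsUnit (h m)) (hM0 : ∀ m ∈ M, 0 < m) (hMY : ∀ m ∈ M, m ≤ Y)
    (hφ : ∀ m ∈ M, m ≤ 2 * m.totient) (hMR : ∀ m ∈ M, ∀ f, f ∣ m → f ≠ 1 → R < f)
    (α β : ℕ → ℂ) :
    ∑ m ∈ M, ‖∑ k ∈ range N₁, ∑ l ∈ range N₂, α k * β l * (apKer m (h m) (k * l) : ℂ)‖ ≤
      32 * ((Nat.log 2 Y + 2 : ℕ) : ℝ) ^ 2 *
      ((√(N₁ : ℝ) * √(N₂ : ℝ) / R + 2 * √(N₁ : ℝ) + 2 * √(N₂ : ℝ) + 4 * Y) *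
        (√(∑ n ∈ range N₁, ‖α n‖ ^ 2) * √(∑ n ∈ range N₂, ‖β n‖ ^ 2))) := by
  classical
  set W := (√(N₁ : ℝ) * √(N₂ : ℝ) / R + 2 * √(N₁ : ℝ) + 2 * √(N₂ : ℝ) + 4 * Y) *
        (√(∑ n ∈ range N₁, ‖α n‖ ^ 2) * √(∑ n ∈ range N₂, ‖β n‖ ^ 2)) with hW
  set G : ℕ × ℕ → ℝ := fun x => 2 / ((x.1 : ℝ) * x.2) * primProd x.1 x.2 N₁ N₂ α β with hG
  have hG0 : ∀ x, 0 ≤ G x := fun x => mul_nonneg (by positivity) (primProd_nonneg _ _ _ _ _ _)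
  have hW0 : 0 ≤ W := by positivity
  calc _ ≤ ∑ m ∈ M, ∑ f ∈ m.divisors.erase 1, G (f, m / f) := by
        refine sum_le_sum fun m hm => ?_
        have : NeZero m := ⟨(hM0 m hm).ne'⟩
        refine (norm_bilinear_apKer_le m (h m) (hh m hm) N₁ N₂ α β).trans ?_
        rw [mul_sum]
        refine sum_le_sum fun f hf => ?_
        have hfm := (Nat.mem_divisors.1 (mem_erase.1 hf).2).1
        simp only [hG]
        refine mul_le_mul_of_nonneg_right ?_ (primProd_nonneg _ _ _ _ _ _)
        rw [← Nat.cast_mul, Nat.mul_div_cancel' hfm]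
        have hm0 : (0 : ℝ) < m := by exact_mod_cast hM0 m hm
        have hφ0 : (0 : ℝ) < m.totient := by exact_mod_cast Nat.totient_pos.2 (hM0 m hm)
        rw [div_le_div_iff₀ hφ0 hm0]
        have : (m : ℝ) ≤ 2 * m.totient := by exact_mod_cast hφ m hm
        linarith
    _ = ∑ x ∈ (M.sigma fun m => m.divisors.erase 1).image
          (fun x : (_ : ℕ) × ℕ => (x.2, x.1 / x.2)), G x := by
        rw [sum_image, sum_sigma]
        rintro ⟨m, f⟩ h1 ⟨m', f'⟩ h2 heq
        simp only [mem_coe, mem_sigma, mem_erase, Nat.mem_divisors] at h1 h2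
        simp only [Prod.mk.injEq] at heq
        obtain ⟨rfl, h3⟩ := heq
        have : m = m' := by
          rw [← Nat.mul_div_cancel' h1.2.2.1, ← Nat.mul_div_cancel' h2.2.2.1, h3]
        subst this
        rfl
    _ ≤ ∑ x ∈ Ioc R Y ×ˢ Icc 1 Y, G x := by
        refine sum_le_sum_of_subset_of_nonneg ?_ fun x _ _ => hG0 x
        intro x hx
        obtain ⟨⟨m, f⟩, h1, rfl⟩ := mem_image.1 hx
        simp only [mem_sigma, mem_erase, Nat.mem_divisors] at h1
        obtain ⟨hm, hf1, hfm, -⟩ := h1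
        have hf0 : 0 < f := Nat.pos_of_dvd_of_pos hfm (hM0 m hm)
        have hfle := Nat.le_of_dvd (hM0 m hm) hfm
        have h2 := Nat.div_pos hfle hf0
        have h3 := Nat.div_le_self m f
        have h4 := hMY m hm
        have h5 := hMR m hm f hfm hf1
        simp only [mem_product, mem_Ioc, mem_Icc]
        omega
    _ = ∑ e ∈ Icc 1 Y, 2 * (1 / (e : ℝ)) *
        ∑ f ∈ Ioc R Y, (1 / (f : ℝ)) * primProd f e N₁ N₂ α β := by
        rw [sum_product_right]
        refine sum_congr rfl fun e _ => ?_
        rw [mul_sum]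
        refine sum_congr rfl fun f _ => ?_
        simp only [hG]
        rw [← mul_assoc]
        congr 1
        rw [div_mul_eq_div_div]
        ring
    _ ≤ ∑ e ∈ Icc 1 Y, 2 * (1 / (e : ℝ)) * (((Nat.log 2 Y + 2 : ℕ) : ℝ) * (16 * W)) := by
        refine sum_le_sum fun e _ => ?_
        refine mul_le_mul_of_nonneg_left ?_ (by positivity)
        refine (sum_primProd_le R Y e N₁ N₂ hR α β).trans ?_
        rw [mul_assoc 16, ← hW]
        gcongr
        omega
    _ = 32 * ((Nat.log 2 Y + 2 : ℕ) : ℝ) * W * ∑ e ∈ Icc 1 Y, (1 / (e : ℝ)) := by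
        rw [mul_sum]
        refine sum_congr rfl fun e _ => ?_
        ring
    _ ≤ 32 * ((Nat.log 2 Y + 2 : ℕ) : ℝ) * W * ((Nat.log 2 Y + 2 : ℕ) : ℝ) := by
        gcongr
        have h1 := harmonic_le_one_add_log Y
        rw [harmonic_eq_sum_Icc] at h1
        push_cast at h1
        simp_rw [one_div]
        refine h1.trans ?_
        rcases Nat.eq_zero_or_pos Y with rfl | hY
        · simp
        have h2 : (Y : ℝ) ≤ 2 ^ (Nat.log 2 Y + 1) := by
          exact_mod_cast (Nat.lt_pow_succ_log_self (by norm_num : 1 < 2) Y).le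
        have h3 := Real.log_le_log (by exact_mod_cast hY) h2
        rw [Real.log_pow] at h3
        have h4 : Real.log 2 ≤ 1 := by
          have := Real.log_two_lt_d9; linarith
        push_cast at h3 ⊢
        have h5 : (0 : ℝ) ≤ Nat.log 2 Y := by positivity
        nlinarith
    _ = _ := by ring

end BilinearForms

section PolyaVinogradov

open Finset

lemma sum_range_mul_eq (J M : ℕ) (f : ℕ → ℝ) :
    ∑ t ∈ range (J * M), f t = ∑ j ∈ range J, ∑ b ∈ range M, f (b + j * M) := by
  induction J with
  | zero => simp
  | succ J ih =>
    rw [add_mul, one_mul, sum_range_add, ih, sum_range_succ]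
    congr 1
    exact sum_congr rfl fun b _ => by rw [add_comm]

lemma abs_sub_le_sum_abs_diff (F : ℕ → ℝ) (s M b : ℕ) (hb : b < M) :
    |F (s + b) - F s| ≤ ∑ i ∈ range M, |F (s + i + 1) - F (s + i)| := by
  have h : F (s + b) - F s = ∑ i ∈ range b, (F (s + i + 1) - F (s + i)) := by
    have := sum_range_sub (fun i => F (s + i)) b
    simpa [add_assoc] using this.symm
  rw [h]
  refine (abs_sum_le_sum_abs _ _).trans (sum_le_sum_of_subset_of_nonneg ?_ fun _ _ _ => abs_nonneg _)
  exact range_subset_range.2 hb.le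

lemma abs_sum_class_sub_le (F : ℕ → ℝ) (J M b : ℕ) (hb : b < M) :
    |∑ j ∈ range J, F (b + j * M) - ∑ j ∈ range J, F (j * M)| ≤
      ∑ i ∈ range (J * M), |F (i + 1) - F i| := by
  rw [sum_range_mul_eq, ← sum_sub_distrib]
  refine (abs_sum_le_sum_abs _ _).trans (sum_le_sum fun j _ => ?_)
  have := abs_sub_le_sum_abs_diff F (j * M) M b hb
  rw [add_comm b]
  refine this.trans (le_of_eq (sum_congr rfl fun i _ => ?_))
  rw [add_comm i (j * M)]

lemma sum_range_eq_sum_zmod (n : ℕ) [NeZero n] (G : ZMod n → ℝ) :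
    ∑ b ∈ range n, G b = ∑ z : ZMod n, G z := by
  refine sum_nbij' (fun b => (b : ZMod n)) (fun z => z.val) ?_ ?_ ?_ ?_ ?_
  · simp
  · intro z _; simpa using ZMod.val_lt z
  · intro b hb; exact ZMod.val_cast_of_lt (mem_range.1 hb)
  · intro z _; simp
  · simp

/-- Summing over a residue class modulo `3` runs through the residues modulo `m`. -/
lemma sum_range_three_mul (m d c : ℕ) [NeZero m] (hm : 0 < m) (h3 : Nat.Coprime 3 m) (hd : d.Coprime (3 * m))
    (hc : c < 3) (H : ZMod m → ℝ) :
    ∑ b ∈ range (3 * m), (if d * b % 3 = c then H ((d * b : ℕ) : ZMod m) else 0) =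
      ∑ z : ZMod m, H z := by
  have : NeZero (3 * m) := ⟨by omega⟩
  let e := ZMod.chineseRemainder h3
  have key : ∀ b : ℕ, (if d * b % 3 = c then H ((d * b : ℕ) : ZMod m) else 0) =
      (fun z : ZMod (3 * m) => if (e ((d : ZMod (3 * m)) * z)).1 = (c : ZMod 3) then
        H ((e ((d : ZMod (3 * m)) * z)).2) else 0) (b : ZMod (3 * m)) := by
    intro b
    have h1 : e ((d : ZMod (3 * m)) * (b : ZMod (3 * m))) =
        (((d * b : ℕ) : ZMod 3), ((d * b : ℕ) : ZMod m)) := by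
      rw [← Nat.cast_mul, map_natCast]; rfl
    simp only [h1]
    have h2 : (((d * b : ℕ) : ZMod 3) = (c : ZMod 3)) ↔ d * b % 3 = c := by
      rw [ZMod.natCast_eq_natCast_iff']
      rw [Nat.mod_eq_of_lt hc]
    simp only [h2]
  rw [sum_congr rfl fun b _ => key b]
  refine (sum_range_eq_sum_zmod (3 * m) (fun z => if (e ((d : ZMod (3 * m)) * z)).1 = (c : ZMod 3)
    then H ((e ((d : ZMod (3 * m)) * z)).2) else 0)).trans ?_
  have hu : IsUnit (d : ZMod (3 * m)) := (ZMod.isUnit_iff_coprime d _).2 hd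
  obtain ⟨u, hu⟩ := hu
  rw [← Equiv.sum_comp (Units.mulLeft u⁻¹)]
  rw [← Equiv.sum_comp e.symm.toEquiv]
  have : ∀ y : ZMod 3 × ZMod m, e ((d : ZMod (3 * m)) * (Units.mulLeft u⁻¹ (e.symm.toEquiv y))) = y := by
    intro y
    rw [← hu, Units.mulLeft_apply, ← mul_assoc, Units.mul_inv, one_mul]
    exact e.apply_symm_apply y
  simp only [this]
  rw [Fintype.sum_prod_type]
  rw [sum_eq_single (c : ZMod 3)]
  · simp
  · intro b _ hb; simp [hb]
  · simp

lemma sum_apKer_class (m d c : ℕ) (hm : 0 < m) (h3 : Nat.Coprime 3 m) (hd : d.Coprime (3 * m))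
    (hc : c < 3) (h : ZMod m) :
    ∑ b ∈ range (3 * m), (if d * b % 3 = c then apKer m h (d * b) else 0) = 0 ∧
    ∑ b ∈ range (3 * m), |if d * b % 3 = c then apKer m h (d * b) else 0| ≤ 2 := by
  classical
  have : NeZero m := ⟨hm.ne'⟩
  have hφ : (0 : ℝ) < m.totient := by exact_mod_cast Nat.totient_pos.2 hm
  have hu : ∑ z : ZMod m, (if IsUnit z then (1 : ℝ) else 0) / m.totient = 1 := by
    rw [← sum_div, div_eq_one_iff_eq hφ.ne', sum_boole]
    have : Fintype.card (ZMod m)ˣ = #{z : ZMod m | IsUnit z} := by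
      rw [← Fintype.card_subtype]
      refine Fintype.card_congr ?_
      exact Equiv.ofBijective (fun u => ⟨(u : ZMod m), u.isUnit⟩)
        ⟨fun a b hab => Units.ext (by simpa using hab), fun ⟨z, hz⟩ => ⟨hz.unit, rfl⟩⟩
    rw [← this, ZMod.card_units_eq_totient]
  have hh : ∑ z : ZMod m, (if z = h then (1 : ℝ) else 0) = 1 := by simp
  have hk : ∀ b : ℕ, apKer m h b = (fun z : ZMod m => (if z = h then (1 : ℝ) else 0) -
      (if IsUnit z then (1 : ℝ) else 0) / m.totient) (b : ZMod m) := by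
    intro b
    simp only [apKer, ZMod.isUnit_iff_coprime]
  constructor
  · simp only [hk]
    refine (sum_range_three_mul m d c hm h3 hd hc (fun z : ZMod m => (if z = h then (1 : ℝ) else 0) -
      (if IsUnit z then (1 : ℝ) else 0) / m.totient)).trans ?_
    rw [sum_sub_distrib, hu, hh, sub_self]
  · have : ∀ b, |if d * b % 3 = c then apKer m h (d * b) else 0| ≤
        if d * b % 3 = c then (fun z : ZMod m => (if z = h then (1 : ℝ) else 0) +
      (if IsUnit z then (1 : ℝ) else 0) / m.totient) ((d * b : ℕ) : ZMod m) else 0 := by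
      intro b
      split_ifs
      · rw [hk]
        refine (abs_sub _ _).trans (le_of_eq ?_)
        rw [abs_of_nonneg (by positivity), abs_of_nonneg (by positivity)]
      · simp
    refine (sum_le_sum fun b _ => this b).trans ?_
    refine (sum_range_three_mul m d c hm h3 hd hc (fun z : ZMod m =>
      (if z = h then (1 : ℝ) else 0) + (if IsUnit z then (1 : ℝ) else 0) / m.totient)).le.trans ?_
    rw [sum_add_distrib, hu, hh]
    norm_num

/-- Sums of slowly varying functions have small discrepancy in residue classes. -/
theorem abs_sum_mul_apKer_le (m d c N : ℕ) (hm : 0 < m) (h3 : Nat.Coprime 3 m)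
    (hc0 : c ≠ 0) (hc : c < 3) (h : ZMod m) (hh : IsUnit h) (F : ℕ → ℝ) (hF : ∀ t, N ≤ t → F t = 0) :
    |∑ t ∈ range N, if d * t % 3 = c then F t * apKer m h (d * t) else 0| ≤
      2 * ∑ i ∈ range N, |F (i + 1) - F i| := by
  have hV : 0 ≤ 2 * ∑ i ∈ range N, |F (i + 1) - F i| := by positivity
  by_cases hd : d.Coprime (3 * m)
  · have hN : N ≤ N * (3 * m) := Nat.le_mul_of_pos_right _ (by omega)
    have ext1 : ∑ t ∈ range N, (if d * t % 3 = c then F t * apKer m h (d * t) else 0) =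
        ∑ t ∈ range (N * (3 * m)), if d * t % 3 = c then F t * apKer m h (d * t) else 0 := by
      refine sum_subset (range_subset_range.2 hN) fun t _ ht => ?_
      rw [hF t (by simpa using ht)]; simp
    have ext2 : ∑ i ∈ range N, |F (i + 1) - F i| = ∑ i ∈ range (N * (3 * m)), |F (i + 1) - F i| := by
      refine sum_subset (range_subset_range.2 hN) fun t _ ht => ?_
      have : N ≤ t := by simpa using ht
      rw [hF t this, hF (t + 1) (by omega)]; simp
    rw [ext1, ext2, sum_range_mul_eq, sum_comm]
    obtain ⟨w0, w1⟩ := sum_apKer_class m d c hm h3 hd hc h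
    set w : ℕ → ℝ := fun b => if d * b % 3 = c then apKer m h (d * b) else 0 with hw
    have hwp : ∀ b j, (if d * (b + j * (3 * m)) % 3 = c then
        F (b + j * (3 * m)) * apKer m h (d * (b + j * (3 * m))) else 0) =
        w b * F (b + j * (3 * m)) := by
      intro b j
      have e1 : d * (b + j * (3 * m)) % 3 = d * b % 3 := by
        have : d * (b + j * (3 * m)) = d * b + 3 * (d * j * m) := by ring
        rw [this, Nat.add_mul_mod_self_left]
      have e2 : apKer m h (d * (b + j * (3 * m))) = apKer m h (d * b) := by
        have : d * (b + j * (3 * m)) = d * b + (d * j * 3) * m := by ring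
        unfold apKer
        rw [this]
        simp
      rw [e1, e2]
      simp only [hw]
      split_ifs <;> ring
    simp only [hwp]
    simp only [← mul_sum]
    have : ∑ b ∈ range (3 * m), w b * ∑ j ∈ range N, F (b + j * (3 * m)) =
        ∑ b ∈ range (3 * m), w b * (∑ j ∈ range N, F (b + j * (3 * m)) -
          ∑ j ∈ range N, F (j * (3 * m))) := by
      simp only [mul_sub, sum_sub_distrib]
      rw [← sum_mul, w0, zero_mul, sub_zero]
    rw [this]
    refine (abs_sum_le_sum_abs _ _).trans ?_
    calc _ ≤ ∑ b ∈ range (3 * m), |w b| * ∑ i ∈ range (N * (3 * m)), |F (i + 1) - F i| := by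
          refine sum_le_sum fun b hb => ?_
          rw [abs_mul]
          exact mul_le_mul_of_nonneg_left (abs_sum_class_sub_le F N (3 * m) b (mem_range.1 hb))
            (abs_nonneg _)
      _ ≤ _ := by
          rw [← sum_mul]
          exact mul_le_mul_of_nonneg_right w1 (by positivity)
  · have : ∀ t, (if d * t % 3 = c then F t * apKer m h (d * t) else 0) = 0 := by
      intro t
      split_ifs with ht
      · suffices apKer m h (d * t) = 0 by rw [this, mul_zero]
        have h3d : d.Coprime 3 := by
          rw [Nat.coprime_comm, Nat.Prime.coprime_iff_not_dvd Nat.prime_three]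
          intro hdvd
          exact hc0 (by rw [← ht]; exact Nat.mod_eq_zero_of_dvd (hdvd.mul_right t))
        have hdm : ¬ d.Coprime m := fun h' => hd (h3d.mul_right h')
        have hdt : ¬ (d * t).Coprime m := fun h' => hdm (Nat.Coprime.coprime_mul_right h')
        unfold apKer
        rw [if_neg hdt, if_neg]
        · simp
        · rintro rfl
          exact hdt ((ZMod.isUnit_iff_coprime _ _).1 hh)
      · rfl
    simp only [this]
    simpa using hV

end PolyaVinogradov

section ProgressionErrors

open Finset

/-- A tent-shaped weight in the variable `log (n / x)`, supported on `[x, 256 x]`. -/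
noncomputable def wt (x n : ℕ) : ℝ :=
  max 0 (Real.log 16 - |Real.log n - Real.log x - Real.log 16|)

lemma log_sixteen_pos : 0 < Real.log 16 := Real.log_pos (by norm_num)

lemma log_sixteen_lt : Real.log 16 < 2.8 := by
  have : Real.log 16 = 4 * Real.log 2 := by
    rw [show (16 : ℝ) = 2 ^ 4 by norm_num, Real.log_pow]; norm_num
  rw [this]; have := Real.log_two_lt_d9; linarith

lemma log_sixteen_gt : 2.7 < Real.log 16 := by
  have : Real.log 16 = 4 * Real.log 2 := by
    rw [show (16 : ℝ) = 2 ^ 4 by norm_num, Real.log_pow]; norm_num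
  rw [this]; have := Real.log_two_gt_d9; linarith

lemma wt_nonneg (x n : ℕ) : 0 ≤ wt x n := le_max_left _ _

lemma wt_le (x n : ℕ) : wt x n ≤ Real.log 16 :=
  max_le log_sixteen_pos.le (by have := abs_nonneg (Real.log n - Real.log x - Real.log 16); linarith)

lemma wt_eq_zero_of_le {x n : ℕ} (hx : 0 < x) (h : n ≤ x) : wt x n = 0 := by
  refine max_eq_left ?_
  have : Real.log n ≤ Real.log x := by
    rcases Nat.eq_zero_or_pos n with rfl | hn
    · simpa using Real.log_nonneg (by exact_mod_cast hx)
    · exact Real.log_le_log (by exact_mod_cast hn) (by exact_mod_cast h)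
  have h2 := neg_abs_le (Real.log n - Real.log x - Real.log 16)
  linarith

lemma wt_eq_zero_of_ge {x n : ℕ} (hx : 0 < x) (h : 256 * x ≤ n) : wt x n = 0 := by
  refine max_eq_left ?_
  have hx' : (0 : ℝ) < x := by exact_mod_cast hx
  have : Real.log 16 + Real.log 16 + Real.log x ≤ Real.log n := by
    rw [← Real.log_mul (by norm_num) (by norm_num), ← Real.log_mul (by norm_num) hx'.ne']
    exact Real.log_le_log (by positivity) (by norm_num; exact_mod_cast h)
  have h2 := le_abs_self (Real.log n - Real.log x - Real.log 16)
  linarith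

lemma abs_wt_sub_le (x m n : ℕ) : |wt x m - wt x n| ≤ |Real.log m - Real.log n| := by
  unfold wt
  refine (abs_max_sub_max_le_max _ _ _ _).trans ?_
  rw [sub_self, abs_zero]
  refine max_le (abs_nonneg _) ?_
  have h1 := abs_abs_sub_abs_le (Real.log n - Real.log x - Real.log 16)
    (Real.log m - Real.log x - Real.log 16)
  have h2 : (Real.log n - Real.log x - Real.log 16) - (Real.log m - Real.log x - Real.log 16) =
    -(Real.log m - Real.log n) := by ring
  rw [h2, abs_neg] at h1
  rwa [sub_sub_sub_cancel_left]

lemma wt_ge {x n : ℕ} (hx : 0 < x) (h1 : 4 * x ≤ n) (h2 : n ≤ 64 * x) : 1 ≤ wt x n := by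
  have hx' : (0 : ℝ) < x := by exact_mod_cast hx
  have hn' : (0 : ℝ) < n := by exact_mod_cast (by omega : 0 < n)
  have e4 : Real.log 16 = Real.log 4 + Real.log 4 := by
    rw [← Real.log_mul (by norm_num) (by norm_num)]; norm_num
  have e64 : Real.log 64 = Real.log 16 + Real.log 4 := by
    rw [← Real.log_mul (by norm_num) (by norm_num)]; norm_num
  have a1 : Real.log 4 + Real.log x ≤ Real.log n := by
    rw [← Real.log_mul (by norm_num) hx'.ne']
    exact Real.log_le_log (by positivity) (by exact_mod_cast h1)
  have a2 : Real.log n ≤ Real.log 64 + Real.log x := by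
    rw [← Real.log_mul (by norm_num) hx'.ne']
    exact Real.log_le_log (by positivity) (by exact_mod_cast h2)
  refine le_max_of_le_right ?_
  have := log_sixteen_gt
  have : |Real.log n - Real.log x - Real.log 16| ≤ Real.log 4 := abs_le.2 ⟨by linarith, by linarith⟩
  linarith

lemma log_succ_sub_le (t : ℕ) (ht : 0 < t) :
    |Real.log ((t + 1 : ℕ) : ℝ) - Real.log t| ≤ 1 / t := by
  have ht' : (0 : ℝ) < t := by exact_mod_cast ht
  have h1 : Real.log t ≤ Real.log ((t + 1 : ℕ) : ℝ) :=
    Real.log_le_log ht' (by push_cast; linarith)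
  rw [abs_of_nonneg (by linarith), ← Real.log_div (by positivity) ht'.ne']
  refine (Real.log_le_sub_one_of_pos (by positivity)).trans (le_of_eq ?_)
  push_cast; field_simp; ring

lemma abs_wt_mul_succ_sub_le (x d t : ℕ) (hd : 0 < d) (ht : 0 < t) :
    |wt x (d * (t + 1)) - wt x (d * t)| ≤ 1 / t := by
  refine (abs_wt_sub_le x _ _).trans ?_
  have ht' : (t : ℝ) ≠ 0 := by positivity
  have hd' : (d : ℝ) ≠ 0 := by positivity
  have := log_succ_sub_le t ht
  rw [Nat.cast_mul, Nat.cast_mul, Real.log_mul hd' (by positivity), Real.log_mul hd' ht']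
  rwa [add_sub_add_left_eq_sub]

lemma sum_one_div_le (N : ℕ) : ∑ t ∈ range N, (1 : ℝ) / (t + 1 : ℕ) ≤ 1 + Real.log N := by
  have := harmonic_le_one_add_log N
  refine le_trans (le_of_eq ?_) this
  rw [harmonic]; push_cast; simp

lemma wt_zero (x : ℕ) : wt x 0 = 0 := by
  refine max_eq_left ?_
  have : 0 ≤ Real.log (x : ℝ) := Real.log_natCast_nonneg x
  have h2 := neg_abs_le (Real.log (0 : ℕ) - Real.log x - Real.log 16)
  simp only [Nat.cast_zero, Real.log_zero] at *
  linarith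

lemma variation_wt_le (x d N : ℕ) (hd : 0 < d) :
    ∑ i ∈ range (N + 1), |wt x (d * (i + 1)) - wt x (d * i)| ≤ 4 + Real.log N := by
  rw [sum_range_succ']
  have h0 : |wt x (d * (0 + 1)) - wt x (d * 0)| ≤ 3 := by
    rw [mul_zero, wt_zero, sub_zero, abs_of_nonneg (wt_nonneg _ _)]
    have := wt_le x (d * (0 + 1)); have := log_sixteen_lt; linarith
  have h1 := sum_one_div_le N
  have h2 : ∑ i ∈ range N, |wt x (d * (i + 1 + 1)) - wt x (d * (i + 1))| ≤
      ∑ t ∈ range N, (1 : ℝ) / (t + 1 : ℕ) :=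
    sum_le_sum fun i _ => abs_wt_mul_succ_sub_le x d (i + 1) hd (by omega)
  linarith

lemma variation_log_wt_le (x d N : ℕ) (hd : 0 < d) :
    ∑ i ∈ range (N + 1), |Real.log ((i + 1 : ℕ) : ℝ) * wt x (d * (i + 1)) -
      Real.log i * wt x (d * i)| ≤ (3 + Real.log N) * (1 + Real.log N) := by
  rw [sum_range_succ']
  have hL : 0 ≤ Real.log N := Real.log_natCast_nonneg N
  have h1 := sum_one_div_le N
  have h2 : ∀ i ∈ range N, |Real.log ((i + 1 + 1 : ℕ) : ℝ) * wt x (d * (i + 1 + 1)) -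
      Real.log ((i + 1 : ℕ) : ℝ) * wt x (d * (i + 1))| ≤
      (3 + Real.log N) * (1 / (i + 1 : ℕ)) := by
    intro i hi
    have hi := mem_range.1 hi
    have e : Real.log ((i + 1 + 1 : ℕ) : ℝ) * wt x (d * (i + 1 + 1)) -
      Real.log ((i + 1 : ℕ) : ℝ) * wt x (d * (i + 1)) =
      (Real.log ((i + 1 + 1 : ℕ) : ℝ) - Real.log ((i + 1 : ℕ) : ℝ)) * wt x (d * (i + 1 + 1)) +
      Real.log ((i + 1 : ℕ) : ℝ) * (wt x (d * (i + 1 + 1)) - wt x (d * (i + 1))) := by ring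
    rw [e]
    refine (abs_add_le _ _).trans ?_
    rw [abs_mul, abs_mul, add_mul]
    have b1 := log_succ_sub_le (i + 1) (by omega)
    have b2 := abs_wt_mul_succ_sub_le x d (i + 1) hd (by omega)
    have b3 : |wt x (d * (i + 1 + 1))| ≤ 3 := by
      rw [abs_of_nonneg (wt_nonneg _ _)]
      have := wt_le x (d * (i + 1 + 1)); have := log_sixteen_lt; linarith
    have b4 : |Real.log ((i + 1 : ℕ) : ℝ)| ≤ Real.log N := by
      rw [abs_of_nonneg (Real.log_natCast_nonneg _)]
      exact Real.log_le_log (by positivity) (by exact_mod_cast hi)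
    have p1 := mul_le_mul b1 b3 (abs_nonneg _) (by positivity)
    have p2 := mul_le_mul b4 b2 (abs_nonneg _) hL
    linarith
  have h3 := sum_le_sum h2
  rw [← mul_sum] at h3
  have h4 := mul_le_mul_of_nonneg_left h1 (by linarith : 0 ≤ 3 + Real.log N)
  have h0 : |Real.log ((0 + 1 : ℕ) : ℝ) * wt x (d * (0 + 1)) - Real.log (0 : ℕ) * wt x (d * 0)| = 0 := by
    simp
  rw [h0]
  linarith

lemma sum_mul_arith (f g : ArithmeticFunction ℝ) (G : ℕ → ℝ) (N : ℕ) (hG : ∀ n, N ≤ n → G n = 0) :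
    ∑ n ∈ range N, (f * g) n * G n = ∑ d ∈ range N, ∑ t ∈ range N, f d * g t * G (d * t) := by
  have h1 : ∀ n ∈ range N, (f * g) n * G n =
      ∑ d ∈ range N, ∑ t ∈ range N, if d * t = n then f d * g t * G (d * t) else 0 := by
    intro n hn
    have hn := mem_range.1 hn
    rw [ArithmeticFunction.mul_apply, sum_mul, ← sum_product', ← sum_filter]
    rcases Nat.eq_zero_or_pos n with rfl | hn0
    · simp only [Nat.divisorsAntidiagonal_zero, sum_empty]
      refine (sum_eq_zero fun y hy => ?_).symm
      rcases Nat.mul_eq_zero.1 (mem_filter.1 hy).2 with h | h <;> simp [h]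
    · refine sum_congr_of_eq_on_inter ?_ ?_ ?_
      · intro y hy hy'
        exfalso; apply hy'
        have := Nat.mem_divisorsAntidiagonal.1 hy
        have ha : y.1 ≤ n := Nat.le_of_dvd hn0 ⟨y.2, this.1.symm⟩
        have hb : y.2 ≤ n := Nat.le_of_dvd hn0 ⟨y.1, by rw [mul_comm]; exact this.1.symm⟩
        simp only [mem_filter, mem_product, mem_range]
        exact ⟨⟨by omega, by omega⟩, this.1⟩
      · intro y hy hy'
        exfalso; apply hy'
        exact Nat.mem_divisorsAntidiagonal.2 ⟨(mem_filter.1 hy).2, hn0.ne'⟩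
      · intro y hy _
        rw [(Nat.mem_divisorsAntidiagonal.1 hy).1]
  rw [sum_congr rfl h1, sum_comm]
  refine sum_congr rfl fun d _ => ?_
  rw [sum_comm]
  refine sum_congr rfl fun t _ => ?_
  rw [sum_ite_eq]
  split_ifs with h
  · rfl
  · rw [hG _ (by simpa using h), mul_zero]

end ProgressionErrors

section ProgressionAverages

open Finset

lemma card_divisors_sq_le (l N : ℕ) (hl : l < N) :
    l.divisors.card ^ 2 ≤ #{y ∈ (Icc 1 N ×ˢ Icc 1 N) ×ˢ Icc 1 N | y.1.1 * y.1.2 * y.2 ∣ l ∧ 0 < l} := by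
  rw [sq, ← card_product]
  refine card_le_card_of_injOn (fun y => ((y.1.gcd y.2, y.1 / y.1.gcd y.2), y.2 / y.1.gcd y.2)) ?_ ?_
  · intro y hy
    obtain ⟨h1, h2⟩ := mem_product.1 (mem_coe.1 hy)
    obtain ⟨d1, l0⟩ := Nat.mem_divisors.1 h1
    obtain ⟨d2, -⟩ := Nat.mem_divisors.1 h2
    have p1 : 0 < y.1 := Nat.pos_of_dvd_of_pos d1 (Nat.pos_of_ne_zero l0)
    have p2 : 0 < y.2 := Nat.pos_of_dvd_of_pos d2 (Nat.pos_of_ne_zero l0)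
    have l1 := Nat.le_of_dvd (Nat.pos_of_ne_zero l0) d1
    have l2 := Nat.le_of_dvd (Nat.pos_of_ne_zero l0) d2
    have g0 : 0 < y.1.gcd y.2 := Nat.gcd_pos_of_pos_left _ p1
    have g1 := Nat.gcd_dvd_left y.1 y.2
    have g2 := Nat.gcd_dvd_right y.1 y.2
    have q1 := Nat.div_pos (Nat.le_of_dvd p1 g1) g0
    have q2 := Nat.div_pos (Nat.le_of_dvd p2 g2) g0
    have q3 := Nat.div_le_self y.1 (y.1.gcd y.2)
    have q4 := Nat.div_le_self y.2 (y.1.gcd y.2)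
    have q5 := Nat.le_of_dvd p1 g1
    refine mem_coe.2 (mem_filter.2 ⟨?_, ?_, Nat.pos_of_ne_zero l0⟩)
    · simp only [mem_product, mem_Icc]; omega
    · simp only
      rw [Nat.mul_div_cancel' g1, ← Nat.mul_div_assoc _ g2]
      exact Nat.lcm_dvd d1 d2
  · intro y _ z _ h
    simp only [Prod.mk.injEq] at h
    obtain ⟨⟨h1, h2⟩, h3⟩ := h
    ext
    · rw [← Nat.div_mul_cancel (Nat.gcd_dvd_left y.1 y.2), h2, h1,
        Nat.div_mul_cancel (Nat.gcd_dvd_left z.1 z.2)]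
    · rw [← Nat.div_mul_cancel (Nat.gcd_dvd_right y.1 y.2), h3, h1,
        Nat.div_mul_cancel (Nat.gcd_dvd_right z.1 z.2)]

lemma card_multiples_le (N d : ℕ) :
    (#{l ∈ range N | d ∣ l ∧ 0 < l} : ℝ) ≤ N / d := by
  have : #{l ∈ range N | d ∣ l ∧ 0 < l} ≤ N / d := by
    rw [← Nat.Ioc_filter_dvd_card_eq_div N d]
    refine card_le_card fun l hl => ?_
    obtain ⟨h1, h2, h3⟩ := mem_filter.1 hl
    exact mem_filter.2 ⟨mem_Ioc.2 ⟨h3, (mem_range.1 h1).le⟩, h2⟩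
  calc _ ≤ ((N / d : ℕ) : ℝ) := by exact_mod_cast this
    _ ≤ _ := Nat.cast_div_le

lemma sum_Icc_inv_le (N : ℕ) : ∑ d ∈ Icc 1 N, (1 : ℝ) / d ≤ 1 + Real.log N := by
  refine le_trans (le_of_eq ?_) (harmonic_le_one_add_log N)
  rw [harmonic_eq_sum_Icc]; push_cast; simp

lemma sum_card_divisors_sq_le (N : ℕ) :
    ∑ l ∈ range N, ((l.divisors.card : ℝ)) ^ 2 ≤ N * (1 + Real.log N) ^ 3 := by
  have hH := sum_Icc_inv_le N
  have hH0 : 0 ≤ ∑ d ∈ Icc 1 N, (1 : ℝ) / d := sum_nonneg fun _ _ => by positivity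
  set T := (Icc 1 N ×ˢ Icc 1 N) ×ˢ Icc 1 N with hT
  calc ∑ l ∈ range N, ((l.divisors.card : ℝ)) ^ 2
      ≤ ∑ l ∈ range N, ∑ y ∈ T, if y.1.1 * y.1.2 * y.2 ∣ l ∧ 0 < l then (1 : ℝ) else 0 := by
        refine sum_le_sum fun l hl => ?_
        rw [sum_boole]
        exact_mod_cast card_divisors_sq_le l N (mem_range.1 hl)
    _ = ∑ y ∈ T, (#{l ∈ range N | y.1.1 * y.1.2 * y.2 ∣ l ∧ 0 < l} : ℝ) := by
        rw [sum_comm]; simp only [sum_boole]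
    _ ≤ ∑ y ∈ T, N * ((1 : ℝ) / y.1.1 * (1 / y.1.2) * (1 / y.2)) := by
        refine sum_le_sum fun y _ => ?_
        refine (card_multiples_le N _).trans (le_of_eq ?_)
        push_cast
        rw [one_div_mul_one_div, one_div_mul_one_div, mul_one_div]
    _ = N * (∑ d ∈ Icc 1 N, (1 : ℝ) / d) ^ 3 := by
        rw [← mul_sum, hT, sum_product, sum_product]
        simp only [← mul_sum, ← sum_mul]
        ring
    _ ≤ _ := by gcongr

lemma integral_indicator_mul (p q W : ℝ) (hp0 : 0 ≤ p - Real.log 16) (hpW : p ≤ W) :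
    ∫ u in (0 : ℝ)..W, (Set.Ioc (p - Real.log 16) p).indicator (1 : ℝ → ℝ) u *
      (Set.Ico q (q + Real.log 16)).indicator (1 : ℝ → ℝ) u =
      max 0 (Real.log 16 - |p - q - Real.log 16|) := by
  have hκ := log_sixteen_pos
  have hset : ∀ u, (Set.Ioc (p - Real.log 16) p).indicator (1 : ℝ → ℝ) u *
      (Set.Ico q (q + Real.log 16)).indicator (1 : ℝ → ℝ) u =
      (Set.Ioc (p - Real.log 16) p ∩ Set.Ico q (q + Real.log 16)).indicator (1 : ℝ → ℝ) u := by
    intro u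
    rw [Set.inter_indicator_one]; rfl
  simp only [hset]
  rw [intervalIntegral.integral_of_le (by linarith),
    MeasureTheory.integral_indicator_one (measurableSet_Ioc.inter measurableSet_Ico),
    MeasureTheory.measureReal_restrict_apply (measurableSet_Ioc.inter measurableSet_Ico)]
  have e1 : Set.Ioc (p - Real.log 16) p ∩ Set.Ico q (q + Real.log 16) ∩ Set.Ioc 0 W =
      Set.Ioc (p - Real.log 16) p ∩ Set.Ico q (q + Real.log 16) := by
    refine Set.inter_eq_left.2 fun u hu => ⟨?_, ?_⟩
    · have := hu.1.1; linarith
    · have := hu.1.2; linarith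
  rw [e1]
  have key : ∀ a b : ℝ, MeasureTheory.volume.real (Set.Ioo a b) = max 0 (b - a) := by
    intro a b
    rw [MeasureTheory.measureReal_def, Real.volume_Ioo, ENNReal.toReal_ofReal', max_comm]
  have e2 : MeasureTheory.volume.real (Set.Ioc (p - Real.log 16) p ∩ Set.Ico q (q + Real.log 16)) =
      MeasureTheory.volume.real (Set.Ioo (max (p - Real.log 16) q) (min p (q + Real.log 16))) := by
    rw [← Set.Ioo_inter_Ioo]
    refine MeasureTheory.measureReal_congr ?_
    exact (MeasureTheory.Ioo_ae_eq_Ioc.symm).inter (MeasureTheory.Ioo_ae_eq_Ico.symm)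
  rw [e2, key]
  rcases le_total (p - Real.log 16) q with h1 | h1
  · rw [max_eq_right h1, min_eq_left (by linarith), abs_of_nonpos (by linarith)]
    congr 1; ring
  · rw [max_eq_left h1, min_eq_right (by linarith), abs_of_nonneg (by linarith)]
    congr 1; ring

end ProgressionAverages

section SmoothSums

open Finset

lemma bilinear_box (M : Finset ℕ) (R Y U x N N₁ N₂ : ℕ) (hR : 0 < R) (h : ∀ m, ZMod m)
    (hh : ∀ m ∈ M, IsUnit (h m)) (hM0 : ∀ m ∈ M, 0 < m) (hMY : ∀ m ∈ M, m ≤ Y)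
    (hφ : ∀ m ∈ M, m ≤ 2 * m.totient) (hMR : ∀ m ∈ M, ∀ f, f ∣ m → f ≠ 1 → R < f)
    (hU : 0 < U) (L : ℝ) (hL : L = Real.log N) (hL1 : 1 ≤ L) (hY : ((Nat.log 2 Y + 2 : ℕ) : ℝ) ≤ 4 * L)
    (α β : ℕ → ℝ) (hα : ∀ k, |α k| ≤ Real.log k) (hβ : ∀ l, |β l| ≤ (l.divisors.card : ℝ))
    (hα0 : ∀ k, k ≤ U → α k = 0) (hβ0 : ∀ k, k ≤ U → β k = 0)
    (hα1 : ∀ k, N₁ ≤ k → α k = 0) (hβ1 : ∀ k, N₂ ≤ k → β k = 0) (hN₁ : N₁ ≤ N) (hN₂ : N₂ ≤ N)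
    (hN : U < N₁ → U < N₂ → (N₁ * N₂ : ℝ) ≤ 1024 * x) :
    ∑ m ∈ M, |∑ k ∈ range N, ∑ l ∈ range N, α k * β l * apKer m (h m) (k * l)| ≤
      2 ^ 23 * L ^ 5 * (x / R + x / √U + Y * √x) := by
  by_cases hc : U < N₁ ∧ U < N₂
  swap
  · have : ∀ k l, α k * β l = 0 := by
      intro k l
      rcases not_and_or.1 hc with h1 | h1
      · rcases le_or_gt k U with h2 | h2
        · rw [hα0 k h2, zero_mul]
        · rw [hα1 k (by omega), zero_mul]
      · rcases le_or_gt l U with h2 | h2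
        · rw [hβ0 l h2, mul_zero]
        · rw [hβ1 l (by omega), mul_zero]
    simp only [this, zero_mul, sum_const_zero, abs_zero]
    positivity
  have hN := hN hc.1 hc.2
  have hb := bilinear_average M R Y N₁ N₂ hR h hh hM0 hMY hφ hMR (fun k => (α k : ℂ)) (fun l => (β l : ℂ))
  have e1 : ∀ m, ‖∑ k ∈ range N₁, ∑ l ∈ range N₂, (α k : ℂ) * (β l : ℂ) * (apKer m (h m) (k * l) : ℂ)‖ =
      |∑ k ∈ range N, ∑ l ∈ range N, α k * β l * apKer m (h m) (k * l)| := by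
    intro m
    rw [← Real.norm_eq_abs, ← Complex.norm_real]
    congr 1
    push_cast
    rw [sum_subset (range_subset_range.2 hN₁) (fun k _ hk => ?_)]
    · refine sum_congr rfl fun k _ => ?_
      rw [sum_subset (range_subset_range.2 hN₂) (fun l _ hl => ?_)]
      rw [hβ1 l (by simpa using hl)]; simp
    · rw [hα1 k (by simpa using hk)]; simp
  simp only [e1] at hb
  refine hb.trans ?_
  clear hb e1
  have hU' : (0 : ℝ) < √U := Real.sqrt_pos.2 (by exact_mod_cast hU)
  have hx0 : (0 : ℝ) ≤ √x := Real.sqrt_nonneg _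
  have hxx : √(x : ℝ) * √x = x := Real.mul_self_sqrt (Nat.cast_nonneg _)
  have hUN1 : (U : ℝ) ≤ N₁ := by exact_mod_cast hc.1.le
  have hUN2 : (U : ℝ) ≤ N₂ := by exact_mod_cast hc.2.le
  have s12 : √(N₁ : ℝ) * √N₂ ≤ 32 * √x := by
    rw [← Real.sqrt_mul (Nat.cast_nonneg _)]
    refine (Real.sqrt_le_sqrt hN).trans (le_of_eq ?_)
    rw [Real.sqrt_mul (by norm_num), show (1024 : ℝ) = 32 ^ 2 by norm_num, Real.sqrt_sq (by norm_num)]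
  have s1 : √(N₁ : ℝ) ≤ 32 * √x / √U := by
    rw [le_div_iff₀ hU']
    exact (mul_le_mul_of_nonneg_left (Real.sqrt_le_sqrt hUN2) (Real.sqrt_nonneg _)).trans s12
  have s2 : √(N₂ : ℝ) ≤ 32 * √x / √U := by
    rw [le_div_iff₀ hU', mul_comm]
    exact (mul_le_mul_of_nonneg_right (Real.sqrt_le_sqrt hUN1) (Real.sqrt_nonneg _)).trans s12
  have lN1 : Real.log N₁ ≤ L := by
    rw [hL]; exact Real.log_le_log (by exact_mod_cast (by omega : 0 < N₁)) (by exact_mod_cast hN₁)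
  have lN2 : Real.log N₂ ≤ L := by
    rw [hL]; exact Real.log_le_log (by exact_mod_cast (by omega : 0 < N₂)) (by exact_mod_cast hN₂)
  have A : ∑ n ∈ range N₁, ‖(α n : ℂ)‖ ^ 2 ≤ N₁ * L ^ 2 := by
    have : ∀ n ∈ range N₁, ‖(α n : ℂ)‖ ^ 2 ≤ L ^ 2 := by
      intro n hn
      rw [Complex.norm_real, Real.norm_eq_abs]
      refine pow_le_pow_left₀ (abs_nonneg _) ((hα n).trans ?_) 2
      rcases Nat.eq_zero_or_pos n with rfl | h0
      · simp; linarith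
      · exact (Real.log_le_log (by exact_mod_cast h0) (by exact_mod_cast (mem_range.1 hn).le)).trans lN1
    refine (sum_le_sum this).trans (le_of_eq ?_)
    simp
  have B : ∑ n ∈ range N₂, ‖(β n : ℂ)‖ ^ 2 ≤ N₂ * (8 * L ^ 3) := by
    have : ∀ n ∈ range N₂, ‖(β n : ℂ)‖ ^ 2 ≤ (n.divisors.card : ℝ) ^ 2 := by
      intro n _
      rw [Complex.norm_real, Real.norm_eq_abs]
      exact pow_le_pow_left₀ (abs_nonneg _) (hβ n) 2
    refine (sum_le_sum this).trans ((sum_card_divisors_sq_le N₂).trans ?_)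
    refine mul_le_mul_of_nonneg_left ?_ (Nat.cast_nonneg _)
    have : (1 + Real.log N₂) ^ 3 ≤ (2 * L) ^ 3 :=
      pow_le_pow_left₀ (by have := Real.log_natCast_nonneg N₂; linarith) (by linarith) 3
    linarith [mul_pow 2 L 3]
  have AB : √(∑ n ∈ range N₁, ‖(α n : ℂ)‖ ^ 2) * √(∑ n ∈ range N₂, ‖(β n : ℂ)‖ ^ 2) ≤
      96 * L ^ 3 * √x := by
    calc _ ≤ √(N₁ * L ^ 2) * √(N₂ * (8 * L ^ 3)) := by gcongr
      _ = (√N₁ * √N₂) * √(8 * L ^ 5) := by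
          rw [Real.sqrt_mul (Nat.cast_nonneg _), Real.sqrt_mul (Nat.cast_nonneg _),
            show 8 * L ^ 5 = L ^ 2 * (8 * L ^ 3) by ring, Real.sqrt_mul (sq_nonneg L)]
          ring
      _ ≤ (32 * √x) * (3 * L ^ 3) := by
          gcongr
          refine Real.sqrt_le_iff.2 ⟨by positivity, ?_⟩
          have : L ^ 5 ≤ L ^ 6 := pow_le_pow_right₀ hL1 (by norm_num)
          nlinarith [pow_nonneg (zero_le_one.trans hL1) 5]
      _ = _ := by ring
  have F : √(N₁ : ℝ) * √N₂ / R + 2 * √(N₁ : ℝ) + 2 * √(N₂ : ℝ) + 4 * Y ≤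
      128 * (√x / R + √x / √U + Y) := by
    have hR' : (0 : ℝ) < R := by exact_mod_cast hR
    have t1 : √(N₁ : ℝ) * √N₂ / R ≤ 32 * √x / R := by gcongr
    have t2 : 0 ≤ √(x : ℝ) / R := by positivity
    have t3 : 0 ≤ (Y : ℝ) := by positivity
    have e1 : 32 * √(x : ℝ) / R = 32 * (√x / R) := by ring
    have e2 : 32 * √(x : ℝ) / √U = 32 * (√x / √U) := by ring
    rw [e1] at t1
    rw [e2] at s1 s2
    linarith
  calc _ ≤ 32 * (4 * L) ^ 2 * ((128 * (√x / R + √x / √U + Y)) * (96 * L ^ 3 * √x)) := by gcongr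
    _ = (32 * 16 * 128 * 96) * L ^ 5 * ((√x * √x) / R + (√x * √x) / √U + Y * √x) := by ring
    _ ≤ _ := by
      rw [hxx]
      gcongr
      norm_num

end SmoothSums

section IntegralBounds

open Finset MeasureTheory

lemma intervalIntegrable_fun_sum {ι : Type*} (s : Finset ι) {f : ι → ℝ → ℝ} {a b : ℝ}
    (h : ∀ i ∈ s, IntervalIntegrable (f i) volume a b) :
    IntervalIntegrable (fun u => ∑ i ∈ s, f i u) volume a b := by
  have := IntervalIntegrable.sum s h
  rwa [Finset.sum_fn] at this

/-- The bilinear sums weighted by `wt`, averaged over moduli. -/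
theorem bilinear_wt_average (M : Finset ℕ) (R Y U x N : ℕ) (hR : 0 < R) (h : ∀ m, ZMod m)
    (hh : ∀ m ∈ M, IsUnit (h m)) (hM0 : ∀ m ∈ M, 0 < m) (hMY : ∀ m ∈ M, m ≤ Y)
    (hφ : ∀ m ∈ M, m ≤ 2 * m.totient) (hMR : ∀ m ∈ M, ∀ f, f ∣ m → f ≠ 1 → R < f)
    (hU : 16 ≤ U) (hx : 0 < x)
    (L : ℝ) (hL : L = Real.log N) (hL1 : 1 ≤ L) (hY : ((Nat.log 2 Y + 2 : ℕ) : ℝ) ≤ 4 * L)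
    (α β : ℕ → ℝ) (hα : ∀ k, |α k| ≤ Real.log k) (hβ : ∀ l, |β l| ≤ (l.divisors.card : ℝ))
    (hα0 : ∀ k, k ≤ U → α k = 0) (hβ0 : ∀ k, k ≤ U → β k = 0)
    (hα1 : ∀ k, N ≤ k → α k = 0) (hβ1 : ∀ k, N ≤ k → β k = 0) :
    ∑ m ∈ M, |∑ k ∈ range N, ∑ l ∈ range N, α k * β l * (wt x (k * l) * apKer m (h m) (k * l))| ≤
      2 ^ 23 * L ^ 6 * (x / R + x / √U + Y * √x) := by
  have hκ := log_sixteen_pos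
  have hx' : (0 : ℝ) < x := by exact_mod_cast hx
  set φ : ℕ → ℝ → ℝ := fun k => (Set.Ioc (Real.log k - Real.log 16) (Real.log k)).indicator 1 with hφd
  set ψ : ℕ → ℝ → ℝ := fun l => (Set.Ico (Real.log x - Real.log l)
    (Real.log x - Real.log l + Real.log 16)).indicator 1 with hψd
  set T : ℕ → ℝ → ℝ := fun m u => ∑ k ∈ range N, ∑ l ∈ range N,
    (α k * φ k u) * (β l * ψ l u) * apKer m (h m) (k * l) with hT
  have int1 : ∀ k l, IntervalIntegrable (fun u => φ k u * ψ l u) volume 0 L := by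
    intro k l
    have : (fun u => φ k u * ψ l u) = (Set.Ioc (Real.log k - Real.log 16) (Real.log k) ∩
        Set.Ico (Real.log x - Real.log l) (Real.log x - Real.log l + Real.log 16)).indicator
          (fun _ => (1 : ℝ)) := by
      ext u
      have := congrFun (Set.inter_indicator_one (M₀ := ℝ) (s := Set.Ioc (Real.log k - Real.log 16) (Real.log k))
        (t := Set.Ico (Real.log x - Real.log l) (Real.log x - Real.log l + Real.log 16))) u
      exact this.symm
    rw [this, intervalIntegrable_iff]
    refine IntegrableOn.indicator ?_ (measurableSet_Ioc.inter measurableSet_Ico)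
    exact integrableOn_const (by simp [Set.uIoc])
  have hTe : ∀ m, T m = fun u => ∑ k ∈ range N, ∑ l ∈ range N,
      (α k * β l * apKer m (h m) (k * l)) * (φ k u * ψ l u) := by
    intro m; ext u
    refine sum_congr rfl fun k _ => sum_congr rfl fun l _ => by ring
  have intT : ∀ m, IntervalIntegrable (T m) volume 0 L := by
    intro m
    rw [hTe]
    refine intervalIntegrable_fun_sum _ fun k _ => intervalIntegrable_fun_sum _ fun l _ => ?_
    exact (int1 k l).const_mul _
  have hval : ∀ m, ∑ k ∈ range N, ∑ l ∈ range N, α k * β l * (wt x (k * l) * apKer m (h m) (k * l)) =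
      ∫ u in (0 : ℝ)..L, T m u := by
    intro m
    rw [hTe, intervalIntegral.integral_finsetSum]
    swap
    · exact fun k _ => intervalIntegrable_fun_sum _ fun l _ => (int1 k l).const_mul _
    refine sum_congr rfl fun k hk => ?_
    rw [intervalIntegral.integral_finsetSum]
    swap
    · exact fun l _ => (int1 k l).const_mul _
    refine sum_congr rfl fun l _ => ?_
    rw [intervalIntegral.integral_const_mul]
    rcases le_or_gt k U with h1 | h1
    · rw [hα0 k h1]; simp
    rcases le_or_gt l U with h2 | h2
    · rw [hβ0 l h2]; simp
    have hk0 : (0 : ℝ) < k := by exact_mod_cast (by omega : 0 < k)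
    have hl0 : (0 : ℝ) < l := by exact_mod_cast (by omega : 0 < l)
    rw [hφd, hψd]
    simp only
    rw [integral_indicator_mul]
    · rw [show wt x (k * l) = max 0 (Real.log 16 -
        |Real.log k - (Real.log x - Real.log l) - Real.log 16|) by
          unfold wt
          push_cast
          rw [Real.log_mul hk0.ne' hl0.ne']
          congr 4; ring]
      ring
    · have : Real.log 16 ≤ Real.log k := Real.log_le_log (by norm_num) (by exact_mod_cast (by omega : 16 ≤ k))
      linarith
    · rw [hL]; exact Real.log_le_log hk0 (by exact_mod_cast (mem_range.1 hk).le)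
  have hbox : ∀ u, ∑ m ∈ M, |T m u| ≤ 2 ^ 23 * L ^ 5 * (x / R + x / √U + Y * √x) := by
    intro u
    have i01 : ∀ (s : Set ℝ), |s.indicator (1 : ℝ → ℝ) u| ≤ 1 := by
      intro s
      by_cases hs : u ∈ s
      · simp [hs]
      · simp [hs]
    refine bilinear_box M R Y U x N (min N ⌈Real.exp (u + Real.log 16)⌉₊)
      (min N ⌈Real.exp (Real.log x - u + Real.log 16)⌉₊) hR h hh hM0 hMY hφ hMR (by omega) L hL hL1 hY
      (fun k => α k * φ k u) (fun l => β l * ψ l u) ?_ ?_ ?_ ?_ ?_ ?_ (min_le_left _ _)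
      (min_le_left _ _) ?_
    · intro k
      rw [abs_mul]
      exact (mul_le_of_le_one_right (abs_nonneg _) (i01 _)).trans (hα k)
    · intro l
      rw [abs_mul]
      exact (mul_le_of_le_one_right (abs_nonneg _) (i01 _)).trans (hβ l)
    · intro k hk; simp [hα0 k hk]
    · intro k hk; simp [hβ0 k hk]
    · intro k hk
      rcases min_le_iff.1 hk with hk | hk
      · simp [hα1 k hk]
      · have hle := Nat.ceil_le.1 hk
        have := Real.log_le_log (Real.exp_pos _) hle
        rw [Real.log_exp] at this
        have : φ k u = 0 := by
          rw [hφd]; refine Set.indicator_of_notMem ?_ _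
          rintro ⟨h1, h2⟩; linarith
        simp only [this, mul_zero]
    · intro k hk
      rcases min_le_iff.1 hk with hk | hk
      · simp [hβ1 k hk]
      · have hle := Nat.ceil_le.1 hk
        have := Real.log_le_log (Real.exp_pos _) hle
        rw [Real.log_exp] at this
        have : ψ k u = 0 := by
          rw [hψd]; refine Set.indicator_of_notMem ?_ _
          rintro ⟨h1, h2⟩; linarith
        simp only [this, mul_zero]
    · intro h1 h2
      have b1 : ((min N ⌈Real.exp (u + Real.log 16)⌉₊ : ℕ) : ℝ) ≤ Real.exp (u + Real.log 16) + 1 :=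
        le_trans (by exact_mod_cast min_le_right _ _) (Nat.ceil_lt_add_one (Real.exp_pos _).le).le
      have b2 : ((min N ⌈Real.exp (Real.log x - u + Real.log 16)⌉₊ : ℕ) : ℝ) ≤
          Real.exp (Real.log x - u + Real.log 16) + 1 :=
        le_trans (by exact_mod_cast min_le_right _ _) (Nat.ceil_lt_add_one (Real.exp_pos _).le).le
      have c1 : (17 : ℝ) ≤ (min N ⌈Real.exp (u + Real.log 16)⌉₊ : ℕ) := by exact_mod_cast (by omega)
      have c2 : (17 : ℝ) ≤ (min N ⌈Real.exp (Real.log x - u + Real.log 16)⌉₊ : ℕ) := by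
        exact_mod_cast (by omega)
      have e1 : Real.exp (u + Real.log 16) = 16 * Real.exp u := by
        rw [Real.exp_add, Real.exp_log (by norm_num)]; ring
      have e2 : Real.exp (Real.log x - u + Real.log 16) = 16 * (x * Real.exp (-u)) := by
        rw [Real.exp_add, Real.exp_log (by norm_num), sub_eq_add_neg, Real.exp_add, Real.exp_log hx']
        ring
      have e3 : Real.exp u * (x * Real.exp (-u)) = x := by
        rw [mul_comm (x : ℝ), ← mul_assoc, ← Real.exp_add]; simp
      rw [e1] at b1 c1
      rw [e2] at b2 c2
      rw [e1, e2]
      calc _ ≤ (32 * Real.exp u) * (32 * (x * Real.exp (-u))) := by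
            refine mul_le_mul (by linarith) (by linarith) (by positivity) (by positivity)
        _ = 1024 * (Real.exp u * (x * Real.exp (-u))) := by ring
        _ = _ := by rw [e3]
  have hL0 : 0 ≤ L := by linarith
  calc _ = ∑ m ∈ M, |∫ u in (0 : ℝ)..L, T m u| := sum_congr rfl fun m _ => by rw [hval]
    _ ≤ ∑ m ∈ M, ∫ u in (0 : ℝ)..L, |T m u| :=
        sum_le_sum fun m _ => intervalIntegral.abs_integral_le_integral_abs hL0
    _ = ∫ u in (0 : ℝ)..L, ∑ m ∈ M, |T m u| := by
        rw [intervalIntegral.integral_finsetSum fun m _ => (intT m).abs]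
    _ ≤ ∫ _ in (0 : ℝ)..L, 2 ^ 23 * L ^ 5 * (x / R + x / √U + Y * √x) := by
        refine intervalIntegral.integral_mono_on hL0 ?_ (by simp) fun u _ => hbox u
        exact intervalIntegrable_fun_sum M fun m _ => (intT m).abs
    _ = _ := by
        rw [intervalIntegral.integral_const, smul_eq_mul]; ring

end IntegralBounds

section VaughanAverage

open Finset ArithmeticFunction
open scoped ArithmeticFunction.zeta ArithmeticFunction.Moebius

/-- Truncation of an arithmetic function to `n ≤ U`. -/
noncomputable def arithTrunc (U : ℕ) (f : ArithmeticFunction ℝ) : ArithmeticFunction ℝ :=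
  ⟨fun n => if n ≤ U then f n else 0, by simp⟩

lemma arithTrunc_apply (U : ℕ) (f : ArithmeticFunction ℝ) (n : ℕ) :
    arithTrunc U f n = if n ≤ U then f n else 0 := rfl

lemma arith_sub_apply (f g : ArithmeticFunction ℝ) (n : ℕ) : (f - g) n = f n - g n := by
  rw [sub_eq_add_neg, ArithmeticFunction.add_apply, sub_eq_add_neg]
  rfl

lemma abs_moebius_real_le (n : ℕ) : |(μ : ArithmeticFunction ℝ) n| ≤ 1 := by
  rw [intCoe_apply, ← Int.cast_abs]; exact_mod_cast abs_moebius_le_one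

lemma vaughan_identity (U : ℕ) :
    Λ = arithTrunc U Λ + arithTrunc U (μ : ArithmeticFunction ℝ) * log -
      arithTrunc U Λ * arithTrunc U (μ : ArithmeticFunction ℝ) * (ζ : ArithmeticFunction ℝ) +
      (Λ - arithTrunc U Λ) * (((μ : ArithmeticFunction ℝ) - arithTrunc U (μ : ArithmeticFunction ℝ)) *
        (ζ : ArithmeticFunction ℝ)) := by
  have h1 : Λ * (ζ : ArithmeticFunction ℝ) = log := vonMangoldt_mul_zeta
  have h2 : (μ : ArithmeticFunction ℝ) * (ζ : ArithmeticFunction ℝ) = 1 := coe_moebius_mul_coe_zeta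
  linear_combination (arithTrunc U (μ : ArithmeticFunction ℝ)) * h1 - (Λ - arithTrunc U Λ) * h2

lemma tail_moebius_zeta (U l : ℕ) :
    ((((μ : ArithmeticFunction ℝ) - arithTrunc U (μ : ArithmeticFunction ℝ)) *
        (ζ : ArithmeticFunction ℝ)) l) =
      ∑ d ∈ l.divisors, if d ≤ U then 0 else (μ : ArithmeticFunction ℝ) d := by
  rw [coe_mul_zeta_apply]
  refine sum_congr rfl fun d _ => ?_
  rw [arith_sub_apply, arithTrunc_apply]
  split_ifs <;> simp

lemma abs_tail_moebius_zeta_le (U l : ℕ) :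
    |((((μ : ArithmeticFunction ℝ) - arithTrunc U (μ : ArithmeticFunction ℝ)) *
        (ζ : ArithmeticFunction ℝ)) l)| ≤ (l.divisors.card : ℝ) := by
  rw [tail_moebius_zeta]
  refine (abs_sum_le_sum_abs _ _).trans ?_
  refine (sum_le_card_nsmul _ _ 1 fun d _ => ?_).trans (by simp)
  split_ifs
  · simp
  · exact abs_moebius_real_le d

lemma tail_moebius_zeta_eq_zero {U l : ℕ} (h : l ≤ U) :
    ((((μ : ArithmeticFunction ℝ) - arithTrunc U (μ : ArithmeticFunction ℝ)) *
        (ζ : ArithmeticFunction ℝ)) l) = 0 := by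
  rw [tail_moebius_zeta]
  refine sum_eq_zero fun d hd => if_pos ((Nat.divisor_le hd).trans h)

lemma abs_trunc_mul_trunc_le (U d : ℕ) :
    |(arithTrunc U Λ * arithTrunc U (μ : ArithmeticFunction ℝ)) d| ≤ Real.log d := by
  have h : ∑ i ∈ d.divisors, Λ i = Real.log d := vonMangoldt_sum
  rw [mul_apply, ← h, ← Nat.sum_divisorsAntidiagonal (n := d) (fun i _ => Λ i)]
  refine (abs_sum_le_sum_abs _ _).trans (sum_le_sum fun y _ => ?_)
  rw [abs_mul]
  have h1 : |arithTrunc U Λ y.1| ≤ Λ y.1 := by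
    rw [arithTrunc_apply]
    split_ifs
    · rw [abs_of_nonneg vonMangoldt_nonneg]
    · simp
  have h2 : |arithTrunc U (μ : ArithmeticFunction ℝ) y.2| ≤ 1 := by
    rw [arithTrunc_apply]
    split_ifs
    · exact abs_moebius_real_le _
    · simp
  calc _ ≤ Λ y.1 * 1 := mul_le_mul h1 h2 (abs_nonneg _) vonMangoldt_nonneg
    _ = _ := mul_one _

lemma trunc_mul_trunc_eq_zero {U d : ℕ} (h : U * U < d) :
    (arithTrunc U Λ * arithTrunc U (μ : ArithmeticFunction ℝ)) d = 0 := by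
  rw [mul_apply]
  refine sum_eq_zero fun y hy => ?_
  have hy := (Nat.mem_divisorsAntidiagonal.1 hy).1
  rw [arithTrunc_apply, arithTrunc_apply]
  by_cases h1 : y.1 ≤ U
  · by_cases h2 : y.2 ≤ U
    · exact absurd (Nat.mul_le_mul h1 h2) (by omega)
    · rw [if_neg h2, mul_zero]
  · rw [if_neg h1, zero_mul]

lemma sum_abs_le_of_support (f : ℕ → ℝ) (N D : ℕ) (B : ℝ) (hB : 0 ≤ B) (h0 : f 0 = 0)
    (hD : ∀ d, D < d → f d = 0) (hf : ∀ d ∈ range N, |f d| ≤ B) :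
    ∑ d ∈ range N, |f d| ≤ D * B := by
  calc ∑ d ∈ range N, |f d| = ∑ d ∈ range N with d ∈ Icc 1 D, |f d| := by
        rw [sum_filter]
        refine sum_congr rfl fun d _ => ?_
        split_ifs with h
        · rfl
        · rw [mem_Icc] at h
          rcases Nat.eq_zero_or_pos d with rfl | hd
          · simp [h0]
          · rw [hD d (by omega), abs_zero]
    _ ≤ #{d ∈ range N | d ∈ Icc 1 D} • B := sum_le_card_nsmul _ _ _ fun d hd => hf d (mem_filter.1 hd).1
    _ ≤ D * B := by
        rw [nsmul_eq_mul]
        refine mul_le_mul_of_nonneg_right ?_ hB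
        have : #{d ∈ range N | d ∈ Icc 1 D} ≤ #(Icc 1 D) :=
          card_le_card fun d hd => (mem_filter.1 hd).2
        rw [Nat.card_Icc] at this
        exact_mod_cast this

/-- Sums with a long smooth variable. -/
lemma type_one_le (f : ℕ → ℝ) (g : ℕ → ℝ) (m c x N D : ℕ) (hN : N = 256 * x) (hx : 0 < x)
    (hm : 0 < m) (h3 : Nat.Coprime 3 m) (hc0 : c ≠ 0) (hc : c < 3) (h : ZMod m) (hh : IsUnit h)
    (B V : ℝ) (hB : 0 ≤ B) (h0 : f 0 = 0) (hD : ∀ d, D < d → f d = 0)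
    (hf : ∀ d ∈ range N, |f d| ≤ B) (hV0 : 0 ≤ V)
    (hV : ∀ d, 0 < d → ∑ i ∈ range (N + 1), |g (i + 1) * wt x (d * (i + 1)) - g i * wt x (d * i)| ≤ V) :
    |∑ d ∈ range N, ∑ t ∈ range N, f d * g t *
      (if d * t % 3 = c then wt x (d * t) * apKer m h (d * t) else 0)| ≤ D * B * (2 * V) := by
  calc _ ≤ ∑ d ∈ range N, |f d| * (2 * V) := by
        refine (abs_sum_le_sum_abs _ _).trans (sum_le_sum fun d _ => ?_)
        simp only [mul_assoc (f d)]
        rw [← mul_sum, abs_mul]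
        rcases Nat.eq_zero_or_pos d with rfl | hd
        · simp [h0]
        refine mul_le_mul_of_nonneg_left ?_ (abs_nonneg _)
        have := abs_sum_mul_apKer_le m d c N hm h3 hc0 hc h hh (fun t => g t * wt x (d * t))
          (fun t ht => by
            rw [wt_eq_zero_of_ge hx, mul_zero]
            calc 256 * x ≤ t := by omega
              _ ≤ d * t := Nat.le_mul_of_pos_left _ hd)
        have h2 : ∑ i ∈ range N, |g (i + 1) * wt x (d * (i + 1)) - g i * wt x (d * i)| ≤ V := by
          refine le_trans (sum_le_sum_of_subset_of_nonneg ?_ fun _ _ _ => abs_nonneg _) (hV d hd)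
          exact range_subset_range.2 (by omega)
        refine le_trans (le_of_eq ?_) (this.trans (by linarith))
        congr 1
        refine sum_congr rfl fun t _ => ?_
        split_ifs <;> ring
    _ ≤ _ := by
        rw [← sum_mul]
        exact mul_le_mul_of_nonneg_right (sum_abs_le_of_support f N D B hB h0 hD hf) (by linarith)

/-- An average of the error term for primes in residue classes, weighted by `wt`. -/
theorem vonMangoldt_average (M : Finset ℕ) (R Y U x N c : ℕ) (hR : 0 < R) (h : ∀ m, ZMod m)
    (hh : ∀ m ∈ M, IsUnit (h m)) (hM0 : ∀ m ∈ M, 0 < m) (hMY : ∀ m ∈ M, m ≤ Y)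
    (hM3 : ∀ m ∈ M, Nat.Coprime 3 m)
    (hφ : ∀ m ∈ M, m ≤ 2 * m.totient) (hMR : ∀ m ∈ M, ∀ f, f ∣ m → f ≠ 1 → R < f)
    (hU : 16 ≤ U) (hUx : U ≤ x) (hN : N = 256 * x) (hYN : Y ≤ N) (hc : c = 1 ∨ c = 2)
    (L : ℝ) (hL : L = Real.log N) :
    ∑ m ∈ M, |∑ n ∈ range N, if n % 3 = c then Λ n * (wt x n * apKer m (h m) n) else 0| ≤
      2 ^ 24 * L ^ 6 * (#M * U ^ 2 + x / R + x / √U + Y * √x) := by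
  have hx : 0 < x := by omega
  have hL5 : 5 ≤ L := by
    have : Real.log 256 ≤ L := by
      rw [hL]; exact Real.log_le_log (by norm_num) (by exact_mod_cast (by omega : 256 ≤ N))
    have e : Real.log 256 = Real.log 16 + Real.log 16 := by
      rw [← Real.log_mul (by norm_num) (by norm_num)]; norm_num
    have := log_sixteen_gt
    linarith
  have hY : ((Nat.log 2 Y + 2 : ℕ) : ℝ) ≤ 4 * L := by
    rcases Nat.eq_zero_or_pos Y with rfl | hY0
    · simp; linarith
    have h1 : ((2 : ℕ) ^ Nat.log 2 Y : ℝ) ≤ Y := by exact_mod_cast Nat.pow_log_le_self 2 hY0.ne'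
    have h2 := Real.log_le_log (by positivity) h1
    rw [Real.log_pow] at h2
    have h3 : Real.log Y ≤ L := by
      rw [hL]; exact Real.log_le_log (by exact_mod_cast hY0) (by exact_mod_cast hYN)
    have := Real.log_two_gt_d9
    push_cast at h2 ⊢
    nlinarith [(Nat.cast_nonneg (Nat.log 2 Y) : (0 : ℝ) ≤ _)]
  set G : ℕ → ℕ → ℝ := fun m n => if n % 3 = c then wt x n * apKer m (h m) n else 0 with hG
  have hGN : ∀ m n, N ≤ n → G m n = 0 := by
    intro m n hn
    simp only [hG, wt_eq_zero_of_ge hx (by omega : 256 * x ≤ n), zero_mul, ite_self]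
  have hGU : ∀ m n, n ≤ U → G m n = 0 := by
    intro m n hn
    simp only [hG, wt_eq_zero_of_le hx (hn.trans hUx), zero_mul, ite_self]
  set a := arithTrunc U Λ with ha
  set b := arithTrunc U (μ : ArithmeticFunction ℝ) with hb
  set β := ((μ : ArithmeticFunction ℝ) - b) * (ζ : ArithmeticFunction ℝ) with hβ
  set S1 : ℕ → ℝ := fun m => ∑ d ∈ range N, ∑ t ∈ range N, b d * log t * G m (d * t)
  set S2 : ℕ → ℝ := fun m => ∑ d ∈ range N, ∑ t ∈ range N, (a * b) d *
    (ζ : ArithmeticFunction ℝ) t * G m (d * t)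
  set S3 : ℕ → ℝ := fun m => ∑ d ∈ range N, ∑ t ∈ range N, (Λ - a) d * β t * G m (d * t)
  have split : ∀ m, (∑ n ∈ range N, if n % 3 = c then Λ n * (wt x n * apKer m (h m) n) else 0) =
      S1 m - S2 m + S3 m := by
    intro m
    have e0 : (∑ n ∈ range N, if n % 3 = c then Λ n * (wt x n * apKer m (h m) n) else 0) =
        ∑ n ∈ range N, Λ n * G m n := by
      refine sum_congr rfl fun n _ => ?_
      simp only [hG]; split_ifs <;> simp
    rw [e0]
    simp only [S1, S2, S3]
    rw [← sum_mul_arith _ _ _ _ (hGN m), ← sum_mul_arith _ _ _ _ (hGN m),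
      ← sum_mul_arith _ _ _ _ (hGN m), ← sum_sub_distrib, ← sum_add_distrib]
    refine sum_congr rfl fun n _ => ?_
    have hv := congrArg (fun f : ArithmeticFunction ℝ => f n) (vaughan_identity U)
    simp only [ArithmeticFunction.add_apply, arith_sub_apply] at hv
    rw [hv]
    have ha0 : a n * G m n = 0 := by
      rcases le_or_gt n U with h1 | h1
      · rw [hGU m n h1, mul_zero]
      · rw [ha, arithTrunc_apply, if_neg (by omega), zero_mul]
    rw [add_mul, sub_mul, add_mul, ha0, zero_add]
  have hLN : 0 ≤ Real.log N := Real.log_natCast_nonneg N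
  have b1 : ∀ m ∈ M, |S1 m| ≤ U * 1 * (2 * ((3 + L) * (1 + L))) := by
    intro m hm
    refine type_one_le b (fun t => log t) m c x N U hN hx (hM0 m hm) (hM3 m hm) (by omega) (by omega)
      (h m) (hh m hm) 1 _ (by norm_num) (by simp) ?_ ?_ (by positivity) ?_
    · intro d hd; rw [hb, arithTrunc_apply, if_neg (by omega)]
    · intro d _
      rw [hb, arithTrunc_apply]
      split_ifs
      · exact abs_moebius_real_le d
      · simp
    · intro d hd
      rw [hL]
      exact variation_log_wt_le x d N hd
  have b2 : ∀ m ∈ M, |S2 m| ≤ (U * U : ℕ) * L * (2 * (4 + L)) := by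
    intro m hm
    refine type_one_le ((a * b : ArithmeticFunction ℝ) : ℕ → ℝ) (fun t => (ζ : ArithmeticFunction ℝ) t) m c x N (U * U) hN hx (hM0 m hm)
      (hM3 m hm) (by omega) (by omega) (h m) (hh m hm) L _ (by linarith) (by simp) ?_ ?_
      (by linarith) ?_
    · intro d hd; exact trunc_mul_trunc_eq_zero hd
    · intro d hd
      refine (abs_trunc_mul_trunc_le U d).trans ?_
      rcases Nat.eq_zero_or_pos d with rfl | h0
      · simp; linarith
      · rw [hL]; exact Real.log_le_log (by exact_mod_cast h0) (by exact_mod_cast (mem_range.1 hd).le)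
    · intro d hd
      rw [hL]
      refine le_trans (le_of_eq (sum_congr rfl fun i _ => ?_)) (variation_wt_le x d N hd)
      rcases Nat.eq_zero_or_pos i with rfl | hi
      · simp [wt_zero]
      · simp [hi.ne']
  have b3 : ∑ m ∈ M, |S3 m| ≤ 2 * (2 ^ 23 * L ^ 6 * (x / R + x / √U + Y * √x)) := by
    set A : ℕ → ℕ → ℝ := fun r k => if k < N ∧ k % 3 = r then (Λ - a) k else 0 with hA
    set B : ℕ → ℕ → ℝ := fun r l => if l < N ∧ l % 3 = (c * r) % 3 then β l else 0 with hB
    have key : ∀ m, S3 m = (∑ k ∈ range N, ∑ l ∈ range N, A 1 k * B 1 l *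
        (wt x (k * l) * apKer m (h m) (k * l))) + ∑ k ∈ range N, ∑ l ∈ range N, A 2 k * B 2 l *
        (wt x (k * l) * apKer m (h m) (k * l)) := by
      intro m
      simp only [S3, ← sum_add_distrib]
      refine sum_congr rfl fun k hk => sum_congr rfl fun l hl => ?_
      simp only [hA, hB, hG, mem_range.1 hk, mem_range.1 hl, true_and]
      rw [Nat.mul_mod k l]
      have hk3 : k % 3 = 0 ∨ k % 3 = 1 ∨ k % 3 = 2 := by omega
      have hl3 : l % 3 = 0 ∨ l % 3 = 1 ∨ l % 3 = 2 := by omega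
      rcases hc with rfl | rfl <;> rcases hk3 with e | e | e <;> rcases hl3 with e' | e' | e' <;>
        simp [e, e']
    have bound : ∀ r, ∑ m ∈ M, |∑ k ∈ range N, ∑ l ∈ range N, A r k * B r l *
        (wt x (k * l) * apKer m (h m) (k * l))| ≤ 2 ^ 23 * L ^ 6 * (x / R + x / √U + Y * √x) := by
      intro r
      refine bilinear_wt_average M R Y U x N hR h hh hM0 hMY hφ hMR hU hx L hL (by linarith) hY
        (A r) (B r) ?_ ?_ ?_ ?_ ?_ ?_
      · intro k
        simp only [hA, ha, arith_sub_apply, arithTrunc_apply]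
        have h1 : (0 : ℝ) ≤ Real.log k := Real.log_natCast_nonneg k
        split_ifs
        · simpa
        · rw [sub_zero, abs_of_nonneg vonMangoldt_nonneg]; exact vonMangoldt_le_log
        · simpa
      · intro l
        simp only [hB]
        split_ifs
        · exact abs_tail_moebius_zeta_le U l
        · simp
      · intro k hk
        simp only [hA, ha, arith_sub_apply, arithTrunc_apply, if_pos hk, sub_self, ite_self]
      · intro k hk
        have : β k = 0 := tail_moebius_zeta_eq_zero hk
        simp only [hB, this, ite_self]
      · intro k hk
        exact if_neg fun h => by omega
      · intro k hk
        exact if_neg fun h => by omega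
    calc _ ≤ ∑ m ∈ M, (|∑ k ∈ range N, ∑ l ∈ range N, A 1 k * B 1 l *
        (wt x (k * l) * apKer m (h m) (k * l))| + |∑ k ∈ range N, ∑ l ∈ range N, A 2 k * B 2 l *
        (wt x (k * l) * apKer m (h m) (k * l))|) := sum_le_sum fun m _ => by
          rw [key]; exact abs_add_le _ _
      _ ≤ _ := by
          rw [sum_add_distrib, two_mul]; exact add_le_add (bound 1) (bound 2)
  have b12 : ∀ m ∈ M, |S1 m| + |S2 m| ≤ 2 ^ 24 * L ^ 6 * U ^ 2 := by
    intro m hm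
    have h1 := b1 m hm
    have h2 := b2 m hm
    have hU1 : (1 : ℝ) ≤ U := by exact_mod_cast (by omega : 1 ≤ U)
    have hU2 : (U : ℝ) ≤ U ^ 2 := by nlinarith
    have l1 : (3 + L) * (1 + L) ≤ 4 * L ^ 6 := by
      have : L ^ 2 ≤ L ^ 6 := pow_le_pow_right₀ (by linarith) (by norm_num)
      nlinarith
    have l2 : L * (2 * (4 + L)) ≤ 4 * L ^ 6 := by
      have : L ^ 2 ≤ L ^ 6 := pow_le_pow_right₀ (by linarith) (by norm_num)
      nlinarith
    have hU0 : (0 : ℝ) ≤ (U : ℝ) ^ 2 := by positivity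
    have hL0 : (0 : ℝ) ≤ L ^ 6 := by positivity
    have t1 : (U : ℝ) * 1 * (2 * ((3 + L) * (1 + L))) ≤ U ^ 2 * (8 * L ^ 6) := by
      refine mul_le_mul (by linarith) (by linarith) (by positivity) hU0
    have t2 : ((U * U : ℕ) : ℝ) * L * (2 * (4 + L)) ≤ U ^ 2 * (4 * L ^ 6) := by
      push_cast
      rw [mul_assoc, ← sq]
      exact mul_le_mul_of_nonneg_left l2 hU0
    nlinarith [mul_nonneg hU0 hL0]
  calc _ ≤ ∑ m ∈ M, ((|S1 m| + |S2 m|) + |S3 m|) := sum_le_sum fun m _ => by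
        rw [split]
        refine (abs_add_le _ _).trans (add_le_add_left (abs_sub _ _) _)
    _ ≤ #M * (2 ^ 24 * L ^ 6 * U ^ 2) + 2 * (2 ^ 23 * L ^ 6 * (x / R + x / √U + Y * √x)) := by
        rw [sum_add_distrib]
        refine add_le_add ?_ b3
        rw [← nsmul_eq_mul]
        exact sum_le_card_nsmul _ _ _ b12
    _ = _ := by ring

end VaughanAverage

section SelbergSieve

open Finset

lemma sum_range_mul_of_coprime (a b : ℕ) (ha : 0 < a) (hb : 0 < b) (hab : a.Coprime b) (f g : ℕ → ℝ)
    (hf : ∀ n, f (n % a) = f n) (hg : ∀ n, g (n % b) = g n) :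
    ∑ n ∈ range (a * b), f n * g n = (∑ n ∈ range a, f n) * ∑ n ∈ range b, g n := by
  rw [sum_mul_sum, ← sum_product']
  refine sum_nbij' (fun n => (n % a, n % b)) (fun y => (Nat.chineseRemainder hab y.1 y.2 : ℕ)) ?_ ?_ ?_ ?_ ?_
  · intro n _
    exact mem_product.2 ⟨mem_range.2 (Nat.mod_lt _ ha), mem_range.2 (Nat.mod_lt _ hb)⟩
  · intro y _
    exact mem_range.2 (Nat.chineseRemainder_lt_mul hab _ _ ha.ne' hb.ne')
  · intro n hn
    have h := (Nat.chineseRemainder hab (n % a) (n % b)).2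
    have h1 : (Nat.chineseRemainder hab (n % a) (n % b) : ℕ) ≡ n [MOD a] := h.1.trans (Nat.mod_modEq _ _)
    have h2 : (Nat.chineseRemainder hab (n % a) (n % b) : ℕ) ≡ n [MOD b] := h.2.trans (Nat.mod_modEq _ _)
    have h3 := (Nat.modEq_and_modEq_iff_modEq_mul hab).1 ⟨h1, h2⟩
    exact Nat.ModEq.eq_of_lt_of_lt h3 (Nat.chineseRemainder_lt_mul hab _ _ ha.ne' hb.ne') (mem_range.1 hn)
  · intro y hy
    have h := (Nat.chineseRemainder hab y.1 y.2).2
    obtain ⟨h1, h2⟩ := mem_product.1 hy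
    ext
    · exact Nat.ModEq.eq_of_lt_of_lt ((Nat.mod_modEq _ _).trans h.1) (Nat.mod_lt _ ha) (mem_range.1 h1)
    · exact Nat.ModEq.eq_of_lt_of_lt ((Nat.mod_modEq _ _).trans h.2) (Nat.mod_lt _ hb) (mem_range.1 h2)
  · intro n _
    simp only [hf, hg]

lemma sum_range_periodic_le (T N : ℕ) (hT : 0 < T) (F : ℕ → ℝ) (hF : ∀ n, F (n % T) = F n)
    (h1 : ∀ n, |F n| ≤ 1) :
    |∑ n ∈ range N, F n - (N / T : ℕ) * ∑ n ∈ range T, F n| ≤ T := by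
  have key : ∀ j, ∑ n ∈ range (T * j), F n = j * ∑ n ∈ range T, F n := by
    intro j
    induction j with
    | zero => simp
    | succ j ih =>
      rw [mul_add, mul_one, sum_range_add, ih]
      have : ∀ n ∈ range T, F (T * j + n) = F n := by
        intro n _
        rw [← hF, Nat.mul_add_mod, hF]
      rw [sum_congr rfl this]
      push_cast; ring
  conv_lhs => rw [show range N = range (T * (N / T) + N % T) by rw [Nat.div_add_mod]]
  rw [sum_range_add, key, add_sub_cancel_left]
  refine (abs_sum_le_sum_abs _ _).trans ((sum_le_card_nsmul _ _ 1 fun n _ => h1 _).trans ?_)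
  simp only [card_range, nsmul_eq_mul, mul_one]
  exact_mod_cast (Nat.mod_lt _ hT).le

section Sieve

variable (ψ : ℕ → ℕ → ℝ) (η : ℕ → ℝ)

lemma prod_mod_eq (s : Finset ℕ) (hp : ∀ l ∈ s, ∀ n, ψ l (n % l) = ψ l n) (T : ℕ)
    (hT : ∀ l ∈ s, l ∣ T) (n : ℕ) : ∏ l ∈ s, ψ l (n % T) = ∏ l ∈ s, ψ l n := by
  refine prod_congr rfl fun l hl => ?_
  rw [← hp l hl, Nat.mod_mod_of_dvd _ (hT l hl), hp l hl]

lemma sum_prod_sq (s : Finset ℕ) (hs : ∀ l ∈ s, l.Prime)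
    (hp : ∀ l ∈ s, ∀ n, ψ l (n % l) = ψ l n) (h2 : ∀ l ∈ s, ∑ n ∈ range l, ψ l n ^ 2 = l * η l) :
    ∑ n ∈ range (∏ l ∈ s, l), (∏ l ∈ s, ψ l n) ^ 2 = (∏ l ∈ s, (l : ℝ)) * ∏ l ∈ s, η l := by
  classical
  induction s using Finset.induction_on with
  | empty => simp
  | insert a s ha ih =>
    have hcop : a.Coprime (∏ l ∈ s, l) := by
      refine Nat.Coprime.prod_right fun l hl => ?_
      refine (Nat.coprime_primes (hs a (mem_insert_self _ _)) (hs l (mem_insert_of_mem hl))).2 ?_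
      rintro rfl; exact ha hl
    have ih := ih (fun l hl => hs l (mem_insert_of_mem hl)) (fun l hl => hp l (mem_insert_of_mem hl))
      (fun l hl => h2 l (mem_insert_of_mem hl))
    have hpos : 0 < ∏ l ∈ s, l := prod_pos fun l hl => (hs l (mem_insert_of_mem hl)).pos
    rw [prod_insert ha, prod_insert ha, prod_insert ha]
    have := sum_range_mul_of_coprime a (∏ l ∈ s, l) (hs a (mem_insert_self _ _)).pos hpos hcop
      (fun n => ψ a n ^ 2) (fun n => (∏ l ∈ s, ψ l n) ^ 2)
      (fun n => by simp only [hp a (mem_insert_self _ _)])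
      (fun n => by
        rw [prod_mod_eq ψ s (fun l hl => hp l (mem_insert_of_mem hl)) _ (fun l hl => dvd_prod_of_mem _ hl)])
    simp only [prod_insert ha, mul_pow]
    rw [this, ih, h2 a (mem_insert_self _ _)]
    ring

lemma sum_prod_mul_prod_eq_zero (s t : Finset ℕ) (hs : ∀ l ∈ s, l.Prime) (ht : ∀ l ∈ t, l.Prime)
    (hps : ∀ l ∈ s, ∀ n, ψ l (n % l) = ψ l n) (hpt : ∀ l ∈ t, ∀ n, ψ l (n % l) = ψ l n)
    (h0 : ∀ l ∈ s, ∑ n ∈ range l, ψ l n = 0) (hst : ∃ l ∈ s, l ∉ t) :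
    ∑ n ∈ range ((∏ l ∈ s, l) * ∏ l ∈ t, l), (∏ l ∈ s, ψ l n) * (∏ l ∈ t, ψ l n) = 0 := by
  classical
  obtain ⟨a, has, hat⟩ := hst
  have e : (∏ l ∈ s, l) * ∏ l ∈ t, l = a * ((∏ l ∈ s.erase a, l) * ∏ l ∈ t, l) := by
    rw [← mul_assoc, mul_prod_erase s (fun l => l) has]
  have hc1 : ∀ u : Finset ℕ, (∀ l ∈ u, l.Prime) → a ∉ u → a.Coprime (∏ l ∈ u, l) := by
    intro u hu hau
    refine Nat.Coprime.prod_right fun l hl => ?_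
    refine (Nat.coprime_primes (hs a has) (hu l hl)).2 ?_
    rintro rfl; exact hau hl
  have hse : ∀ l ∈ s.erase a, l.Prime := fun l hl => hs l (mem_of_mem_erase hl)
  rw [e]
  have := sum_range_mul_of_coprime a ((∏ l ∈ s.erase a, l) * ∏ l ∈ t, l) (hs a has).pos
    (mul_pos (prod_pos fun l hl => (hse l hl).pos) (prod_pos fun l hl => (ht l hl).pos))
    (Nat.Coprime.mul_right (hc1 _ hse (notMem_erase _ _)) (hc1 _ ht hat))
    (fun n => ψ a n) (fun n => (∏ l ∈ s.erase a, ψ l n) * ∏ l ∈ t, ψ l n)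
    (fun n => hps a has n)
    (fun n => by
      rw [prod_mod_eq ψ _ (fun l hl => hps l (mem_of_mem_erase hl)) _
        (fun l hl => (dvd_prod_of_mem _ hl).mul_right _),
        prod_mod_eq ψ _ hpt _ (fun l hl => (dvd_prod_of_mem _ hl).mul_left _)])
  rw [h0 a has, zero_mul] at this
  rw [← this]
  refine sum_congr rfl fun n _ => ?_
  rw [← mul_assoc, mul_prod_erase s (fun l => ψ l n) has]

/-- A large-sieve type upper bound for a set of integers avoiding residue classes. -/
theorem sieve_upper_bound (D : Finset ℕ) (Q N : ℕ) (hD : ∀ q ∈ D, Squarefree q ∧ q ≤ Q)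
    (hp : ∀ q ∈ D, ∀ l ∈ q.primeFactors, ∀ n, ψ l (n % l) = ψ l n)
    (h0 : ∀ q ∈ D, ∀ l ∈ q.primeFactors, ∑ n ∈ range l, ψ l n = 0)
    (h2 : ∀ q ∈ D, ∀ l ∈ q.primeFactors, ∑ n ∈ range l, ψ l n ^ 2 = l * η l)
    (h1 : ∀ q ∈ D, ∀ l ∈ q.primeFactors, ∀ n, |ψ l n| ≤ 1)
    (hη : ∀ q ∈ D, ∀ l ∈ q.primeFactors, 0 ≤ η l)
    (Z : Finset ℕ) (hZ : Z ⊆ range N) (hZψ : ∀ t ∈ Z, ∀ q ∈ D, ∀ l ∈ q.primeFactors, ψ l t = η l) :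
    (∑ q ∈ D, ∏ l ∈ q.primeFactors, η l) ^ 2 * #Z ≤
      N * (∑ q ∈ D, ∏ l ∈ q.primeFactors, η l) + (Q : ℝ) ^ 4 := by
  set Ψ : ℕ → ℕ → ℝ := fun q n => ∏ l ∈ q.primeFactors, ψ l n with hΨ
  set H : ℕ → ℝ := fun q => ∏ l ∈ q.primeFactors, η l with hH
  have hH0 : ∀ q ∈ D, 0 ≤ H q := fun q hq => prod_nonneg fun l hl => hη q hq l hl
  have hQ : ∀ q ∈ D, 0 < q := fun q hq => Nat.pos_of_ne_zero (hD q hq).1.ne_zero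
  have hprod : ∀ q ∈ D, ∏ l ∈ q.primeFactors, l = q := fun q hq =>
    Nat.prod_primeFactors_of_squarefree (hD q hq).1
  have hΨ1 : ∀ q ∈ D, ∀ n, |Ψ q n| ≤ 1 := by
    intro q hq n
    simp only [hΨ]
    rw [abs_prod]
    exact prod_le_one (fun _ _ => abs_nonneg _) fun l hl => h1 q hq l hl n
  have hper : ∀ q ∈ D, ∀ T, q ∣ T → ∀ n, Ψ q (n % T) = Ψ q n := by
    intro q hq T hT n
    exact prod_mod_eq ψ _ (hp q hq) T (fun l hl => (Nat.dvd_of_mem_primeFactors hl).trans hT) n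
  have corr : ∀ q ∈ D, ∀ q' ∈ D, ∑ n ∈ range N, Ψ q n * Ψ q' n ≤
      (if q = q' then N * H q else 0) + (Q : ℝ) ^ 2 := by
    intro q hq q' hq'
    have hab : ∀ n, |Ψ q n * Ψ q' n| ≤ 1 := by
      intro n
      rw [abs_mul]; exact mul_le_one₀ (hΨ1 q hq n) (abs_nonneg _) (hΨ1 q' hq' n)
    by_cases hqq : q = q'
    · subst hqq
      rw [if_pos rfl]
      have h3 := sum_range_periodic_le q N (hQ q hq) (fun n => Ψ q n * Ψ q n)
        (fun n => by simp only [hper q hq q dvd_rfl]) hab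
      have h4 := sum_prod_sq ψ η q.primeFactors (fun l hl => Nat.prime_of_mem_primeFactors hl) (hp q hq)
        (h2 q hq)
      rw [← Nat.cast_prod, hprod q hq] at h4
      have h5 : ∑ n ∈ range q, Ψ q n * Ψ q n = q * H q := by
        rw [← h4]; exact sum_congr rfl fun n _ => by rw [sq]
      rw [h5] at h3
      have h6 := (abs_le.1 h3).2
      have h7 : ((N / q : ℕ) : ℝ) * (q * H q) ≤ N * H q := by
        rw [← mul_assoc]
        refine mul_le_mul_of_nonneg_right ?_ (hH0 q hq)
        exact_mod_cast Nat.div_mul_le_self N q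
      have h8 : (q : ℝ) ≤ (Q : ℝ) ^ 2 := by
        have : q ≤ Q ^ 2 := (hD q hq).2.trans (Nat.le_self_pow two_ne_zero Q)
        exact_mod_cast this
      linarith
    · rw [if_neg hqq]
      have h3 := sum_range_periodic_le (q * q') N (Nat.mul_pos (hQ q hq) (hQ q' hq'))
        (fun n => Ψ q n * Ψ q' n)
        (fun n => by
          simp only [hper q hq _ (Nat.dvd_mul_right q q'), hper q' hq' _ (Nat.dvd_mul_left q' q)]) hab
      have h4 : ∑ n ∈ range (q * q'), Ψ q n * Ψ q' n = 0 := by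
        by_cases hex : ∃ l ∈ q.primeFactors, l ∉ q'.primeFactors
        · have := sum_prod_mul_prod_eq_zero ψ q.primeFactors q'.primeFactors
            (fun l hl => Nat.prime_of_mem_primeFactors hl) (fun l hl => Nat.prime_of_mem_primeFactors hl)
            (hp q hq) (hp q' hq') (h0 q hq) hex
          rwa [hprod q hq, hprod q' hq'] at this
        · have hex' : ∃ l ∈ q'.primeFactors, l ∉ q.primeFactors := by
            by_contra hcon
            push Not at hex hcon
            apply hqq
            rw [← hprod q hq, ← hprod q' hq', Subset.antisymm hex hcon]
          have := sum_prod_mul_prod_eq_zero ψ q'.primeFactors q.primeFactors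
            (fun l hl => Nat.prime_of_mem_primeFactors hl) (fun l hl => Nat.prime_of_mem_primeFactors hl)
            (hp q' hq') (hp q hq) (h0 q' hq') hex'
          rw [hprod q hq, hprod q' hq', mul_comm] at this
          rw [← this]
          exact sum_congr rfl fun n _ => mul_comm _ _
      rw [h4, mul_zero, sub_zero] at h3
      have h6 := (abs_le.1 h3).2
      have h8 : ((q * q' : ℕ) : ℝ) ≤ (Q : ℝ) ^ 2 := by
        have : q * q' ≤ Q ^ 2 := by rw [sq]; exact Nat.mul_le_mul (hD q hq).2 (hD q' hq').2
        exact_mod_cast this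
      linarith
  have hcard : (#D : ℝ) ≤ Q := by
    have : D ⊆ Icc 1 Q := fun q hq => mem_Icc.2 ⟨hQ q hq, (hD q hq).2⟩
    have := card_le_card this
    rw [Nat.card_Icc] at this
    exact_mod_cast this
  calc (∑ q ∈ D, H q) ^ 2 * #Z = ∑ t ∈ Z, (∑ q ∈ D, Ψ q t) ^ 2 := by
        rw [mul_comm, ← nsmul_eq_mul, ← sum_const]
        refine sum_congr rfl fun t ht => ?_
        congr 1
        refine sum_congr rfl fun q hq => ?_
        exact prod_congr rfl fun l hl => (hZψ t ht q hq l hl).symm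
    _ ≤ ∑ t ∈ range N, (∑ q ∈ D, Ψ q t) ^ 2 :=
        sum_le_sum_of_subset_of_nonneg hZ fun _ _ _ => sq_nonneg _
    _ = ∑ q ∈ D, ∑ q' ∈ D, ∑ n ∈ range N, Ψ q n * Ψ q' n := by
        simp only [sq, sum_mul_sum]
        rw [sum_comm]
        exact sum_congr rfl fun q _ => sum_comm
    _ ≤ ∑ q ∈ D, ∑ q' ∈ D, ((if q = q' then N * H q else 0) + (Q : ℝ) ^ 2) :=
        sum_le_sum fun q hq => sum_le_sum fun q' hq' => corr q hq q' hq'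
    _ = N * (∑ q ∈ D, H q) + #D * (#D * (Q : ℝ) ^ 2) := by
        simp only [sum_add_distrib, sum_ite_eq, sum_const, nsmul_eq_mul]
        rw [mul_sum]
        congr 1
        exact sum_congr rfl fun q hq => if_pos hq
    _ ≤ _ := by
        have : (#D : ℝ) * (#D * (Q : ℝ) ^ 2) ≤ Q * (Q * (Q : ℝ) ^ 2) := by gcongr
        linarith [show (Q : ℝ) * (Q * (Q : ℝ) ^ 2) = (Q : ℝ) ^ 4 by ring]

end Sieve

end SelbergSieve

section SieveBounds

open Finset

/-- The sum of `1 / u` over the squarefree `u ≤ V` coprime to `g`. -/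
noncomputable def sqfSum (g V : ℕ) : ℝ :=
  ∑ u ∈ (Icc 1 V).filter (fun u => Squarefree u ∧ u.Coprime g), (1 : ℝ) / u

lemma sqfSum_le_mul (g V p : ℕ) (hp : p.Prime) :
    sqfSum g V ≤ (1 + 1 / (p : ℝ)) * sqfSum (g * p) V := by
  have hp0 : (0 : ℝ) < p := by exact_mod_cast hp.pos
  unfold sqfSum
  rw [← sum_filter_add_sum_filter_not ((Icc 1 V).filter (fun u => Squarefree u ∧ u.Coprime g))
    (fun u => ¬ p ∣ u), add_mul, one_mul]
  refine add_le_add ?_ ?_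
  · refine sum_le_sum_of_subset_of_nonneg ?_ fun _ _ _ => by positivity
    intro u hu
    simp only [mem_filter] at hu ⊢
    exact ⟨hu.1.1, hu.1.2.1, Nat.Coprime.mul_right hu.1.2.2 ((hp.coprime_iff_not_dvd.2 hu.2).symm)⟩
  · rw [mul_sum]
    have : ∀ u ∈ ((Icc 1 V).filter (fun u => Squarefree u ∧ u.Coprime g)).filter (fun u => ¬ ¬ p ∣ u),
        u / p * p = u := by
      intro u hu
      simp only [mem_filter, not_not] at hu
      exact Nat.div_mul_cancel hu.2
    rw [sum_congr rfl (g := fun u => 1 / (p : ℝ) * (1 / ((u / p : ℕ) : ℝ))) fun u hu => by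
      conv_lhs => rw [← this u hu]
      push_cast
      field_simp]
    rw [← sum_image (f := fun v : ℕ => 1 / (p : ℝ) * (1 / (v : ℝ))) (g := fun u => u / p)]
    · refine sum_le_sum_of_subset_of_nonneg ?_ fun _ _ _ => by positivity
      intro v hv
      obtain ⟨u, hu, rfl⟩ := mem_image.1 hv
      have h1 := this u hu
      simp only [mem_filter, not_not, mem_Icc] at hu ⊢
      obtain ⟨⟨⟨hu1, hu2⟩, hsq, hc⟩, hpu⟩ := hu
      have hsq' : Squarefree (u / p * p) := by rwa [h1]
      have h2 := Nat.coprime_of_squarefree_mul hsq'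
      refine ⟨⟨Nat.div_pos (Nat.le_of_dvd (by omega) hpu) hp.pos, (Nat.div_le_self _ _).trans hu2⟩,
        hsq'.of_mul_left, Nat.Coprime.mul_right ?_ h2⟩
      exact Nat.Coprime.coprime_dvd_left ⟨p, h1.symm⟩ hc
    · intro u hu v hv huv
      rw [← this u hu, ← this v hv]
      simp only at huv
      rw [huv]

lemma sqfSum_le_prod (g V : ℕ) (T : Finset ℕ) (hT : ∀ p ∈ T, p.Prime) :
    sqfSum g V ≤ (∏ p ∈ T, (1 + 1 / (p : ℝ))) * sqfSum (g * ∏ p ∈ T, p) V := by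
  classical
  induction T using Finset.induction_on with
  | empty => simp
  | insert a s ha ih =>
    rw [prod_insert ha, prod_insert ha]
    refine (ih fun p hp => hT p (mem_insert_of_mem hp)).trans ?_
    have h := sqfSum_le_mul (g * ∏ p ∈ s, p) V a (hT a (mem_insert_self _ _))
    rw [show g * (a * ∏ p ∈ s, p) = g * (∏ p ∈ s, p) * a by ring,
      mul_comm (1 + 1 / (a : ℝ)), mul_assoc]
    exact mul_le_mul_of_nonneg_left h (prod_nonneg fun _ _ => by positivity)

lemma sum_one_div_sq_le (V : ℕ) : ∑ a ∈ Icc 1 V, (1 : ℝ) / (a : ℝ) ^ 2 ≤ 2 - 1 / V := by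
  induction V with
  | zero => norm_num
  | succ V ih =>
    rw [sum_Icc_succ_top (by omega)]
    rcases Nat.eq_zero_or_pos V with rfl | hV
    · norm_num
    · have hV' : (0 : ℝ) < V := by exact_mod_cast hV
      have h1 : (1 : ℝ) / V - 1 / (V + 1) = 1 / (V * (V + 1)) := by
        field_simp; ring
      have h2 : (1 : ℝ) / (V + 1) ^ 2 ≤ 1 / (V * (V + 1)) :=
        one_div_le_one_div_of_le (by positivity) (by nlinarith)
      push_cast
      linarith

lemma log_le_sqfSum (V : ℕ) : Real.log (V + 1) / 2 ≤ sqfSum 1 V := by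
  have h1 : Real.log ((V + 1 : ℕ) : ℝ) ≤ ∑ n ∈ Icc 1 V, (1 : ℝ) / n := by
    have := log_add_one_le_harmonic V
    rw [harmonic_eq_sum_Icc] at this
    push_cast at this ⊢
    simpa [one_div] using this
  have h2 : ∑ n ∈ Icc 1 V, (1 : ℝ) / n ≤ (∑ a ∈ Icc 1 V, (1 : ℝ) / (a : ℝ) ^ 2) * sqfSum 1 V := by
    unfold sqfSum
    rw [sum_mul_sum, ← sum_product']
    choose a b hab using Nat.sq_mul_squarefree
    rw [sum_congr rfl (g := fun n => (1 : ℝ) / ((b n : ℕ) : ℝ) ^ 2 * (1 / (a n : ℕ))) fun n hn => by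
      conv_lhs => rw [← (hab n).1]
      push_cast
      field_simp]
    rw [← sum_image (f := fun y : ℕ × ℕ => (1 : ℝ) / ((y.1 : ℕ) : ℝ) ^ 2 * (1 / (y.2 : ℕ)))
      (g := fun n => (b n, a n))]
    · refine sum_le_sum_of_subset_of_nonneg ?_ fun _ _ _ => by positivity
      intro y hy
      obtain ⟨n, hn, rfl⟩ := mem_image.1 hy
      obtain ⟨h3, h4⟩ := hab n
      rw [mem_Icc] at hn
      have hb : 0 < b n := Nat.pos_of_ne_zero fun h => by rw [h] at h3; simp at h3; omega
      have ha : 0 < a n := Nat.pos_of_ne_zero fun h => by rw [h] at h3; simp at h3; omega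
      simp only [mem_product, mem_filter, mem_Icc, Nat.coprime_one_right_eq_true, and_true]
      refine ⟨⟨hb, ?_⟩, ⟨ha, ?_⟩, h4⟩ <;> nlinarith [Nat.mul_le_mul hb ha, Nat.mul_le_mul hb hb]
    · intro n _ n' _ h
      simp only [Prod.mk.injEq] at h
      rw [← (hab n).1, ← (hab n').1, h.1, h.2]
  have h3 : 0 ≤ sqfSum 1 V := sum_nonneg fun _ _ => by positivity
  have h4 := sum_one_div_sq_le V
  have h5 : ∑ a ∈ Icc 1 V, (1 : ℝ) / (a : ℝ) ^ 2 ≤ 2 := h4.trans (by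
    have : (0 : ℝ) ≤ 1 / V := by positivity
    linarith)
  push_cast at h1
  nlinarith [mul_le_mul_of_nonneg_right h5 h3]

lemma prod_one_add_inv_le (m : ℕ) (hm : 0 < m) (hφ : m ≤ 2 * m.totient) :
    ∏ p ∈ m.primeFactors, (1 + 1 / (p : ℝ)) ≤ 2 := by
  have h1 : (m.totient : ℝ) = m * ∏ p ∈ m.primeFactors, (1 - (p : ℝ)⁻¹) := by
    have := Nat.totient_eq_mul_prod_factors m
    have := congrArg (Rat.cast (K := ℝ)) this
    push_cast at this
    exact this
  have h2 : (∏ p ∈ m.primeFactors, (1 + 1 / (p : ℝ))) * ∏ p ∈ m.primeFactors, (1 - (p : ℝ)⁻¹) ≤ 1 := by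
    rw [← prod_mul_distrib]
    refine prod_le_one ?_ ?_
    · intro p hp
      have : (1 : ℝ) ≤ p := by exact_mod_cast (Nat.prime_of_mem_primeFactors hp).one_le
      have : (p : ℝ)⁻¹ ≤ 1 := inv_le_one_of_one_le₀ this
      have : (0 : ℝ) ≤ 1 / p := by positivity
      apply mul_nonneg <;> linarith
    · intro p _
      rw [one_div]
      nlinarith [sq_nonneg ((p : ℝ)⁻¹)]
  have h3 : (1 : ℝ) / 2 ≤ ∏ p ∈ m.primeFactors, (1 - (p : ℝ)⁻¹) := by
    have hm' : (0 : ℝ) < m := by exact_mod_cast hm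
    have : (m : ℝ) ≤ 2 * m.totient := by exact_mod_cast hφ
    rw [h1] at this
    by_contra h
    push Not at h
    nlinarith
  have h4 : 0 ≤ ∏ p ∈ m.primeFactors, (1 + 1 / (p : ℝ)) := prod_nonneg fun _ _ => by positivity
  nlinarith

lemma log_le_sqfSum_of_prime (m Q s : ℕ) (hm : 0 < m) (hsq : Squarefree m) (hφ : m ≤ 2 * m.totient)
    (hs : s.Prime) (hs5 : 5 ≤ s) (hsQ : s ^ 2 ≤ Q) :
    Real.log Q / 20 ≤ sqfSum (2 * 3 * s * m) (Q / s) := by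
  have h1 := log_le_sqfSum (Q / s)
  have h2 := sqfSum_le_mul 1 (Q / s) 2 Nat.prime_two
  have h3 := sqfSum_le_mul (1 * 2) (Q / s) 3 Nat.prime_three
  have h4 := sqfSum_le_mul (1 * 2 * 3) (Q / s) s hs
  have h5 := sqfSum_le_prod (1 * 2 * 3 * s) (Q / s) m.primeFactors
    (fun p hp => Nat.prime_of_mem_primeFactors hp)
  rw [Nat.prod_primeFactors_of_squarefree hsq] at h5
  have h6 := prod_one_add_inv_le m hm hφ
  simp only [one_mul] at h2 h3 h4 h5
  have h7 : 0 ≤ sqfSum (2 * 3 * s * m) (Q / s) := sum_nonneg fun _ _ => by positivity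
  have h7' : 0 ≤ sqfSum (2 * 3 * s) (Q / s) := sum_nonneg fun _ _ => by positivity
  have h8 : (1 : ℝ) / s ≤ 1 / 5 := one_div_le_one_div_of_le (by norm_num) (by exact_mod_cast hs5)
  have h9 : Real.log Q ≤ 2 * Real.log ((Q / s : ℕ) + 1) := by
    have : (Q : ℝ) ≤ (((Q / s : ℕ) : ℝ) + 1) ^ 2 := by
      have ha : Q < s * (Q / s + 1) := by
        have := Nat.lt_mul_div_succ Q hs.pos
        simpa using this
      have hb : s ≤ Q / s := (Nat.le_div_iff_mul_le hs.pos).2 (by nlinarith)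
      have : Q ≤ (Q / s + 1) ^ 2 := by nlinarith
      exact_mod_cast this
    rw [show (2 : ℝ) = (2 : ℕ) by norm_num, ← Real.log_pow]
    refine Real.log_le_log ?_ this
    have : 0 < Q := by nlinarith [hs.pos]
    exact_mod_cast this
  have h10 := mul_le_mul_of_nonneg_right h6 h7
  have h11 := mul_le_mul_of_nonneg_right h8 h7'
  push_cast at h2 h3 h4
  linarith

lemma exists_residue (m l : ℕ) (e : ℤ) (hl : l.Prime) (hlm : ¬ l ∣ m) (hle : ¬ (l : ℤ) ∣ e) :
    ∃ n₀, n₀ < l ∧ n₀ ≠ 0 ∧ ∀ n : ℕ, (l : ℤ) ∣ m * n + e ↔ n % l = n₀ := by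
  have := Fact.mk hl
  have hm : (m : ZMod l) ≠ 0 := by rwa [Ne, ZMod.natCast_eq_zero_iff]
  have he : (e : ZMod l) ≠ 0 := by rwa [Ne, ZMod.intCast_zmod_eq_zero_iff_dvd]
  refine ⟨(-(e : ZMod l) / m).val, ZMod.val_lt _, ?_, fun n => ?_⟩
  · rw [Ne, ZMod.val_eq_zero, div_eq_zero_iff, neg_eq_zero]
    tauto
  · rw [← ZMod.intCast_zmod_eq_zero_iff_dvd, ← ZMod.val_natCast, (ZMod.val_injective l).eq_iff,
      eq_div_iff hm]
    push_cast
    rw [add_eq_zero_iff_eq_neg, mul_comm]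

theorem sieve_count (m Q N : ℕ) (e : ℤ) (hm : 0 < m) (hsq : Squarefree m) (hφ : m ≤ 2 * m.totient)
    (he : e = 9 ∨ e = -9) (S : Finset ℕ) (hS : ∀ s ∈ S, s.Prime ∧ 5 ≤ s ∧ s ^ 2 ≤ Q ∧ ¬ s ∣ m)
    (hQ : 1 ≤ Q) (hQN : Q ^ 4 ≤ N) (Z : Finset ℕ) (hZ : Z ⊆ range N) (hZS : ∀ t ∈ Z, ∀ s ∈ S, ¬ s ∣ t)
    (hZl : ∀ t ∈ Z, ∀ l : ℕ, l.Prime → 5 ≤ l → l ≤ Q → ¬ l ∣ m → ¬ (l : ℤ) ∣ m * t + e) :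
    #Z * (Real.log Q * ∑ s ∈ S, (1 : ℝ) / s) ≤ 40 * N := by
  classical
  set bad : ℕ → ℕ → Prop := fun l n => (l : ℤ) ∣ m * n + e ∨ l ∈ S ∧ l ∣ n with hbad
  set ω : ℕ → ℝ := fun l => if l ∈ S then 2 else 1 with hω
  set η : ℕ → ℝ := fun l => ω l / (l - ω l) with hη
  set ψ : ℕ → ℕ → ℝ := fun l n => if bad l n then -1 else η l with hψ
  set D : Finset ℕ := (Icc 1 Q).filter (fun q => Squarefree q ∧ q.Coprime (2 * 3 * m)) with hD
  have hω1 : ∀ l, 1 ≤ ω l ∧ ω l ≤ 2 := by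
    intro l; simp only [hω]; split_ifs <;> norm_num
  have hDl : ∀ q ∈ D, ∀ l ∈ q.primeFactors, l.Prime ∧ 5 ≤ l ∧ l ≤ Q ∧ ¬ l ∣ m ∧ ¬ (l : ℤ) ∣ e := by
    intro q hq l hl
    simp only [hD, mem_filter, mem_Icc] at hq
    have hlp := Nat.prime_of_mem_primeFactors hl
    have hlq := Nat.dvd_of_mem_primeFactors hl
    have hc : l.Coprime (2 * 3 * m) := hq.2.2.coprime_dvd_left hlq
    have h2 : l ≠ 2 := by
      rintro rfl
      exact (Nat.prime_two.coprime_iff_not_dvd.1 hc) ⟨3 * m, by ring⟩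
    have h3 : l ≠ 3 := by
      rintro rfl
      exact (Nat.prime_three.coprime_iff_not_dvd.1 hc) ⟨2 * m, by ring⟩
    have h4 : l ≠ 4 := by rintro rfl; revert hlp; norm_num
    have := hlp.two_le
    refine ⟨hlp, by omega, (Nat.le_of_dvd (by omega) hlq).trans hq.1.2, ?_, ?_⟩
    · intro h
      exact hlp.coprime_iff_not_dvd.1 hc (h.mul_left _)
    · intro h
      have h9 : l ∣ 3 ^ 2 := by
        rcases he with rfl | rfl
        · exact_mod_cast h
        · rw [dvd_neg] at h; exact_mod_cast h
      exact h3 ((Nat.prime_dvd_prime_iff_eq hlp Nat.prime_three).1 (hlp.dvd_of_dvd_pow h9))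
  have hη0 : ∀ l, 5 ≤ l → 0 ≤ η l ∧ η l ≤ 1 ∧ ω l / l ≤ η l := by
    intro l hl
    have hl' : (5 : ℝ) ≤ l := by exact_mod_cast hl
    obtain ⟨h1, h2⟩ := hω1 l
    simp only [hη]
    refine ⟨div_nonneg (by linarith) (by linarith), ?_, ?_⟩
    · rw [div_le_one (by linarith)]; linarith
    · exact div_le_div_of_nonneg_left (by linarith) (by linarith) (by linarith)
  have hcount : ∀ q ∈ D, ∀ l ∈ q.primeFactors, (#((range l).filter (bad l)) : ℝ) = ω l := by
    intro q hq l hl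
    obtain ⟨hlp, hl5, -, hlm, hle⟩ := hDl q hq l hl
    obtain ⟨n₀, hn, hn0, hiff⟩ := exists_residue m l e hlp hlm hle
    by_cases hlS : l ∈ S
    · have : (range l).filter (bad l) = {n₀, 0} := by
        ext n
        simp only [mem_filter, mem_range, hbad, hiff, hlS, true_and, mem_insert, mem_singleton]
        constructor
        · rintro ⟨h1, h2 | h2⟩
          · rw [Nat.mod_eq_of_lt h1] at h2; exact Or.inl h2
          · exact Or.inr (Nat.eq_zero_of_dvd_of_lt h2 h1)
        · rintro (rfl | rfl)
          · exact ⟨hn, Or.inl (Nat.mod_eq_of_lt hn)⟩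
          · exact ⟨hlp.pos, Or.inr (dvd_zero _)⟩
      rw [this, card_pair hn0]
      simp [hω, hlS]
    · have : (range l).filter (bad l) = {n₀} := by
        ext n
        simp only [mem_filter, mem_range, hbad, hiff, hlS, false_and, or_false, mem_singleton]
        constructor
        · rintro ⟨h1, h2⟩
          rwa [Nat.mod_eq_of_lt h1] at h2
        · rintro rfl
          exact ⟨hn, Nat.mod_eq_of_lt hn⟩
      rw [this]
      simp [hω, hlS]
  have hsum : ∀ q ∈ D, ∀ l ∈ q.primeFactors, ∀ x y : ℝ,
      ∑ n ∈ range l, (if bad l n then x else y) = ω l * x + (l - ω l) * y := by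
    intro q hq l hl x y
    have h1 := hcount q hq l hl
    have h2 := card_filter_add_card_filter_not (s := range l) (bad l)
    rw [card_range] at h2
    have h3 : (#((range l).filter (bad l)) : ℝ) + #((range l).filter (fun n => ¬ bad l n)) = l := by
      exact_mod_cast h2
    rw [sum_ite, sum_const, sum_const, nsmul_eq_mul, nsmul_eq_mul, ← h1, ← h3]
    ring
  have main := sieve_upper_bound ψ η D Q N
    (fun q hq => by
      simp only [hD, mem_filter, mem_Icc] at hq
      exact ⟨hq.2.1, hq.1.2⟩)
    (fun q hq l hl n => by
      obtain ⟨hlp, hl5, -, hlm, hle⟩ := hDl q hq l hl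
      obtain ⟨n₀, hn, hn0, hiff⟩ := exists_residue m l e hlp hlm hle
      simp only [hψ, hbad, hiff, Nat.mod_mod, Nat.dvd_mod_iff dvd_rfl])
    (fun q hq l hl => by
      have hl5 : (5 : ℝ) ≤ l := by exact_mod_cast (hDl q hq l hl).2.1
      have := (hω1 l).2
      simp only [hψ]
      rw [hsum q hq l hl, hη]
      have : (l : ℝ) - ω l ≠ 0 := by linarith
      field_simp
      ring)
    (fun q hq l hl => by
      have hl5 : (5 : ℝ) ≤ l := by exact_mod_cast (hDl q hq l hl).2.1
      have := (hω1 l).2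
      simp only [hψ, ite_pow]
      rw [hsum q hq l hl, hη]
      have : (l : ℝ) - ω l ≠ 0 := by linarith
      field_simp
      ring)
    (fun q hq l hl n => by
      have := hη0 l (hDl q hq l hl).2.1
      simp only [hψ]
      split_ifs
      · norm_num
      · rw [abs_of_nonneg this.1]; exact this.2.1)
    (fun q hq l hl => (hη0 l (hDl q hq l hl).2.1).1) Z hZ
    (fun t ht q hq l hl => by
      obtain ⟨hlp, hl5, hlQ, hlm, hle⟩ := hDl q hq l hl
      simp only [hψ]
      rw [if_neg]
      rintro (h | ⟨h, h'⟩)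
      · exact hZl t ht l hlp hl5 hlQ hlm h
      · exact hZS t ht l h h')
  set L := ∑ q ∈ D, ∏ l ∈ q.primeFactors, η l with hL
  have hH0 : ∀ q ∈ D, 0 ≤ ∏ l ∈ q.primeFactors, η l := fun q hq =>
    prod_nonneg fun l hl => (hη0 l (hDl q hq l hl).2.1).1
  have hL1 : 1 ≤ L := by
    have : (1 : ℕ) ∈ D := by simp [hD, hQ]
    have := single_le_sum hH0 this
    simpa using this
  have hHq : ∀ q ∈ D, (∑ s ∈ S, if s ∣ q then (1 : ℝ) / q else 0) ≤ ∏ l ∈ q.primeFactors, η l := by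
    intro q hq
    have hq0 : 0 < q ∧ Squarefree q := by
      simp only [hD, mem_filter, mem_Icc] at hq
      exact ⟨hq.1.1, hq.2.1⟩
    calc (∑ s ∈ S, if s ∣ q then (1 : ℝ) / q else 0) = #(S.filter (· ∣ q)) * (1 / q) := by
          rw [← sum_filter, sum_const, nsmul_eq_mul]
      _ ≤ 2 ^ #(S.filter (· ∣ q)) * (1 / q) := by
          refine mul_le_mul_of_nonneg_right ?_ (by positivity)
          exact_mod_cast Nat.lt_two_pow_self.le
      _ = (∏ l ∈ S.filter (· ∣ q), ω l) * (1 / q) := by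
          rw [prod_congr rfl (g := fun _ => (2 : ℝ)) fun l hl => by simp [hω, (mem_filter.1 hl).1],
            prod_const]
      _ ≤ (∏ l ∈ q.primeFactors, ω l) * (1 / q) := by
          refine mul_le_mul_of_nonneg_right ?_ (by positivity)
          refine prod_le_prod_of_subset_of_one_le ?_ (fun l _ => by linarith [(hω1 l).1])
            fun l _ _ => (hω1 l).1
          intro l hl
          obtain ⟨h1, h2⟩ := mem_filter.1 hl
          exact Nat.mem_primeFactors.2 ⟨(hS l h1).1, h2, hq0.1.ne'⟩
      _ = ∏ l ∈ q.primeFactors, ω l / l := by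
          rw [prod_div_distrib, ← Nat.cast_prod, Nat.prod_primeFactors_of_squarefree hq0.2]
          ring
      _ ≤ _ := prod_le_prod (fun l _ => div_nonneg (by linarith [(hω1 l).1]) (by positivity))
          fun l hl => (hη0 l (hDl q hq l hl).2.1).2.2
  have hLl : Real.log Q / 20 * ∑ s ∈ S, (1 : ℝ) / s ≤ L := by
    refine le_trans ?_ (sum_le_sum hHq)
    rw [sum_comm, mul_sum]
    refine sum_le_sum fun s hs => ?_
    obtain ⟨hsp, hs5, hsQ, hsm⟩ := hS s hs
    refine (mul_le_mul_of_nonneg_right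
      (log_le_sqfSum_of_prime m Q s hm hsq hφ hsp hs5 hsQ) (by positivity)).trans ?_
    rw [← sum_filter]
    unfold sqfSum
    rw [sum_mul, sum_congr rfl (g := fun u => (1 : ℝ) / ((s * u : ℕ) : ℝ)) fun u _ => by
      push_cast; field_simp]
    rw [← sum_image (f := fun q : ℕ => (1 : ℝ) / q) (g := fun u => s * u)]
    · refine sum_le_sum_of_subset_of_nonneg ?_ fun _ _ _ => by positivity
      intro q hq
      obtain ⟨u, hu, rfl⟩ := mem_image.1 hq
      simp only [mem_filter, mem_Icc, hD] at hu ⊢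
      obtain ⟨⟨hu1, hu2⟩, hus, huc⟩ := hu
      have huc1 : u.Coprime s := huc.coprime_dvd_right ⟨2 * 3 * m, by ring⟩
      have huc2 : u.Coprime (2 * 3 * m) := huc.coprime_dvd_right ⟨s, by ring⟩
      refine ⟨⟨⟨Nat.mul_pos hsp.pos hu1, ?_⟩, ?_, ?_⟩, dvd_mul_right _ _⟩
      · exact (Nat.mul_le_mul_left s hu2).trans (Nat.mul_div_le Q s)
      · exact (Nat.squarefree_mul huc1.symm).2 ⟨hsp.squarefree, hus⟩
      · refine Nat.Coprime.mul_left ?_ huc2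
        rw [hsp.coprime_iff_not_dvd]
        intro h
        rcases (hsp.dvd_mul).1 h with h | h
        · have := Nat.le_of_dvd (by norm_num) h
          have : s = 5 ∨ s = 6 := by omega
          rcases this with rfl | rfl
          · revert h; norm_num
          · revert hsp; norm_num
        · exact hsm h
    · intro u _ v _ h
      exact Nat.eq_of_mul_eq_mul_left hsp.pos h
  have hQN' : (Q : ℝ) ^ 4 ≤ N := by exact_mod_cast hQN
  have h1 : #Z * L ≤ 2 * N := by
    have h2 : L * (#Z * L) ≤ L * (2 * N) := by nlinarith
    exact le_of_mul_le_mul_left h2 (by linarith)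
  have h3 := mul_le_mul_of_nonneg_left hLl (Nat.cast_nonneg (α := ℝ) #Z)
  linarith [show (#Z : ℝ) * (Real.log Q / 20 * ∑ s ∈ S, (1 : ℝ) / s) =
    #Z * (Real.log Q * ∑ s ∈ S, (1 : ℝ) / s) / 20 by ring]

end SieveBounds

section ChebyshevBounds

open Finset

lemma sum_log_prime_ge (V : ℕ) (hV : 1600000000 ≤ V) :
    9 * (V : ℝ) ≤ ∑ p ∈ (Ioc V (16 * V)).filter Nat.Prime, Real.log p := by
  have hV' : (1600000000 : ℝ) ≤ V := by exact_mod_cast hV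
  have e : ∑ p ∈ (Ioc V (16 * V)).filter Nat.Prime, Real.log p =
      Chebyshev.theta ((16 * V : ℕ) : ℝ) - Chebyshev.theta (V : ℝ) := by
    unfold Chebyshev.theta
    rw [Nat.floor_natCast, Nat.floor_natCast, eq_sub_iff_add_eq, add_comm, ← sum_union]
    · congr 1
      rw [← filter_union, Ioc_union_Ioc_eq_Ioc (by omega) (by omega)]
    · refine disjoint_left.2 fun p h1 h2 => ?_
      simp only [mem_filter, mem_Ioc] at h1 h2
      omega
  rw [e]
  have h1 := Chebyshev.theta_ge (16 * V)
  have h2 := Chebyshev.theta_le_log4_mul_x (Nat.cast_nonneg (α := ℝ) V)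
  have h3 : Real.log 4 = 2 * Real.log 2 := by
    rw [show (4 : ℝ) = 2 ^ 2 by norm_num, Real.log_pow]; norm_num
  have h4 := Real.log_two_gt_d9
  have h5 := Real.log_two_lt_d9
  set n : ℝ := ((16 * V : ℕ) : ℝ) with hn
  have hnV : n = 16 * V := by rw [hn]; push_cast; ring
  have hn0 : 0 ≤ n := by rw [hnV]; positivity
  set y : ℝ := n ^ (1 / 4 : ℝ) with hy
  have hy0 : 0 ≤ y := Real.rpow_nonneg hn0 _
  have hy4 : y ^ 4 = n := by
    rw [hy, ← Real.rpow_natCast, ← Real.rpow_mul hn0]; norm_num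
  have hyl : 400 ≤ y := by
    by_contra h
    push Not at h
    have : y ^ 4 < 400 ^ 4 := pow_lt_pow_left₀ h hy0 (by norm_num)
    rw [hy4, hnV] at this
    linarith
  have hsq : √n = y ^ 2 := by
    rw [← hy4, show y ^ 4 = (y ^ 2) ^ 2 by ring, Real.sqrt_sq (by positivity)]
  have hlog : Real.log n ≤ 4 * y := by
    have := Real.log_le_rpow_div hn0 (show (0 : ℝ) < 1 / 4 by norm_num)
    rw [← hy] at this
    linarith
  have hlog1 : Real.log (n + 1) ≤ 1 + 4 * y := by
    have : Real.log (n + 1) ≤ Real.log (2 * n) := Real.log_le_log (by linarith) (by linarith)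
    rw [Real.log_mul (by norm_num) (by linarith)] at this
    linarith
  have h6 : 2 * √n * Real.log n ≤ 8 * y ^ 3 := by
    rw [hsq]
    nlinarith [mul_le_mul_of_nonneg_left hlog (sq_nonneg y)]
  have h7 : 8 * y ^ 3 + (1 + 4 * y) ≤ 0.04 * n := by
    rw [← hy4]
    have a1 : 400 * y ^ 3 ≤ y ^ 4 := by
      nlinarith [mul_le_mul_of_nonneg_left hyl (pow_nonneg hy0 3)]
    have a2 : 400 * y ^ 2 ≤ y ^ 3 := by
      nlinarith [mul_le_mul_of_nonneg_left hyl (pow_nonneg hy0 2)]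
    have a3 : 400 * y ≤ y ^ 2 := by nlinarith
    linarith
  have e2 : ((16 * V : ℕ) : ℝ) = n := rfl
  nlinarith

/-- The primes in `(16 ^ j, 16 ^ (j + 1)]`. -/
def primeBlock (j : ℕ) : Finset ℕ := (Ioc (16 ^ j) (16 ^ (j + 1))).filter Nat.Prime

lemma mem_primeBlock {j p : ℕ} : p ∈ primeBlock j ↔ (16 ^ j < p ∧ p ≤ 16 ^ (j + 1)) ∧ p.Prime := by
  simp [primeBlock]

lemma card_primeBlock (j : ℕ) (hj : 8 ≤ j) : 16 ^ j ≤ #(primeBlock j) * (j + 1) := by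
  have hV : 1600000000 ≤ 16 ^ j :=
    le_trans (by norm_num) (Nat.pow_le_pow_right (by norm_num : 0 < 16) hj)
  have h1 := sum_log_prime_ge (16 ^ j) hV
  have h2 : ∑ p ∈ (Ioc (16 ^ j) (16 * 16 ^ j)).filter Nat.Prime, Real.log p ≤
      #(primeBlock j) * (2.8 * (j + 1)) := by
    rw [← nsmul_eq_mul, primeBlock, pow_succ']
    refine sum_le_card_nsmul _ _ _ fun p hp => ?_
    simp only [mem_filter, mem_Ioc] at hp
    have : (p : ℝ) ≤ 16 ^ (j + 1) := by rw [pow_succ']; exact_mod_cast hp.1.2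
    have h3 := Real.log_le_log (by exact_mod_cast hp.2.pos) this
    rw [Real.log_pow, show (16 : ℝ) = 2 ^ 4 by norm_num, Real.log_pow] at h3
    push_cast at h3
    have h5 := Real.log_two_lt_d9
    have : (0 : ℝ) ≤ j := by positivity
    nlinarith
  have h3 : (16 ^ j : ℝ) ≤ #(primeBlock j) * (j + 1) := by
    push_cast at h1
    have : (0 : ℝ) ≤ #(primeBlock j) * (j + 1) := by positivity
    nlinarith
  exact_mod_cast h3

lemma primeBlock_disjoint {i j p : ℕ} (hi : p ∈ primeBlock i) (hj : p ∈ primeBlock j) : i = j := by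
  rw [mem_primeBlock] at hi hj
  have h1 := (Nat.pow_lt_pow_iff_right (by norm_num : 1 < 16)).1 (hi.1.1.trans_le hj.1.2)
  have h2 := (Nat.pow_lt_pow_iff_right (by norm_num : 1 < 16)).1 (hj.1.1.trans_le hi.1.2)
  omega

lemma sum_primeBlock_inv (j : ℕ) (hj : 8 ≤ j) :
    1 / (16 * ((j : ℝ) + 1)) ≤ ∑ s ∈ primeBlock j, (1 : ℝ) / s := by
  have h1 : (16 : ℝ) ^ j ≤ #(primeBlock j) * ((j : ℝ) + 1) := by exact_mod_cast card_primeBlock j hj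
  have h2 : #(primeBlock j) • ((1 : ℝ) / 16 ^ (j + 1)) ≤ ∑ s ∈ primeBlock j, (1 : ℝ) / s := by
    refine card_nsmul_le_sum _ _ _ fun s hs => ?_
    rw [mem_primeBlock] at hs
    exact one_div_le_one_div_of_le (by exact_mod_cast hs.2.pos) (by exact_mod_cast hs.1.2)
  refine le_trans ?_ h2
  rw [nsmul_eq_mul, mul_one_div, div_le_div_iff₀ (by positivity) (by positivity), pow_succ]
  nlinarith

lemma sum_inv_dyadic (A t : ℕ) (hA : 1 ≤ A) :
    (t : ℝ) / 2 ≤ ∑ v ∈ Ico A (2 ^ t * A), 1 / ((v : ℝ) + 1) := by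
  induction t with
  | zero => simp
  | succ t ih =>
    have h0 : A ≤ 2 ^ t * A := Nat.le_mul_of_pos_left _ (by positivity)
    have hpos : 0 < 2 ^ t * A := by positivity
    have e : 2 ^ (t + 1) * A = 2 * (2 ^ t * A) := by ring
    rw [e, ← sum_Ico_consecutive _ h0 (by omega)]
    set W := 2 ^ t * A with hW
    have h1 : #(Ico W (2 * W)) • (1 / (2 * (W : ℝ))) ≤ ∑ v ∈ Ico W (2 * W), 1 / ((v : ℝ) + 1) := by
      refine card_nsmul_le_sum _ _ _ fun v hv => ?_
      rw [mem_Ico] at hv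
      refine one_div_le_one_div_of_le (by positivity) ?_
      have : v + 1 ≤ 2 * W := hv.2
      exact_mod_cast this
    rw [Nat.card_Ico, show 2 * W - W = W by omega, nsmul_eq_mul] at h1
    have h2 : (W : ℝ) * (1 / (2 * (W : ℝ))) = 1 / 2 := by
      have : (W : ℝ) ≠ 0 := by positivity
      field_simp
    push_cast
    linarith

/-- Primes lying in the blocks with exponents in `[A, 2 ^ t * A)`. -/
def primeRange (A t : ℕ) : Finset ℕ := (Ico A (2 ^ t * A)).biUnion primeBlock

lemma sum_primeRange_inv (A t : ℕ) (hA : 8 ≤ A) :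
    (t : ℝ) / 32 ≤ ∑ s ∈ primeRange A t, (1 : ℝ) / s := by
  rw [primeRange, sum_biUnion]
  · have h1 := sum_inv_dyadic A t (by omega)
    have h2 : ∑ v ∈ Ico A (2 ^ t * A), 1 / (16 * ((v : ℝ) + 1)) ≤
        ∑ v ∈ Ico A (2 ^ t * A), ∑ s ∈ primeBlock v, (1 : ℝ) / s :=
      sum_le_sum fun v hv => sum_primeBlock_inv v (hA.trans (mem_Ico.1 hv).1)
    have h3 : ∑ v ∈ Ico A (2 ^ t * A), 1 / (16 * ((v : ℝ) + 1)) =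
        1 / 16 * ∑ v ∈ Ico A (2 ^ t * A), 1 / ((v : ℝ) + 1) := by
      rw [mul_sum]
      exact sum_congr rfl fun v _ => by rw [one_div_mul_one_div]
    linarith
  · intro i _ j _ hij
    exact disjoint_left.2 fun p hi hj => hij (primeBlock_disjoint hi hj)

lemma mem_primeRange {A t s : ℕ} (hs : s ∈ primeRange A t) :
    s.Prime ∧ 16 ^ A < s ∧ s ≤ 16 ^ (2 ^ t * A) := by
  obtain ⟨v, hv, h⟩ := mem_biUnion.1 hs
  rw [mem_primeBlock] at h
  rw [mem_Ico] at hv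
  exact ⟨h.2, (Nat.pow_le_pow_right (by norm_num) hv.1).trans_lt h.1.1,
    h.1.2.trans (Nat.pow_le_pow_right (by norm_num) hv.2)⟩

/-- Choosing, for each `i`, one of two numbers so that the product approximates a given size. -/
lemma exists_balanced_product (k : ℕ) (r r' : ℕ → ℕ)
    (hlo : ∀ i < k, 16 ^ 2 ^ (i + 1) * r i ≤ r' i) (hhi : ∀ i < k, r' i ≤ 16 ^ (2 ^ (i + 1) + 2) * r i)
    (D Z : ℕ) (h1 : D * ∏ i ∈ range k, r i ≤ Z) (h2 : Z ≤ 16 ^ 4 * (D * ∏ i ∈ range k, r' i)) :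
    ∃ A, A ∣ D * ((∏ i ∈ range k, r i) * ∏ i ∈ range k, r' i) ∧ A ≤ Z ∧ Z ≤ 16 ^ 4 * A ∧ D ∣ A := by
  have hprod : ∀ j ≤ k, 16 ^ 2 ^ (j + 1) * ∏ i ∈ range j, r i ≤ 16 ^ 2 * ∏ i ∈ range j, r' i := by
    intro j hj
    induction j with
    | zero => norm_num
    | succ j ih =>
      have ih := ih (by omega)
      rw [prod_range_succ, prod_range_succ, show 2 ^ (j + 1 + 1) = 2 ^ (j + 1) + 2 ^ (j + 1) by ring,
        pow_add]
      calc _ = (16 ^ 2 ^ (j + 1) * ∏ i ∈ range j, r i) * (16 ^ 2 ^ (j + 1) * r j) := by ring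
        _ ≤ (16 ^ 2 * ∏ i ∈ range j, r' i) * r' j := Nat.mul_le_mul ih (hlo j (by omega))
        _ = _ := by ring
  induction k generalizing D with
  | zero => exact ⟨D, by simp, by simpa using h1, by simpa using h2, dvd_rfl⟩
  | succ k ih =>
    rw [prod_range_succ] at h1 h2
    by_cases hc : D * r' k * ∏ i ∈ range k, r i ≤ Z
    · obtain ⟨A, hA1, hA2, hA3, hA4⟩ := ih (fun i hi => hlo i (by omega)) (fun i hi => hhi i (by omega))
        (D * r' k) hc (h2.trans_eq (by ring)) (fun j hj => hprod j (by omega))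
      refine ⟨A, hA1.trans ⟨r k, ?_⟩, hA2, hA3, (dvd_mul_right _ _).trans hA4⟩
      rw [prod_range_succ, prod_range_succ]; ring
    · push Not at hc
      obtain ⟨A, hA1, hA2, hA3, hA4⟩ := ih (fun i hi => hlo i (by omega)) (fun i hi => hhi i (by omega))
        (D * r k) ((le_of_eq (by ring)).trans h1) (by
          refine hc.le.trans ?_
          have h3 := hhi k (by omega)
          have h4 := hprod k (by omega)
          calc D * r' k * ∏ i ∈ range k, r i
              ≤ D * (16 ^ (2 ^ (k + 1) + 2) * r k) * ∏ i ∈ range k, r i := by gcongr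
            _ = D * r k * 16 ^ 2 * (16 ^ 2 ^ (k + 1) * ∏ i ∈ range k, r i) := by rw [pow_add]; ring
            _ ≤ D * r k * 16 ^ 2 * (16 ^ 2 * ∏ i ∈ range k, r' i) := Nat.mul_le_mul_left _ h4
            _ = _ := by ring) (fun j hj => hprod j (by omega))
      refine ⟨A, hA1.trans ⟨r' k, ?_⟩, hA2, hA3, (dvd_mul_right _ _).trans hA4⟩
      rw [prod_range_succ, prod_range_succ]; ring

lemma prime_not_dvd_prod_of_block (E : Finset ℕ) (f : ℕ → ℕ) (hf : ∀ j ∈ E, f j ∈ primeBlock j)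
    {i p : ℕ} (hp : p ∈ primeBlock i) (hi : i ∉ E) : ¬ p ∣ ∏ j ∈ E, f j := by
  intro h
  obtain ⟨j, hj, hpj⟩ := (Prime.dvd_finsetProd_iff (mem_primeBlock.1 hp).2.prime f).1 h
  have := (Nat.prime_dvd_prime_iff_eq (mem_primeBlock.1 hp).2 (mem_primeBlock.1 (hf j hj)).2).1 hpj
  subst this
  exact hi (primeBlock_disjoint hp (hf j hj) ▸ hj)

lemma exists_block_products (E : Finset ℕ) : ∃ M : Finset ℕ, #M = ∏ j ∈ E, #(primeBlock j) ∧
    ∀ m ∈ M, ∃ f : ℕ → ℕ, (∀ j ∈ E, f j ∈ primeBlock j) ∧ m = ∏ j ∈ E, f j := by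
  classical
  induction E using Finset.induction_on with
  | empty => exact ⟨{1}, by simp, by simp⟩
  | insert i E hi ih =>
    obtain ⟨M, hM, hMf⟩ := ih
    refine ⟨(primeBlock i ×ˢ M).image (fun y => y.1 * y.2), ?_, ?_⟩
    · rw [card_image_of_injOn, card_product, prod_insert hi, hM]
      rintro ⟨p, m⟩ h ⟨p', m'⟩ h' he
      simp only [coe_product, Set.mem_prod, mem_coe] at h h'
      simp only at he
      obtain ⟨f, hf, hm'⟩ := hMf m' h'.2
      have hpp := (mem_primeBlock.1 h.1).2
      have h1 : p ∣ p' * m' := ⟨m, he.symm⟩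
      have h2 : ¬ p ∣ m' := by rw [hm']; exact prime_not_dvd_prod_of_block E f hf h.1 hi
      have h3 := (Nat.prime_dvd_prime_iff_eq hpp (mem_primeBlock.1 h'.1).2).1
        ((hpp.dvd_mul.1 h1).resolve_right h2)
      subst h3
      rw [Nat.eq_of_mul_eq_mul_left hpp.pos he]
    · intro m hm
      obtain ⟨⟨p, m'⟩, h, rfl⟩ := mem_image.1 hm
      rw [mem_product] at h
      obtain ⟨f, hf, hm'⟩ := hMf m' h.2
      refine ⟨Function.update f i p, ?_, ?_⟩
      · intro j hj
        rcases mem_insert.1 hj with hji | hjE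
        · rw [hji, Function.update_self]; exact h.1
        · rw [Function.update_of_ne (ne_of_mem_of_not_mem hjE hi)]; exact hf j hjE
      · rw [prod_insert hi, Function.update_self, prod_congr rfl (g := f) fun j hj =>
          Function.update_of_ne (by rintro rfl; exact hi hj) _ _, ← hm']

lemma one_sub_sum_le_prod_one_sub (E : Finset ℕ) (g : ℕ → ℝ) (h0 : ∀ j ∈ E, 0 ≤ g j)
    (h1 : ∀ j ∈ E, g j ≤ 1) : 1 - ∑ j ∈ E, g j ≤ ∏ j ∈ E, (1 - g j) := by
  classical
  induction E using Finset.induction_on with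
  | empty => simp
  | insert i E hi ih =>
    have ih := ih (fun j hj => h0 j (mem_insert_of_mem hj)) (fun j hj => h1 j (mem_insert_of_mem hj))
    rw [sum_insert hi, prod_insert hi]
    have a1 := h0 i (mem_insert_self _ _)
    have a2 := h1 i (mem_insert_self _ _)
    have a3 : 0 ≤ ∑ j ∈ E, g j := sum_nonneg fun j hj => h0 j (mem_insert_of_mem hj)
    nlinarith [mul_le_mul_of_nonneg_left ih (sub_nonneg.2 a2)]

lemma block_product_props (E : Finset ℕ) (B : ℕ) (hEB : ∀ j ∈ E, B ≤ j)
    (hE : 2 * #E ≤ 16 ^ B) (f : ℕ → ℕ) (hf : ∀ j ∈ E, f j ∈ primeBlock j) :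
    Squarefree (∏ j ∈ E, f j) ∧ (∏ j ∈ E, f j) ≤ 2 * (∏ j ∈ E, f j).totient ∧
      (∏ j ∈ E, f j) ≤ 16 ^ ∑ j ∈ E, (j + 1) ∧ (∏ j ∈ E, f j).primeFactors = E.image f ∧
      ∀ g, g ∣ ∏ j ∈ E, f j → g ≠ 1 → 16 ^ B < g := by
  classical
  have hinj : Set.InjOn f E := by
    intro i hi j hj h
    exact primeBlock_disjoint (hf i hi) (h ▸ hf j hj)
  have hpr : ∀ j ∈ E, (f j).Prime := fun j hj => (mem_primeBlock.1 (hf j hj)).2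
  have hgt : ∀ j ∈ E, 16 ^ B < f j := fun j hj =>
    (Nat.pow_le_pow_right (by norm_num) (hEB j hj)).trans_lt (mem_primeBlock.1 (hf j hj)).1.1
  have hpf : (∏ j ∈ E, f j).primeFactors = E.image f := by
    rw [← prod_image (s := E) (g := f) (f := fun p => p) hinj]
    refine Nat.primeFactors_prod fun p hp => ?_
    obtain ⟨j, hj, rfl⟩ := mem_image.1 hp
    exact hpr j hj
  have hne : ∏ j ∈ E, f j ≠ 0 := prod_ne_zero_iff.2 fun j hj => (hpr j hj).ne_zero
  refine ⟨?_, ?_, ?_, hpf, ?_⟩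
  · refine squarefree_prod_of_pairwise_isCoprime ?_ fun j hj => (hpr j hj).squarefree
    intro i hi j hj hij
    rw [Function.onFun, Nat.coprime_iff_isRelPrime.symm]
    exact (Nat.coprime_primes (hpr i hi) (hpr j hj)).2 fun h => hij (hinj hi hj h)
  · have h1 := congrArg (Rat.cast (K := ℝ)) (Nat.totient_eq_mul_prod_factors (∏ j ∈ E, f j))
    push_cast at h1
    have h2 : (1 : ℝ) / 2 ≤ ∏ p ∈ (∏ j ∈ E, f j).primeFactors, (1 - (p : ℝ)⁻¹) := by
      rw [hpf, prod_image hinj]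
      have h3 := one_sub_sum_le_prod_one_sub E (fun j => (f j : ℝ)⁻¹) (fun j _ => by positivity)
        (fun j hj => inv_le_one_of_one_le₀ (by exact_mod_cast (hpr j hj).one_le))
      have h4 : ∑ j ∈ E, (f j : ℝ)⁻¹ ≤ #E • ((16 : ℝ) ^ B)⁻¹ := by
        refine sum_le_card_nsmul _ _ _ fun j hj => ?_
        exact inv_anti₀ (by positivity) (by exact_mod_cast (hgt j hj).le)
      have h5 : (#E : ℝ) * ((16 : ℝ) ^ B)⁻¹ ≤ 1 / 2 := by
        rw [← div_eq_mul_inv, div_le_div_iff₀ (by positivity) (by norm_num)]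
        have : (2 * #E : ℝ) ≤ 16 ^ B := by exact_mod_cast hE
        linarith
      rw [nsmul_eq_mul] at h4
      linarith
    have h3 : (∏ j ∈ E, (f j : ℝ)) ≤ 2 * ((∏ j ∈ E, f j).totient : ℝ) := by
      rw [h1]
      have : (0 : ℝ) ≤ ∏ j ∈ E, (f j : ℝ) := prod_nonneg fun _ _ => by positivity
      nlinarith
    exact_mod_cast h3
  · rw [← prod_pow_eq_pow_sum]
    exact prod_le_prod' fun j hj => (mem_primeBlock.1 (hf j hj)).1.2
  · intro g hg hg1
    obtain ⟨p, hp, hpg⟩ := Nat.exists_prime_and_dvd hg1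
    have : p ∈ (∏ j ∈ E, f j).primeFactors := Nat.mem_primeFactors.2 ⟨hp, hpg.trans hg, hne⟩
    rw [hpf] at this
    obtain ⟨j, hj, rfl⟩ := mem_image.1 this
    exact (hgt j hj).trans_le (Nat.le_of_dvd (Nat.pos_of_dvd_of_pos hg (Nat.pos_of_ne_zero hne)) hpg)

end ChebyshevBounds

section GoodPrime

open Finset ArithmeticFunction

lemma sum_vonMangoldt_not_prime_le (x : ℕ) (hx : 1 ≤ x) :
    ∑ n ∈ (range (256 * x)).filter (fun n => ¬ n.Prime), Λ n ≤
      32 * √x * Real.log (256 * x : ℕ) := by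
  have h1 : (1 : ℝ) ≤ (256 * x : ℕ) := by exact_mod_cast (by omega : 1 ≤ 256 * x)
  have h2 := Chebyshev.psi_sub_theta_le h1
  rw [Chebyshev.psi_sub_theta_eq_sum_not_prime, Nat.floor_natCast] at h2
  have h3 : √((256 * x : ℕ) : ℝ) = 16 * √x := by
    rw [show ((256 * x : ℕ) : ℝ) = 16 ^ 2 * x by push_cast; ring, Real.sqrt_mul (by norm_num),
      Real.sqrt_sq (by norm_num)]
  rw [h3] at h2
  refine le_trans ?_ (h2.trans_eq (by ring))
  rw [sum_filter]
  refine (sum_le_sum_of_subset_of_nonneg (s := range (256 * x)) (t := insert 0 (Ioc 0 (256 * x))) ?_ ?_).trans ?_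
  · intro n hn
    simp only [mem_insert, mem_Ioc, mem_range] at hn ⊢
    omega
  · intro n _ _
    split_ifs
    · exact le_rfl
    · exact vonMangoldt_nonneg
  · rw [sum_insert (by simp), sum_filter]
    simp

theorem exists_prime_of_apKer_bound (m x Q c : ℕ) (e : ℤ) (S : Finset ℕ)
    (hm : 0 < m) (hsq : Squarefree m) (hφ : m ≤ 2 * m.totient) (hce : c = 1 ∧ e = 9 ∨ c = 2 ∧ e = -9)
    (hx : 9 ≤ x) (hmx : m ≤ x) (hS : ∀ s ∈ S, s.Prime ∧ 5 ≤ s ∧ s ^ 2 ≤ Q ∧ ¬ s ∣ m)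
    (hQ : 1 ≤ Q) (hQx : Q ≤ x) (hQm : Q ^ 4 * m ≤ x)
    (hlog : 10000 * Real.log (256 * x : ℕ) ≤ Real.log Q * ∑ s ∈ S, (1 : ℝ) / s)
    (hpp : 23 * m * Real.log (256 * x : ℕ) ≤ √x)
    (hmain : 18 * (x : ℝ) ≤
      ∑ p ∈ (Ioc (4 * x) (64 * x)).filter (fun p => p.Prime ∧ p % 3 = c), Real.log p)
    (hE : |∑ n ∈ range (256 * x), if n % 3 = c then Λ n * (wt x n * apKer m (e : ZMod m) n) else 0| ≤
      9 * x / m.totient) :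
    ∃ p t : ℕ, p.Prime ∧ x < p ∧ p < 256 * x ∧ p % 3 = c ∧ (p : ℤ) = m * t + e ∧ ∃ s ∈ S, s ∣ t := by
  classical
  by_contra hno
  push Not at hno
  set W : ℕ → ℝ := fun n => if n % 3 = c then Λ n * wt x n else 0 with hW
  have hW0 : ∀ n, 0 ≤ W n := by
    intro n
    simp only [hW]
    split_ifs
    · exact mul_nonneg vonMangoldt_nonneg (wt_nonneg x n)
    · exact le_rfl
  have hφ0 : (0 : ℝ) < m.totient := by exact_mod_cast Nat.totient_pos.2 hm
  have hm0 : (0 : ℝ) < m := by exact_mod_cast hm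
  have hx0 : (0 : ℝ) < x := by exact_mod_cast (by omega : 0 < x)
  have hsplit : ∑ n ∈ range (256 * x), (if n % 3 = c then Λ n * (wt x n * apKer m (e : ZMod m) n) else 0) =
      (∑ n ∈ range (256 * x), if (n : ZMod m) = e then W n else 0) -
        (∑ n ∈ range (256 * x), if n.Coprime m then W n else 0) / m.totient := by
    rw [sum_div, ← sum_sub_distrib]
    refine sum_congr rfl fun n _ => ?_
    simp only [hW, apKer]
    split_ifs <;> ring
  have hcop : 18 * (x : ℝ) ≤ ∑ n ∈ range (256 * x), if n.Coprime m then W n else 0 := by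
    refine hmain.trans ?_
    rw [← sum_filter]
    refine (sum_le_sum (g := W) fun p hp => ?_).trans (sum_le_sum_of_subset_of_nonneg ?_ fun n _ _ => hW0 n)
    · simp only [mem_filter, mem_Ioc] at hp
      simp only [hW]
      rw [if_pos hp.2.2, vonMangoldt_apply_prime hp.2.1]
      exact le_mul_of_one_le_right (Real.log_nonneg (by exact_mod_cast hp.2.1.one_le))
        (wt_ge (by omega) (by omega) (by omega))
    · intro p hp
      simp only [mem_filter, mem_Ioc, mem_range] at hp ⊢
      refine ⟨by omega, (hp.2.1.coprime_iff_not_dvd).2 fun h => ?_⟩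
      have := Nat.le_of_dvd hm h
      omega
  have hAP : 9 * (x : ℝ) / m ≤ ∑ n ∈ range (256 * x), if (n : ZMod m) = e then W n else 0 := by
    rw [hsplit] at hE
    have h1 := (abs_le.1 hE).1
    have h2 : 18 * (x : ℝ) / m.totient ≤
        (∑ n ∈ range (256 * x), if n.Coprime m then W n else 0) / m.totient := by gcongr
    have h3 : 9 * (x : ℝ) / m ≤ 9 * x / m.totient := by
      gcongr
      exact_mod_cast Nat.totient_le m
    have h4 : 18 * (x : ℝ) / m.totient = 9 * x / m.totient + 9 * x / m.totient := by ring
    linarith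
  set G := (range (256 * x)).filter
    (fun p => p.Prime ∧ x < p ∧ p % 3 = c ∧ (p : ZMod m) = e) with hG
  set N' := 256 * x / m + 11 with hN'
  set Z := (range N').filter (fun t => (∀ s ∈ S, ¬ s ∣ t) ∧
    ∀ l : ℕ, l.Prime → 5 ≤ l → l ≤ Q → ¬ l ∣ m → ¬ (l : ℤ) ∣ m * t + e) with hZ
  have hGt : ∀ p ∈ G, (p : ℤ) = m * (((p - e) / m).toNat : ℕ) + e := by
    intro p hp
    simp only [hG, mem_filter, mem_range] at hp
    have h1 : (m : ℤ) ∣ p - e := by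
      rw [← ZMod.intCast_zmod_eq_zero_iff_dvd]
      push_cast
      rw [hp.2.2.2.2, sub_self]
    have h2 : 0 ≤ ((p : ℤ) - e) / m := Int.ediv_nonneg (by omega) (by omega)
    rw [Int.toNat_of_nonneg h2, Int.mul_ediv_cancel' h1]
    ring
  have hGZ : #G ≤ #Z := by
    refine card_le_card_of_injOn (fun p => (((p : ℤ) - e) / m).toNat) ?_ ?_
    · intro p hp
      have h1 := hGt p hp
      simp only [hG, coe_filter, mem_range, Set.mem_ofPred_eq] at hp
      set t := (((p : ℤ) - e) / m).toNat with ht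
      simp only [hZ, coe_filter, mem_range, Set.mem_ofPred_eq]
      refine ⟨?_, hno p t hp.2.1 hp.2.2.1 hp.1 hp.2.2.2.1 h1, ?_⟩
      · have h2 : m * t ≤ 256 * x + 9 := by
          have : (m * t : ℤ) ≤ 256 * x + 9 := by omega
          exact_mod_cast this
        have h3 : t ≤ (256 * x + 9) / m := (Nat.le_div_iff_mul_le hm).2 (by rwa [mul_comm])
        have h4 : (256 * x + 9) / m ≤ 256 * x / m + 10 := by
          refine Nat.le_of_lt_succ ((Nat.div_lt_iff_lt_mul hm).2 ?_)
          have h5 := Nat.lt_div_mul_add (a := 256 * x) hm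
          nlinarith
        omega
      · intro l hl _ hlQ _ hdvd
        rw [← h1] at hdvd
        have h6 : l ∣ p := by exact_mod_cast hdvd
        have := (Nat.prime_dvd_prime_iff_eq hl hp.2.1).1 h6
        omega
    · intro p hp p' hp' h
      have h1 := hGt p hp
      have h2 := hGt p' hp'
      simp only at h
      rw [h, ← h2] at h1
      exact_mod_cast h1
  have hsieve := sieve_count m Q N' e hm hsq hφ (by tauto) S hS hQ (by
      have : Q ^ 4 ≤ x / m := (Nat.le_div_iff_mul_le hm).2 hQm
      have h2 : x / m ≤ 256 * x / m := Nat.div_le_div_right (by omega)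
      omega) Z (filter_subset _ _)
    (fun t ht => (mem_filter.1 ht).2.1) (fun t ht => (mem_filter.1 ht).2.2)
  have hN'x : (N' : ℝ) ≤ 267 * (x / m) := by
    have h1 : ((256 * x / m : ℕ) : ℝ) ≤ (256 * x : ℕ) / m := Nat.cast_div_le
    have h2 : (1 : ℝ) ≤ x / m := by
      rw [le_div_iff₀ hm0, one_mul]; exact_mod_cast hmx
    rw [hN']
    push_cast at h1 ⊢
    have : (256 * (x : ℝ)) / m = 256 * (x / m) := by ring
    linarith
  have hL0 : 0 ≤ Real.log (256 * x : ℕ) := Real.log_natCast_nonneg _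
  have hup : (∑ n ∈ range (256 * x), if (n : ZMod m) = e then W n else 0) ≤
      2.8 * ∑ n ∈ (range (256 * x)).filter (fun n => ¬ n.Prime), Λ n +
        #G * (2.8 * Real.log (256 * x : ℕ)) := by
    rw [← nsmul_eq_mul, ← sum_const, mul_sum, sum_filter, hG, sum_filter, ← sum_add_distrib]
    refine sum_le_sum fun n hn => ?_
    rw [mem_range] at hn
    have hΛ : 0 ≤ Λ n := vonMangoldt_nonneg
    have hw := (wt_le x n).trans log_sixteen_lt.le
    have hw0 := wt_nonneg x n
    have hWle : W n ≤ 2.8 * Λ n := by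
      simp only [hW]
      split_ifs
      · nlinarith
      · positivity
    by_cases hpn : n.Prime
    · rw [if_neg (not_not.2 hpn), zero_add]
      by_cases hcond : n.Prime ∧ x < n ∧ n % 3 = c ∧ (n : ZMod m) = e
      · rw [if_pos hcond, if_pos hcond.2.2.2]
        refine hWle.trans ?_
        have : Λ n ≤ Real.log (256 * x : ℕ) := vonMangoldt_le_log.trans
          (Real.log_le_log (by exact_mod_cast hpn.pos) (by exact_mod_cast hn.le))
        linarith
      · rw [if_neg hcond]
        by_cases h1 : (n : ZMod m) = e
        · rw [if_pos h1]
          simp only [hW]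
          by_cases h2 : n % 3 = c
          · rw [if_pos h2, wt_eq_zero_of_le (by omega) (not_lt.1 fun hh => hcond ⟨hpn, hh, h2, h1⟩), mul_zero]
          · rw [if_neg h2]
        · rw [if_neg h1]
    · rw [if_pos hpn, if_neg (c := n.Prime ∧ _) (fun h => hpn h.1), add_zero]
      split_ifs
      · exact hWle
      · positivity
  have hnp := sum_vonMangoldt_not_prime_le x (by omega)
  have h1 : 90 * √x * Real.log (256 * x : ℕ) ≤ 4 * (x / m) := by
    have h2 : √(x : ℝ) * (23 * m * Real.log (256 * x : ℕ)) ≤ x := by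
      calc _ ≤ √(x : ℝ) * √x := by gcongr
        _ = x := Real.mul_self_sqrt hx0.le
    rw [← mul_div_assoc, le_div_iff₀ hm0]
    linarith
  have h2 : #G * Real.log (256 * x : ℕ) ≤ 1.07 * (x / m) := by
    have h3 : (#G : ℝ) * (10000 * Real.log (256 * x : ℕ)) ≤ #Z * (Real.log Q * ∑ s ∈ S, (1 : ℝ) / s) :=
      mul_le_mul (by exact_mod_cast hGZ) hlog (by positivity) (by positivity)
    linarith
  have h3 : (0 : ℝ) < x / m := by positivity
  have h4 : 9 * (x : ℝ) / m = 9 * (x / m) := by ring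
  have h5 : 0 ≤ √(x : ℝ) * Real.log (256 * x : ℕ) := by positivity
  linarith

end GoodPrime

section Parameters

open Finset

/-- Exponents of the blocks from which the prime factors of the moduli are taken. -/
def blockExps (k w : ℕ) : Finset ℕ :=
  insert w ((range k).image (fun i => k ^ 3 + 2 * i) ∪
    (range k).image (fun i => k ^ 3 + 2 * i + 2 ^ (i + 1) + 1))

lemma blockExps_aux (k w : ℕ) (hw : k ^ 3 + 2 * k + 2 ^ k + 1 < w) :
    (∀ i, i < k → k ^ 3 + 2 * i + 2 ^ (i + 1) + 1 < w) ∧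
    Set.InjOn (fun i => k ^ 3 + 2 * i) (range k : Finset ℕ) ∧
    Set.InjOn (fun i => k ^ 3 + 2 * i + 2 ^ (i + 1) + 1) (range k : Finset ℕ) ∧
    Disjoint ((range k).image (fun i => k ^ 3 + 2 * i))
      ((range k).image (fun i => k ^ 3 + 2 * i + 2 ^ (i + 1) + 1)) ∧
    w ∉ (range k).image (fun i => k ^ 3 + 2 * i) ∪
      (range k).image (fun i => k ^ 3 + 2 * i + 2 ^ (i + 1) + 1) := by
  have h1 : ∀ i, i < k → k ^ 3 + 2 * i + 2 ^ (i + 1) + 1 < w := by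
    intro i hi
    have : 2 ^ (i + 1) ≤ 2 ^ k := Nat.pow_le_pow_right (by norm_num) hi
    omega
  refine ⟨h1, fun i _ j _ h => by simp only at h; omega, ?_, ?_, ?_⟩
  · have : StrictMono (fun i => k ^ 3 + 2 * i + 2 ^ (i + 1) + 1) := by
      refine strictMono_nat_of_lt_succ fun i => ?_
      have : 2 ^ (i + 1) < 2 ^ (i + 1 + 1) := Nat.pow_lt_pow_right (by norm_num) (by omega)
      omega
    exact this.injective.injOn
  · refine disjoint_left.2 fun j hj hj' => ?_
    obtain ⟨i, -, rfl⟩ := mem_image.1 hj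
    obtain ⟨i', -, h⟩ := mem_image.1 hj'
    rw [pow_succ] at h
    omega
  · simp only [mem_union, mem_image, mem_range, not_or, not_exists, not_and]
    refine ⟨fun i hi h => ?_, fun i hi h => ?_⟩ <;> have := h1 i hi <;> have := Nat.two_pow_pos (i + 1) <;> omega

lemma prod_blockExps {k w : ℕ} (hw : k ^ 3 + 2 * k + 2 ^ k + 1 < w) (g : ℕ → ℕ) :
    ∏ j ∈ blockExps k w, g j = g w * ((∏ i ∈ range k, g (k ^ 3 + 2 * i)) *
      ∏ i ∈ range k, g (k ^ 3 + 2 * i + 2 ^ (i + 1) + 1)) := by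
  obtain ⟨-, h2, h3, h4, h5⟩ := blockExps_aux k w hw
  rw [blockExps, prod_insert h5, prod_union h4, prod_image h2, prod_image h3]

lemma sum_blockExps {k w : ℕ} (hw : k ^ 3 + 2 * k + 2 ^ k + 1 < w) (g : ℕ → ℕ) :
    ∑ j ∈ blockExps k w, g j = g w + ((∑ i ∈ range k, g (k ^ 3 + 2 * i)) +
      ∑ i ∈ range k, g (k ^ 3 + 2 * i + 2 ^ (i + 1) + 1)) := by
  obtain ⟨-, h2, h3, h4, h5⟩ := blockExps_aux k w hw
  rw [blockExps, sum_insert h5, sum_union h4, sum_image h2, sum_image h3]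

lemma card_blockExps_le (k w : ℕ) : #(blockExps k w) ≤ 2 * k + 1 := by
  refine (card_insert_le _ _).trans ?_
  have h1 := card_union_le ((range k).image (fun i => k ^ 3 + 2 * i))
    ((range k).image (fun i => k ^ 3 + 2 * i + 2 ^ (i + 1) + 1))
  have h2 := card_image_le (s := range k) (f := fun i => k ^ 3 + 2 * i)
  have h3 := card_image_le (s := range k) (f := fun i => k ^ 3 + 2 * i + 2 ^ (i + 1) + 1)
  rw [card_range] at h2 h3
  omega

lemma mem_blockExps_bounds {k w j : ℕ} (hw : k ^ 3 + 2 * k + 2 ^ k + 1 < w) (hj : j ∈ blockExps k w) :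
    k ^ 3 ≤ j ∧ j ≤ w := by
  obtain ⟨h1, -⟩ := blockExps_aux k w hw
  simp only [blockExps, mem_insert, mem_union, mem_image, mem_range] at hj
  rcases hj with rfl | ⟨i, hi, rfl⟩ | ⟨i, hi, rfl⟩
  · have := Nat.two_pow_pos k; omega
  · have := h1 i hi; have := Nat.two_pow_pos (i + 1); omega
  · have := h1 i hi; have := Nat.two_pow_pos (i + 1); omega

lemma sum_two_pow_succ (k : ℕ) : ∑ i ∈ range k, 2 ^ (i + 1) + 2 = 2 * 2 ^ k := by
  induction k with
  | zero => norm_num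
  | succ k ih => rw [sum_range_succ]; omega

lemma sum_offsets (k : ℕ) :
    ∑ i ∈ range k, (k ^ 3 + 2 * i) = k ^ 4 + k * (k - 1) := by
  rw [sum_add_distrib, sum_const, card_range, smul_eq_mul, ← mul_sum, mul_comm 2, sum_range_id_mul_two]
  ring

/-- An averaged bound yields one modulus with a small error term. -/
lemma exists_small_error (M : Finset ℕ) (R Y U x c : ℕ) (e : ℤ) (hR : 0 < R)
    (he : e = 9 ∨ e = -9) (hM0 : ∀ m ∈ M, 0 < m) (hMY : ∀ m ∈ M, m ≤ Y)
    (hM3 : ∀ m ∈ M, Nat.Coprime 3 m)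
    (hφ : ∀ m ∈ M, m ≤ 2 * m.totient) (hMR : ∀ m ∈ M, ∀ f, f ∣ m → f ≠ 1 → R < f)
    (hU : 16 ≤ U) (hUx : U ≤ x) (hYx : Y ≤ x) (hc : c = 1 ∨ c = 2)
    (hbound : 2 ^ 24 * Real.log (256 * x : ℕ) ^ 6 *
      (#M * (U : ℝ) ^ 2 + x / R + x / √U + Y * √x) * Y < 9 * x * #M) :
    ∃ m ∈ M, |∑ n ∈ range (256 * x), if n % 3 = c then
      ArithmeticFunction.vonMangoldt n * (wt x n * apKer m (e : ZMod m) n) else 0| ≤ 9 * x / m.totient := by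
  by_contra hcon
  push Not at hcon
  have hunit : ∀ m ∈ M, IsUnit ((e : ZMod m)) := by
    intro m hm
    have h9 : IsUnit (((9 : ℕ) : ZMod m)) :=
      (ZMod.isUnit_iff_coprime 9 m).2 (Nat.Coprime.pow_left 2 (hM3 m hm))
    rcases he with rfl | rfl
    · exact_mod_cast h9
    · push_cast at h9 ⊢
      exact h9.neg
  have hav := vonMangoldt_average M R Y U x (256 * x) c hR (fun m => (e : ZMod m)) hunit hM0 hMY hM3
    hφ hMR hU hUx rfl (by omega) hc _ rfl
  have hlow : #M • (9 * (x : ℝ) / Y) ≤ ∑ m ∈ M, |∑ n ∈ range (256 * x), if n % 3 = c then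
      ArithmeticFunction.vonMangoldt n * (wt x n * apKer m (e : ZMod m) n) else 0| := by
    refine card_nsmul_le_sum _ _ _ fun m hm => le_trans ?_ (hcon m hm).le
    have h1 : (0 : ℝ) < m.totient := by exact_mod_cast Nat.totient_pos.2 (hM0 m hm)
    have h2 : (m.totient : ℝ) ≤ Y := by exact_mod_cast (Nat.totient_le m).trans (hMY m hm)
    gcongr
  rcases Nat.eq_zero_or_pos Y with rfl | hY
  · rcases M.eq_empty_or_nonempty with rfl | ⟨m, hm⟩
    · simp at hbound
    · have := hM0 m hm; have := hMY m hm; omega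
  have hY' : (0 : ℝ) < Y := by exact_mod_cast hY
  rw [nsmul_eq_mul] at hlow
  have h3 := hlow.trans hav
  rw [← mul_div_assoc, div_le_iff₀ hY'] at h3
  linarith

lemma exists_growth (t N : ℕ) : ∃ d, N ≤ d ∧ 40 ≤ d ∧ 100 * (d + t) ^ 4 ≤ 2 ^ d := by
  have key : ∀ d, 40 ≤ d → 1600 * d ^ 4 ≤ 2 ^ d := by
    intro d hd
    induction d, hd using Nat.le_induction with
    | base => norm_num
    | succ d hd ih =>
      have h1 : (d + 1) ^ 4 ≤ 2 * d ^ 4 := by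
        have a1 : 40 * d ^ 3 ≤ d ^ 4 := by rw [pow_succ d 3, mul_comm]; exact Nat.mul_le_mul_left _ hd
        have a2 : 40 * d ^ 2 ≤ d ^ 3 := by rw [pow_succ d 2, mul_comm]; exact Nat.mul_le_mul_left _ hd
        have a3 : 40 * d ≤ d ^ 2 := by rw [pow_succ d 1, pow_one]; exact Nat.mul_le_mul_right _ hd
        have e : (d + 1) ^ 4 = d ^ 4 + 4 * d ^ 3 + 6 * d ^ 2 + 4 * d + 1 := by ring
        omega
      rw [pow_succ 2 d]
      omega
  refine ⟨max 40 (max N t), by omega, by omega, ?_⟩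
  set d := max 40 (max N t) with hd
  have h1 : (d + t) ^ 4 ≤ (2 * d) ^ 4 := Nat.pow_le_pow_left (by omega) 4
  have h2 := key d (by omega)
  rw [mul_pow] at h1
  omega

lemma exists_residue_three (x : ℕ) (hx : 400000000 ≤ x) : ∃ c, (c = 1 ∨ c = 2) ∧ 18 * (x : ℝ) ≤
    ∑ p ∈ (Ioc (4 * x) (64 * x)).filter (fun p => p.Prime ∧ p % 3 = c), Real.log p := by
  have h := sum_log_prime_ge (4 * x) (by omega)
  rw [show 16 * (4 * x) = 64 * x by ring] at h
  have e : ∑ p ∈ (Ioc (4 * x) (64 * x)).filter Nat.Prime, Real.log p =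
      ∑ p ∈ (Ioc (4 * x) (64 * x)).filter (fun p => p.Prime ∧ p % 3 = 1), Real.log p +
      ∑ p ∈ (Ioc (4 * x) (64 * x)).filter (fun p => p.Prime ∧ p % 3 = 2), Real.log p := by
    rw [← sum_union]
    · congr 1
      ext p
      simp only [mem_filter, mem_Ioc, mem_union]
      constructor
      · rintro ⟨h1, h2⟩
        have : p % 3 ≠ 0 := by
          intro h3
          have := (Nat.prime_dvd_prime_iff_eq Nat.prime_three h2).1 (Nat.dvd_of_mod_eq_zero h3)
          omega
        have : p % 3 = 1 ∨ p % 3 = 2 := by omega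
        tauto
      · tauto
    · refine disjoint_left.2 fun p h1 h2 => ?_
      simp only [mem_filter] at h1 h2
      omega
  rw [e] at h
  push_cast at h
  by_contra hcon
  push Not at hcon
  have h1 := hcon 1 (Or.inl rfl)
  have h2 := hcon 2 (Or.inr rfl)
  linarith

end Parameters

section Assembly

open Finset

lemma log_scale_le (k K : ℕ) (hK : K = 2 ^ k) :
    Real.log (256 * 16 ^ (32 * K) : ℕ) ≤ 2 ^ (k + 7) ∧
    Real.log (256 * 16 ^ (32 * K) : ℕ) ≤ 17 * Real.log (16 ^ (2 * K) : ℕ) := by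
  have hK1 : (1 : ℝ) ≤ K := by
    have : 1 ≤ K := by rw [hK]; exact Nat.one_le_two_pow
    exact_mod_cast this
  have h2 : Real.log 16 = 4 * Real.log 2 := by
    rw [show (16 : ℝ) = 2 ^ 4 by norm_num, Real.log_pow]; norm_num
  have h3 := Real.log_two_lt_d9
  have h4 := Real.log_two_gt_d9
  have e : Real.log (256 * 16 ^ (32 * K) : ℕ) = (32 * K + 2) * Real.log 16 := by
    rw [show 256 * 16 ^ (32 * K) = 16 ^ (32 * K + 2) by rw [pow_add]; norm_num [mul_comm]]
    push_cast
    rw [Real.log_pow]; push_cast; ring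
  have e' : Real.log (16 ^ (2 * K) : ℕ) = (2 * K) * Real.log 16 := by
    push_cast
    rw [Real.log_pow]; push_cast; ring
  have hKr : (2 : ℝ) ^ (k + 7) = 128 * K := by rw [hK, pow_add]; push_cast; ring
  rw [e, e', hKr, h2]
  constructor <;> nlinarith

lemma averaged_bound {L F G m U Y x R u z : ℝ} (hL : 2 ^ 24 * L ^ 6 ≤ F)
    (hm : 0 < m) (hY : 0 < Y) (hx : 0 < x) (hR : 0 < R) (hu : 0 < u) (hz : 0 < z)
    (hYG : Y ≤ m * G) (h1 : F * U ^ 2 * Y ≤ 2 * x) (h2 : F * G ≤ R) (h3 : F * G ≤ u)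
    (h4 : F * G * Y * z ≤ x) :
    2 ^ 24 * L ^ 6 * (m * U ^ 2 + x / R + x / u + Y * z) * Y < 9 * x * m := by
  have hF : 0 ≤ F := le_trans (by positivity) hL
  have a1 : F * (m * U ^ 2) * Y ≤ 2 * x * m := by
    calc F * (m * U ^ 2) * Y = F * U ^ 2 * Y * m := by ring
      _ ≤ _ := by gcongr
  have aux : ∀ {v : ℝ}, 0 < v → F * G ≤ v → F * (x / v) * Y ≤ x * m := by
    intro v hv hv'
    calc F * (x / v) * Y ≤ F * (x / v) * (m * G) := by gcongr
      _ = (F * G) * (x * m / v) := by ring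
      _ ≤ v * (x * m / v) := by gcongr
      _ = x * m := by field_simp
  have a2 := aux hR h2
  have a3 := aux hu h3
  have a4 : F * (Y * z) * Y ≤ x * m := by
    calc F * (Y * z) * Y ≤ F * (Y * z) * (m * G) := by gcongr
      _ = F * G * Y * z * m := by ring
      _ ≤ _ := by gcongr
  have hpos : 0 < x * m := by positivity
  calc 2 ^ 24 * L ^ 6 * (m * U ^ 2 + x / R + x / u + Y * z) * Y
      ≤ F * (m * U ^ 2 + x / R + x / u + Y * z) * Y := by gcongr
    _ = F * (m * U ^ 2) * Y + F * (x / R) * Y + F * (x / u) * Y + F * (Y * z) * Y := by ring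
    _ < _ := by linarith

lemma exponent_bounds {k K a w σ : ℕ} (hK : K = 2 ^ k) (hk : 40 ≤ k) (hka : 100 * k ^ 4 ≤ a)
    (haK : a ≤ K) (hσ : σ = k ^ 4 + k * (k - 1)) (hw : w + a + σ + k + 2 = 14 * K) :
    k ^ 3 + 2 * k + 2 ^ k + 1 < w ∧
    66 + 6 * k + (k + 8) * (2 * k + 1) ≤ 4 * k ^ 3 ∧
    66 + 6 * k + (k + 8) * (2 * k + 1) ≤ 8 * K ∧
    66 + 6 * k + (k + 8) * (2 * k + 1) + 4 * (w + 2 * σ + 3 * k + 2 * K - 1) ≤ 64 * K ∧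
    k + 12 + 4 * (w + 2 * σ + 3 * k + 2 * K - 1) ≤ 64 * K ∧ k ≤ k ^ 3 ∧ 8 ≤ a := by
  have a3 : 40 * k ^ 3 ≤ k ^ 4 := by rw [pow_succ k 3, mul_comm]; exact Nat.mul_le_mul_left _ hk
  have a2 : 40 * k ^ 2 ≤ k ^ 3 := by rw [pow_succ k 2, mul_comm]; exact Nat.mul_le_mul_left _ hk
  have a1 : 40 * k ≤ k ^ 2 := by rw [pow_succ k 1, pow_one]; exact Nat.mul_le_mul_right _ hk
  have b : k * (k - 1) ≤ k ^ 2 := by rw [sq]; exact Nat.mul_le_mul_left _ (by omega)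
  have e : (k + 8) * (2 * k + 1) = 2 * k ^ 2 + 17 * k + 8 := by ring
  rw [e, ← hK]
  omega

lemma sum_block_lengths {k w K : ℕ} (hK : K = 2 ^ k) (hw : k ^ 3 + 2 * k + 2 ^ k + 1 < w) :
    ∑ j ∈ blockExps k w, (j + 1) = w + 2 * (k ^ 4 + k * (k - 1)) + 3 * k + 2 * K - 1 := by
  rw [sum_blockExps hw]
  have h1 : ∑ i ∈ range k, (k ^ 3 + 2 * i + 1) = k ^ 4 + k * (k - 1) + k := by
    rw [sum_add_distrib, sum_offsets]; simp
  have h2 : ∑ i ∈ range k, (k ^ 3 + 2 * i + 2 ^ (i + 1) + 1 + 1) + 2 =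
      k ^ 4 + k * (k - 1) + 2 * 2 ^ k + 2 * k := by
    rw [← sum_two_pow_succ, ← sum_offsets]
    simp only [sum_add_distrib, sum_const, card_range, smul_eq_mul]
    ring
  have := Nat.two_pow_pos k
  omega

lemma block_count_bound {k w K : ℕ} (hK : K = 2 ^ k) (hk : 40 ≤ k)
    (hw : k ^ 3 + 2 * k + 2 ^ k + 1 < w) (hwK : w + 1 ≤ 16 * K) :
    16 ^ (∑ j ∈ blockExps k w, (j + 1)) ≤
      (∏ j ∈ blockExps k w, #(primeBlock j)) * 2 ^ ((k + 8) * (2 * k + 1)) := by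
  have hkk : k ≤ k ^ 3 := Nat.le_self_pow (by norm_num) k
  rw [← prod_pow_eq_pow_sum]
  calc ∏ j ∈ blockExps k w, 16 ^ (j + 1) ≤ ∏ j ∈ blockExps k w, (#(primeBlock j) * 2 ^ (k + 8)) := by
        refine prod_le_prod' fun j hj => ?_
        obtain ⟨h1, h2⟩ := mem_blockExps_bounds hw hj
        have h3 := card_primeBlock j (by omega)
        calc 16 ^ (j + 1) = 16 * 16 ^ j := by ring
          _ ≤ 16 * (#(primeBlock j) * (j + 1)) := by gcongr
          _ = #(primeBlock j) * (16 * (j + 1)) := by ring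
          _ ≤ _ := by
            refine Nat.mul_le_mul_left _ ?_
            rw [pow_add, ← hK]; omega
    _ = (∏ j ∈ blockExps k w, #(primeBlock j)) * (2 ^ (k + 8)) ^ #(blockExps k w) := by
        rw [prod_mul_distrib, prod_const]
    _ ≤ _ := by
        rw [← pow_mul]
        gcongr
        · norm_num
        · exact card_blockExps_le k w

lemma sum_inv_filter_ge {t a R : ℕ} (ha : 8 ≤ a) (T : Finset ℕ) (m : ℕ) (hm : m ≠ 0) (hT : m.primeFactors = T)
    (hR : ∀ g, g ∣ m → g ≠ 1 → R < g) (hTR : #T ≤ R) :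
    (t : ℝ) / 32 - 1 ≤ ∑ s ∈ (primeRange a t).filter (fun s => ¬ s ∣ m), (1 : ℝ) / s := by
  have h := sum_primeRange_inv a t ha
  rw [← sum_filter_add_sum_filter_not _ (fun s => s ∣ m)] at h
  suffices ∑ s ∈ (primeRange a t).filter (fun s => s ∣ m), (1 : ℝ) / s ≤ 1 by linarith
  have hsub : (primeRange a t).filter (fun s => s ∣ m) ⊆ T := by
    intro s hs
    rw [mem_filter] at hs
    rw [← hT, Nat.mem_primeFactors]
    exact ⟨(mem_primeRange hs.1).1, hs.2, hm⟩
  rcases T.eq_empty_or_nonempty with rfl | hne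
  · rw [subset_empty.1 hsub]; simp
  have hRpos : 0 < R := lt_of_lt_of_le (card_pos.2 hne) hTR
  calc ∑ s ∈ (primeRange a t).filter (fun s => s ∣ m), (1 : ℝ) / s
      ≤ #((primeRange a t).filter (fun s => s ∣ m)) • ((1 : ℝ) / R) := by
        refine sum_le_card_nsmul _ _ _ fun s hs => ?_
        rw [mem_filter] at hs
        have := hR s hs.2 (mem_primeRange hs.1).1.ne_one
        gcongr
    _ ≤ R • ((1 : ℝ) / R) := by
        refine nsmul_le_nsmul_left (by positivity) ((card_le_card hsub).trans hTR)
    _ = 1 := by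
        rw [nsmul_eq_mul]; field_simp

end Assembly

section Factorization

open Finset

lemma exists_divisor_in_range {t a k K w σ s m : ℕ} (hK : K = 2 ^ k) (hKa : K = 2 ^ t * a)
    (hσ : σ = k ^ 4 + k * (k - 1)) (hw : w + a + σ + k + 2 = 14 * K)
    (hbw : k ^ 3 + 2 * k + 2 ^ k + 1 < w) (f : ℕ → ℕ)
    (hf : ∀ j ∈ blockExps k w, f j ∈ primeBlock j) (hm : m = ∏ j ∈ blockExps k w, f j)
    (hs : s ∈ primeRange a t) :
    ∃ A, A ∣ s * m ∧ A ≤ 16 ^ (16 * K) ∧ 16 ^ (16 * K) ≤ 16 ^ 4 * A := by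
  obtain ⟨-, hs1, hs2⟩ := mem_primeRange hs
  rw [← hKa] at hs2
  have hfb : ∀ j ∈ blockExps k w, 16 ^ j < f j ∧ f j ≤ 16 ^ (j + 1) :=
    fun j hj => (mem_primeBlock.1 (hf j hj)).1
  have hlow : ∀ i ∈ range k, k ^ 3 + 2 * i ∈ blockExps k w := fun i hi => by
    simp only [blockExps, mem_insert, mem_union, mem_image]
    exact Or.inr (Or.inl ⟨i, hi, rfl⟩)
  have hhigh : ∀ i ∈ range k, k ^ 3 + 2 * i + 2 ^ (i + 1) + 1 ∈ blockExps k w := fun i hi => by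
    simp only [blockExps, mem_insert, mem_union, mem_image]
    exact Or.inr (Or.inr ⟨i, hi, rfl⟩)
  have hww : w ∈ blockExps k w := by simp [blockExps]
  rw [prod_blockExps hbw] at hm
  have hoff := sum_offsets k
  have htwo := sum_two_pow_succ k
  rw [← hK] at htwo
  have hbal : ∃ A, A ∣ f w * s * ((∏ i ∈ range k, f (k ^ 3 + 2 * i)) *
      ∏ i ∈ range k, f (k ^ 3 + 2 * i + 2 ^ (i + 1) + 1)) ∧ A ≤ 16 ^ (16 * K) ∧
      16 ^ (16 * K) ≤ 16 ^ 4 * A ∧ f w * s ∣ A := by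
    refine exists_balanced_product k (fun i => f (k ^ 3 + 2 * i))
      (fun i => f (k ^ 3 + 2 * i + 2 ^ (i + 1) + 1)) (fun i hi => ?_) (fun i hi => ?_)
      (f w * s) (16 ^ (16 * K)) ?_ ?_
    · have b1 := (hfb _ (hlow i (mem_range.2 hi))).2
      have b2 := (hfb _ (hhigh i (mem_range.2 hi))).1
      calc 16 ^ 2 ^ (i + 1) * f (k ^ 3 + 2 * i) ≤ 16 ^ 2 ^ (i + 1) * 16 ^ (k ^ 3 + 2 * i + 1) := by gcongr
        _ = 16 ^ (k ^ 3 + 2 * i + 2 ^ (i + 1) + 1) := by rw [← pow_add]; congr 1; ring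
        _ ≤ _ := b2.le
    · have b1 := (hfb _ (hlow i (mem_range.2 hi))).1
      have b2 := (hfb _ (hhigh i (mem_range.2 hi))).2
      calc f (k ^ 3 + 2 * i + 2 ^ (i + 1) + 1) ≤ 16 ^ (k ^ 3 + 2 * i + 2 ^ (i + 1) + 1 + 1) := b2
        _ = 16 ^ (2 ^ (i + 1) + 2) * 16 ^ (k ^ 3 + 2 * i) := by rw [← pow_add]; congr 1; ring
        _ ≤ _ := by gcongr
    · calc f w * s * ∏ i ∈ range k, f (k ^ 3 + 2 * i)
          ≤ 16 ^ (w + 1) * 16 ^ K * ∏ i ∈ range k, 16 ^ (k ^ 3 + 2 * i + 1) := by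
            gcongr with i hi
            · exact (hfb w hww).2
            · exact (hfb _ (hlow i hi)).2
        _ = 16 ^ (w + 1 + K + (σ + k)) := by
            rw [prod_pow_eq_pow_sum, ← pow_add, ← pow_add, sum_add_distrib, hoff, hσ]; simp
        _ ≤ _ := Nat.pow_le_pow_right (by norm_num) (by omega)
    · calc 16 ^ (16 * K) ≤ 16 ^ (4 + (w + a + (σ + (∑ i ∈ range k, 2 ^ (i + 1) + k)))) :=
            Nat.pow_le_pow_right (by norm_num) (by omega)
        _ = 16 ^ 4 * (16 ^ w * 16 ^ a * ∏ i ∈ range k, 16 ^ (k ^ 3 + 2 * i + 2 ^ (i + 1) + 1)) := by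
            rw [prod_pow_eq_pow_sum, ← pow_add, ← pow_add]
            have : ∑ i ∈ range k, (k ^ 3 + 2 * i + 2 ^ (i + 1) + 1) =
              ∑ i ∈ range k, (k ^ 3 + 2 * i) + ∑ i ∈ range k, 2 ^ (i + 1) + k := by
                simp only [sum_add_distrib, sum_const, card_range, smul_eq_mul, mul_one]
            rw [this, hoff, hσ]; ring
        _ ≤ _ := by
            gcongr with i hi
            · exact (hfb w hww).1.le
            · exact (hfb _ (hhigh i hi)).1.le
  obtain ⟨A, h1, h2, h3, -⟩ := hbal
  refine ⟨A, ?_, h2, h3⟩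
  rw [hm, show s * (f w * ((∏ i ∈ range k, f (k ^ 3 + 2 * i)) *
    ∏ i ∈ range k, f (k ^ 3 + 2 * i + 2 ^ (i + 1) + 1))) = f w * s *
    ((∏ i ∈ range k, f (k ^ 3 + 2 * i)) * ∏ i ∈ range k, f (k ^ 3 + 2 * i + 2 ^ (i + 1) + 1)) by ring]
  exact h1

/-- There are infinitely many primes within `9` of a product of two nearly equal integers. -/
theorem exists_prime_near_balanced_product : ∃ C : ℕ, 0 < C ∧ ∀ N : ℕ, ∃ p A B : ℕ, p.Prime ∧ N < p ∧
    (A : ℝ) ≤ C * √p ∧ (B : ℝ) ≤ C * √p ∧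
    ((p % 3 = 2 ∧ p + 9 = A * B) ∨ (p % 3 = 1 ∧ p = A * B + 9)) := by
  refine ⟨257 * 16 ^ 4, by norm_num, fun N => ?_⟩
  obtain ⟨t, ht⟩ : ∃ t, 6000000 ≤ t := ⟨_, le_rfl⟩
  obtain ⟨d, hNd, hd, hgrow⟩ := exists_growth t N
  obtain ⟨k, hkdef⟩ : ∃ k, k = d + t := ⟨_, rfl⟩
  obtain ⟨a, hadef⟩ : ∃ a, a = 2 ^ d := ⟨_, rfl⟩
  obtain ⟨K, hK⟩ : ∃ K, K = 2 ^ k := ⟨_, rfl⟩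
  have hKa : K = 2 ^ t * a := by rw [hK, hkdef, hadef, pow_add, mul_comm]
  have hk : 40 ≤ k := by omega
  have hka : 100 * k ^ 4 ≤ a := by rw [hkdef, hadef]; exact hgrow
  have haK : a ≤ K := by rw [hK, hadef]; exact Nat.pow_le_pow_right (by norm_num) (by omega)
  have hkK : k < K := by rw [hK]; exact Nat.lt_two_pow_self
  obtain ⟨σ, hσ⟩ : ∃ σ, σ = k ^ 4 + k * (k - 1) := ⟨_, rfl⟩
  obtain ⟨w, hw⟩ : ∃ w, w + a + σ + k + 2 = 14 * K := by
    refine ⟨14 * K - a - σ - k - 2, ?_⟩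
    have : k * (k - 1) ≤ k ^ 4 := by
      calc k * (k - 1) ≤ k * k := Nat.mul_le_mul_left _ (by omega)
        _ = k ^ 2 := by ring
        _ ≤ k ^ 4 := Nat.pow_le_pow_right (by omega) (by norm_num)
    omega
  clear hgrow hadef
  obtain ⟨hbw, g1, g2, g3, g4, hk3, ha8⟩ := exponent_bounds hK hk hka haK hσ hw
  obtain ⟨y, hy⟩ : ∃ y, y = w + 2 * σ + 3 * k + 2 * K - 1 := ⟨_, rfl⟩
  rw [← hy] at g3 g4
  have hysum : ∑ j ∈ blockExps k w, (j + 1) = y := by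
    rw [sum_block_lengths hK hbw, hy, hσ]
  obtain ⟨E₂, hE₂⟩ : ∃ E₂, E₂ = 66 + 6 * k + (k + 8) * (2 * k + 1) := ⟨_, rfl⟩
  rw [← hE₂] at g1 g2 g3
  obtain ⟨L1, L2⟩ := log_scale_le k K hK
  obtain ⟨x, hx⟩ : ∃ x, x = 16 ^ (32 * K) := ⟨_, rfl⟩
  rw [← hx] at L1 L2
  have hkbig : k ^ 3 ≤ w := by omega
  -- the family of moduli
  obtain ⟨M, hMcard, hM⟩ := exists_block_products (blockExps k w)
  have hcount := block_count_bound hK hk hbw (by omega)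
  rw [hysum, ← hMcard] at hcount
  have hcardE := card_blockExps_le k w
  have hkR : 2 * (2 * k + 1) ≤ 16 ^ (k ^ 3) := by
    calc 2 * (2 * k + 1) ≤ 16 * k := by omega
      _ ≤ 16 ^ 1 * 16 ^ (k ^ 3 - 1) := by
        rw [pow_one]
        refine Nat.mul_le_mul_left _ ?_
        have h1 : k ^ 3 - 1 < 16 ^ (k ^ 3 - 1) := Nat.lt_pow_self (by norm_num)
        omega
      _ = 16 ^ (k ^ 3) := by rw [← pow_add]; congr 1; omega
  have hprops : ∀ m ∈ M, ∃ f : ℕ → ℕ, (∀ j ∈ blockExps k w, f j ∈ primeBlock j) ∧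
      m = ∏ j ∈ blockExps k w, f j ∧ Squarefree m ∧ m ≤ 2 * m.totient ∧ m ≤ 16 ^ y ∧
      m.primeFactors = (blockExps k w).image f ∧ ∀ g, g ∣ m → g ≠ 1 → 16 ^ (k ^ 3) < g := by
    intro m hm
    obtain ⟨f, hf, rfl⟩ := hM m hm
    refine ⟨f, hf, rfl, ?_⟩
    have := block_product_props (blockExps k w) (k ^ 3)
      (fun j hj => (mem_blockExps_bounds hbw hj).1) (by omega) f hf
    rwa [hysum] at this
  have hR3 : 3 ≤ 16 ^ (k ^ 3) := by omega
  have hxbig : 400000000 ≤ x := by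
    rw [hx]
    calc 400000000 ≤ 16 ^ 8 := by norm_num
      _ ≤ _ := Nat.pow_le_pow_right (by norm_num) (by omega)
  obtain ⟨c, hc, hmain⟩ := exists_residue_three x hxbig
  obtain ⟨e, he⟩ : ∃ e : ℤ, c = 1 ∧ e = 9 ∨ c = 2 ∧ e = -9 := by
    rcases hc with rfl | rfl
    · exact ⟨9, by simp⟩
    · exact ⟨-9, by simp⟩
  have hsqrtx : √(x : ℝ) = 16 ^ (16 * K) := by
    rw [hx, Real.sqrt_eq_iff_mul_self_eq (by positivity) (by positivity)]
    push_cast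
    rw [← pow_add]; congr 1; ring
  have hsqrtU : √((16 ^ (4 * K) : ℕ) : ℝ) = 16 ^ (2 * K) := by
    rw [Real.sqrt_eq_iff_mul_self_eq (by positivity) (by positivity)]
    push_cast
    rw [← pow_add]; congr 1; ring
  have hlog0 : 0 ≤ Real.log (256 * x : ℕ) := Real.log_natCast_nonneg _
  have hY0 : 0 < 16 ^ y := by positivity
  have hMpos : 0 < #M := by
    rcases Nat.eq_zero_or_pos #M with h | h
    · rw [h] at hcount; omega
    · exact h
  have hp16 : ∀ n, (16 : ℝ) ^ n = 2 ^ (4 * n) := fun n => by rw [pow_mul]; norm_num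
  have hFG : (2 : ℝ) ^ (66 + 6 * k) * 2 ^ ((k + 8) * (2 * k + 1)) = 2 ^ E₂ := by
    rw [← pow_add, hE₂]
  obtain ⟨m, hmM, hE⟩ := exists_small_error M (16 ^ (k ^ 3)) (16 ^ y) (16 ^ (4 * K)) x c e
    (by positivity) (by omega)
    (fun m hm => by
      obtain ⟨f, -, -, h, -⟩ := hprops m hm
      exact Nat.pos_of_ne_zero h.ne_zero)
    (fun m hm => by
      obtain ⟨f, -, -, -, -, h, -⟩ := hprops m hm
      exact h)
    (fun m hm => by
      obtain ⟨f, -, -, -, -, -, -, h⟩ := hprops m hm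
      refine (Nat.Prime.coprime_iff_not_dvd Nat.prime_three).2 fun h3 => ?_
      have := h 3 h3 (by norm_num)
      omega)
    (fun m hm => by
      obtain ⟨f, -, -, -, h, -⟩ := hprops m hm
      exact h)
    (fun m hm => by
      obtain ⟨f, -, -, -, -, -, -, h⟩ := hprops m hm
      exact h)
    (by
      calc 16 = 16 ^ 1 := by norm_num
        _ ≤ _ := Nat.pow_le_pow_right (by norm_num) (by omega))
    (by rw [hx]; exact Nat.pow_le_pow_right (by norm_num) (by omega))
    (by rw [hx]; exact Nat.pow_le_pow_right (by norm_num) (by omega))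
    hc
    (by
      rw [hsqrtU, hsqrtx]
      have hYG : ((16 ^ y : ℕ) : ℝ) ≤ (#M : ℝ) * (2 : ℝ) ^ ((k + 8) * (2 * k + 1)) := by
        exact_mod_cast hcount
      refine averaged_bound (F := 2 ^ (66 + 6 * k)) (G := 2 ^ ((k + 8) * (2 * k + 1))) ?_
        (by exact_mod_cast hMpos) (by positivity) (by positivity) (by positivity) (by positivity)
        (by positivity) hYG ?_ ?_ ?_ ?_
      · calc (2 : ℝ) ^ 24 * Real.log (256 * x : ℕ) ^ 6 ≤ 2 ^ 24 * (2 ^ (k + 7)) ^ 6 := by gcongr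
          _ = 2 ^ (66 + 6 * k) := by rw [← pow_mul, ← pow_add]; congr 1; ring
      · rw [hx]
        push_cast
        rw [hp16, hp16, hp16, ← pow_mul, ← pow_add, ← pow_add]
        calc (2 : ℝ) ^ (66 + 6 * k + 4 * (4 * K) * 2 + 4 * y) ≤ 2 ^ (4 * (32 * K)) := by
              refine pow_le_pow_right₀ (by norm_num) ?_
              omega
          _ ≤ _ := by linarith [show (0 : ℝ) < 2 ^ (4 * (32 * K)) by positivity]
      · rw [hFG]
        push_cast
        rw [hp16]
        exact pow_le_pow_right₀ (by norm_num) g1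
      · rw [hFG, hp16]
        refine pow_le_pow_right₀ (by norm_num) ?_
        omega
      · rw [hFG, hx]
        push_cast
        rw [hp16, hp16, hp16, ← pow_add, ← pow_add]
        refine pow_le_pow_right₀ (by norm_num) ?_
        omega)
  obtain ⟨f, hf, hmf, hsq, hφ, hmY, hpf, hgR⟩ := hprops m hmM
  have hm0 : 0 < m := Nat.pos_of_ne_zero hsq.ne_zero
  obtain ⟨p, t', hp, hxp, hpx, hpc, hpm, s, hsS, hst⟩ := exists_prime_of_apKer_bound m x (16 ^ (2 * K)) c e
    ((primeRange a t).filter (fun s => ¬ s ∣ m)) hm0 hsq hφ he (by omega)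
    (hmY.trans (by rw [hx]; exact Nat.pow_le_pow_right (by norm_num) (by omega)))
    (fun s hs => by
      rw [mem_filter] at hs
      obtain ⟨h1, h2, h3⟩ := mem_primeRange hs.1
      refine ⟨h1, ?_, ?_, hs.2⟩
      · have : 16 ^ 1 ≤ 16 ^ a := Nat.pow_le_pow_right (by norm_num) (by omega)
        omega
      · rw [← hKa] at h3
        calc s ^ 2 ≤ (16 ^ K) ^ 2 := Nat.pow_le_pow_left h3 2
          _ = 16 ^ (2 * K) := by rw [← pow_mul, mul_comm])
    (Nat.one_le_pow _ _ (by norm_num))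
    (by rw [hx]; exact Nat.pow_le_pow_right (by norm_num) (by omega))
    (by
      calc (16 ^ (2 * K)) ^ 4 * m ≤ (16 ^ (2 * K)) ^ 4 * 16 ^ y := by gcongr
        _ = 16 ^ (8 * K + y) := by rw [← pow_mul, ← pow_add]; congr 1; ring
        _ ≤ x := by rw [hx]; exact Nat.pow_le_pow_right (by norm_num) (by omega))
    (by
      have h1 := sum_inv_filter_ge (t := t) ha8 ((blockExps k w).image f) m hm0.ne' hpf hgR
        (card_image_le.trans (by omega))
      have h2 : (6000000 : ℝ) ≤ t := by exact_mod_cast ht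
      have h3 : (0 : ℝ) ≤ Real.log (16 ^ (2 * K) : ℕ) := Real.log_natCast_nonneg _
      calc 10000 * Real.log (256 * x : ℕ) ≤ Real.log (16 ^ (2 * K) : ℕ) * 170000 := by linarith
        _ ≤ _ := by gcongr; linarith)
    (by
      rw [hsqrtx]
      have h1 : (m : ℝ) ≤ 16 ^ y := by exact_mod_cast hmY
      calc 23 * (m : ℝ) * Real.log (256 * x : ℕ) ≤ 2 ^ 5 * 16 ^ y * 2 ^ (k + 7) := by
            gcongr; norm_num
        _ = 2 ^ (k + 12 + 4 * y) := by rw [hp16, ← pow_add, ← pow_add]; congr 1; ring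
        _ ≤ _ := by rw [hp16]; exact pow_le_pow_right₀ (by norm_num) (by omega))
    hmain hE
  rw [mem_filter] at hsS
  obtain ⟨A, hA1, hA2, hA3⟩ := exists_divisor_in_range hK hKa hσ hw hbw f hf hmf hsS.1
  have hAm : A ∣ m * t' := by
    refine hA1.trans ?_
    rw [mul_comm s]
    exact Nat.mul_dvd_mul_left _ hst
  obtain ⟨B, hB⟩ := hAm
  have hZ : (16 ^ (16 * K)) ^ 2 = x := by rw [hx, ← pow_mul]; congr 1; ring
  have hZp : ((16 : ℝ) ^ (16 * K)) ≤ √p := by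
    rw [← hsqrtx]
    exact Real.sqrt_le_sqrt (by exact_mod_cast hxp.le)
  have hpB : A * B ≤ 257 * x := by
    have : (p : ℤ) = (m * t' : ℕ) + e := by rw [hpm]; push_cast; ring
    rw [hB] at this
    omega
  have hBle : B ≤ 257 * 16 ^ 4 * 16 ^ (16 * K) := by
    have h0 : 0 < 16 ^ (16 * K) := by positivity
    refine Nat.le_of_mul_le_mul_left ?_ h0
    calc 16 ^ (16 * K) * B ≤ 16 ^ 4 * A * B := Nat.mul_le_mul_right _ hA3
      _ = 16 ^ 4 * (A * B) := by ring
      _ ≤ 16 ^ 4 * (257 * x) := Nat.mul_le_mul_left _ hpB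
      _ = _ := by rw [← hZ]; ring
  refine ⟨p, A, B, hp, ?_, ?_, ?_, ?_⟩
  · have h1 : K < 16 ^ (32 * K) := by
      have := Nat.lt_pow_self (n := 32 * K) (show 1 < 16 by norm_num)
      omega
    omega
  · have h1 : (A : ℝ) ≤ 16 ^ (16 * K) := by exact_mod_cast hA2
    have h2 : (0 : ℝ) ≤ √p := Real.sqrt_nonneg _
    push_cast
    linarith
  · have h1 : (B : ℝ) ≤ 257 * 16 ^ 4 * 16 ^ (16 * K) := by exact_mod_cast hBle
    push_cast
    linarith
  · have : (p : ℤ) = (m * t' : ℕ) + e := by rw [hpm]; push_cast; ring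
    rw [hB] at this
    rcases he with ⟨rfl, rfl⟩ | ⟨rfl, rfl⟩
    · right; exact ⟨hpc, by omega⟩
    · left; exact ⟨hpc, by omega⟩

end Factorization

section CyclotomicIdentities

open Finset Polynomial

lemma cyclotomic_two_primes_mul {p q : ℕ} (hp : p.Prime) (hq : q.Prime) (hpq : p ≠ q) :
    cyclotomic (p * q) ℤ * ((X ^ p - 1) * (X ^ q - 1)) = (X ^ (p * q) - 1) * (X - 1) := by
  have := Fact.mk hp
  have h1 : expand ℤ q (cyclotomic p ℤ) = cyclotomic (p * q) ℤ * cyclotomic p ℤ :=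
    cyclotomic_expand_eq_cyclotomic_mul hq
      (fun h => hpq ((Nat.prime_dvd_prime_iff_eq hq hp).1 h).symm) ℤ
  have h2 := cyclotomic_prime_mul_X_sub_one ℤ p
  have h3 : expand ℤ q (cyclotomic p ℤ) * (X ^ q - 1) = X ^ (p * q) - 1 := by
    have := congrArg (expand ℤ q) h2
    simp only [map_mul, map_sub, map_one, expand_X, map_pow] at this
    rw [this, ← pow_mul, mul_comm q p]
  calc cyclotomic (p * q) ℤ * ((X ^ p - 1) * (X ^ q - 1))
      = cyclotomic (p * q) ℤ * cyclotomic p ℤ * (X ^ q - 1) * (X - 1) := by rw [← h2]; ring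
    _ = _ := by rw [← h1, h3]

lemma cyclotomic_three_primes_mul {p q r : ℕ} (hp : p.Prime) (hq : q.Prime) (hr : r.Prime)
    (hpq : p ≠ q) (hpr : p ≠ r) (hqr : q ≠ r) :
    cyclotomic (p * q * r) ℤ * (X ^ (p * q) - 1) =
      expand ℤ r (cyclotomic (p * q) ℤ) * ((∑ m ∈ range p, X ^ m) * (X ^ q - 1)) := by
  have h1 : expand ℤ r (cyclotomic (p * q) ℤ) = cyclotomic (p * q * r) ℤ * cyclotomic (p * q) ℤ := by
    refine cyclotomic_expand_eq_cyclotomic_mul hr (fun h => ?_) ℤ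
    rcases (Nat.Prime.dvd_mul hr).1 h with h | h
    · exact hpr ((Nat.prime_dvd_prime_iff_eq hr hp).1 h).symm
    · exact hqr ((Nat.prime_dvd_prime_iff_eq hr hq).1 h).symm
  have h2 := cyclotomic_two_primes_mul hp hq hpq
  have h3 : (∑ m ∈ range p, (X : ℤ[X]) ^ m) * (X - 1) = X ^ p - 1 := geom_sum_mul X p
  have h4 : (X - 1 : ℤ[X]) ≠ 0 := X_sub_C_ne_zero 1
  refine mul_right_cancel₀ h4 ?_
  calc cyclotomic (p * q * r) ℤ * (X ^ (p * q) - 1) * (X - 1)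
      = cyclotomic (p * q * r) ℤ * ((X ^ (p * q) - 1) * (X - 1)) := by ring
    _ = cyclotomic (p * q * r) ℤ * cyclotomic (p * q) ℤ * ((X ^ p - 1) * (X ^ q - 1)) := by
        rw [← h2]; ring
    _ = _ := by rw [← h1, ← h3]; ring

lemma cyclotomic_two_primes_eq {p q a b : ℕ} (hp : p.Prime) (hq : q.Prime) (hpq : p ≠ q)
    (hab : a * p + b * q = p * q + 1) (ha : a ≤ q) (hb : b ≤ p) :
    cyclotomic (p * q) ℤ = ∑ x ∈ range a, ∑ y ∈ range b, X ^ (x * p + y * q) -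
      ∑ x ∈ Ico a q, ∑ y ∈ Ico b p, X ^ (x * p + y * q - p * q) := by
  have hne : ∀ n : ℕ, 0 < n → (X ^ n - 1 : ℤ[X]) ≠ 0 := fun n hn => X_pow_sub_C_ne_zero hn 1
  have hX : (X ^ (p * q) : ℤ[X]) ≠ 0 := pow_ne_zero _ X_ne_zero
  refine mul_right_cancel₀ (mul_ne_zero (mul_ne_zero (hne p hp.pos) (hne q hq.pos)) hX) ?_
  rw [← mul_assoc, cyclotomic_two_primes_mul hp hq hpq]
  have e1 : ∑ x ∈ range a, ∑ y ∈ range b, (X : ℤ[X]) ^ (x * p + y * q) =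
      (∑ x ∈ range a, (X ^ p) ^ x) * ∑ y ∈ range b, (X ^ q) ^ y := by
    rw [sum_mul_sum]
    refine sum_congr rfl fun x _ => sum_congr rfl fun y _ => ?_
    rw [← pow_mul, ← pow_mul, ← pow_add]; congr 1; ring
  have e2 : (∑ x ∈ Ico a q, ∑ y ∈ Ico b p, (X : ℤ[X]) ^ (x * p + y * q - p * q)) * X ^ (p * q) =
      (∑ x ∈ Ico a q, (X ^ p) ^ x) * ∑ y ∈ Ico b p, (X ^ q) ^ y := by
    rw [sum_mul_sum, sum_mul]
    refine sum_congr rfl fun x hx => ?_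
    rw [sum_mul]
    refine sum_congr rfl fun y hy => ?_
    have h1 : a * p ≤ x * p := Nat.mul_le_mul_right _ (mem_Ico.1 hx).1
    have h2 : b * q ≤ y * q := Nat.mul_le_mul_right _ (mem_Ico.1 hy).1
    rw [← pow_add, ← pow_mul, ← pow_mul, ← pow_add, Nat.sub_add_cancel (by omega)]
    congr 1; ring
  have g1 := geom_sum_mul (X ^ p : ℤ[X]) a
  have g2 := geom_sum_mul (X ^ q : ℤ[X]) b
  have g3 := geom_sum_Ico_mul (X ^ p : ℤ[X]) ha
  have g4 := geom_sum_Ico_mul (X ^ q : ℤ[X]) hb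
  have key : (X ^ p) ^ a * (X ^ q) ^ b = (X : ℤ[X]) ^ (p * q) * X := by
    rw [← pow_mul, ← pow_mul, ← pow_add, ← pow_succ]; congr 1; linarith
  have k1 : (X ^ p) ^ q = (X : ℤ[X]) ^ (p * q) := by rw [← pow_mul]
  have k2 : (X ^ q) ^ p = (X : ℤ[X]) ^ (p * q) := by rw [← pow_mul, mul_comm]
  rw [k1] at g3
  rw [k2] at g4
  symm
  calc _ = X ^ (p * q) * (((∑ x ∈ range a, (X ^ p) ^ x) * (X ^ p - 1)) *
        ((∑ y ∈ range b, (X ^ q) ^ y) * (X ^ q - 1))) -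
        (∑ x ∈ Ico a q, ∑ y ∈ Ico b p, (X : ℤ[X]) ^ (x * p + y * q - p * q)) * X ^ (p * q) *
        ((X ^ p - 1) * (X ^ q - 1)) := by rw [e1]; ring
    _ = X ^ (p * q) * (((∑ x ∈ range a, (X ^ p) ^ x) * (X ^ p - 1)) *
        ((∑ y ∈ range b, (X ^ q) ^ y) * (X ^ q - 1))) -
        ((∑ x ∈ Ico a q, (X ^ p) ^ x) * (X ^ p - 1)) *
        ((∑ y ∈ Ico b p, (X ^ q) ^ y) * (X ^ q - 1)) := by rw [e2]; ring
    _ = _ := by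
      rw [g1, g2, g3, g4]
      linear_combination (X ^ (p * q) - 1) * key

/-- The sum of the coefficients at `ρ, ρ + N, …, ρ + l * N`. -/
noncomputable def classSum (ρ l N : ℕ) : ℤ[X] →ₗ[ℤ] ℤ :=
  ∑ u ∈ range (l + 1), lcoeff ℤ (ρ + u * N)

lemma classSum_mul_X_pow_sub_one {ρ l N : ℕ} (hρ : ρ < N) (F : ℤ[X]) :
    classSum ρ l N (F * (X ^ N - 1)) = - F.coeff (ρ + l * N) := by
  rw [mul_sub, mul_one, map_sub]
  simp only [classSum, LinearMap.sum_apply, lcoeff_apply]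
  rw [sum_range_succ', sum_range_succ (fun u => F.coeff (ρ + u * N))]
  have h : ∀ u, (F * X ^ N).coeff (ρ + (u + 1) * N) = F.coeff (ρ + u * N) := fun u => by
    rw [show ρ + (u + 1) * N = ρ + u * N + N by ring, coeff_mul_X_pow]
  have h0 : (F * X ^ N).coeff (ρ + 0 * N) = 0 := by
    rw [coeff_mul_X_pow', if_neg (by omega)]
  rw [sum_congr rfl fun u _ => h u, h0]
  ring

lemma classSum_X_pow {ρ l N : ℕ} (hρ : ρ < N) (e : ℕ) :
    classSum ρ l N (X ^ e) = if e ≤ ρ + l * N ∧ (N : ℤ) ∣ e - (ρ + l * N : ℕ) then 1 else 0 := by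
  simp only [classSum, LinearMap.sum_apply, lcoeff_apply, coeff_X_pow]
  split_ifs with h
  · obtain ⟨h1, h2⟩ := h
    have hN : 0 < N := by omega
    have hmod : e % N = ρ := by
      have : (e : ℤ) ≡ (ρ + l * N : ℕ) [ZMOD N] := (Int.modEq_iff_dvd.2 h2).symm
      rw [Int.natCast_modEq_iff] at this
      rw [this, Nat.add_mul_mod_self_right, Nat.mod_eq_of_lt hρ]
    have he : e = ρ + e / N * N := by rw [← hmod, mul_comm, Nat.mod_add_div]
    rw [sum_eq_single (e / N)]
    · rw [if_pos he.symm]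
    · intro u _ hu
      refine if_neg fun h => hu ?_
      rw [← h, Nat.add_mul_div_right _ _ hN, Nat.div_eq_of_lt hρ, zero_add]
    · intro hu
      refine absurd (mem_range.2 ?_) hu
      have : e / N * N ≤ l * N := by omega
      have := Nat.le_of_mul_le_mul_right this hN
      omega
  · refine sum_eq_zero fun u hu => if_neg fun he => h ?_
    rw [mem_range] at hu
    have h1 : u * N ≤ l * N := Nat.mul_le_mul_right _ (by omega)
    refine ⟨by omega, (u : ℤ) - l, ?_⟩
    rw [← he]; push_cast; ring

end CyclotomicIdentities

section CoefficientFormula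

open Finset Polynomial

lemma dvd_combination_iff {p q x x₀ y y₀ : ℕ} (hpq : Nat.Coprime p q) (hx : x < q) (hx₀ : x₀ < q)
    (hy : y < p) (hy₀ : y₀ < p) :
    ((p * q : ℕ) : ℤ) ∣ ((x : ℤ) - x₀) * p + ((y : ℤ) - y₀) * q ↔ x = x₀ ∧ y = y₀ := by
  constructor
  · intro h
    push_cast at h
    have hc : IsCoprime (p : ℤ) q := Nat.isCoprime_iff_coprime.2 hpq
    have h1 : (q : ℤ) ∣ (x : ℤ) - x₀ := by
      refine hc.symm.dvd_of_dvd_mul_right ?_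
      have := (Dvd.intro_left _ rfl : (q : ℤ) ∣ p * q).trans h
      exact (Int.dvd_add_left (Dvd.intro_left _ rfl)).1 this
    have h2 : (p : ℤ) ∣ (y : ℤ) - y₀ := by
      refine hc.dvd_of_dvd_mul_right ?_
      have := (Dvd.intro _ rfl : (p : ℤ) ∣ p * q).trans h
      exact (Int.dvd_add_right (Dvd.intro_left _ rfl)).1 this
    have a1 := Int.eq_zero_of_abs_lt_dvd h1 (by rw [abs_lt]; omega)
    have a2 := Int.eq_zero_of_abs_lt_dvd h2 (by rw [abs_lt]; omega)
    omega
  · rintro ⟨rfl, rfl⟩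
    simp

lemma sum_sum_ite_eq {s t : Finset ℕ} (P : ℕ → ℕ → Prop) [∀ x y, Decidable (P x y)] (x₀ y₀ : ℕ) :
    ∑ x ∈ s, ∑ y ∈ t, (if P x y ∧ x = x₀ ∧ y = y₀ then (1 : ℤ) else 0) =
      if x₀ ∈ s ∧ y₀ ∈ t ∧ P x₀ y₀ then 1 else 0 := by
  rw [← sum_product', sum_ite, sum_const_zero, add_zero, sum_const, nsmul_eq_mul, mul_one]
  split_ifs with h
  · rw [Nat.cast_eq_one, card_eq_one]
    refine ⟨(x₀, y₀), ?_⟩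
    ext ⟨x, y⟩
    simp only [mem_filter, mem_product, mem_singleton, Prod.mk.injEq]
    constructor
    · tauto
    · rintro ⟨rfl, rfl⟩; tauto
  · rw [Nat.cast_eq_zero, card_eq_zero, filter_eq_empty_iff]
    rintro ⟨x, y⟩ hxy ⟨h1, h2, h3⟩
    simp only [mem_product] at hxy h1 h2 h3
    subst h2 h3
    exact h ⟨hxy.1, hxy.2, h1⟩

/-- The coefficient of the binary cyclotomic polynomial at the residue of `x * p + y * q`, cut off
at `T`. -/
def cutCoeff (a b p q T x y : ℕ) : ℤ :=
  (if x < a ∧ y < b ∧ x * p + y * q ≤ T then 1 else 0) -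
    if a ≤ x ∧ b ≤ y ∧ x * p + y * q ≤ T + p * q then 1 else 0

lemma classSum_expand_cyclotomic {p q r a b T ρ l e x₀ y₀ : ℕ} {κ c : ℤ} (hp : p.Prime) (hq : q.Prime)
    (hpq : p ≠ q) (hab : a * p + b * q = p * q + 1) (ha : a ≤ q) (hb : b ≤ p)
    (hρ : ρ < p * q) (hr : p * q ≤ r) (hκ : ((p * q : ℕ) : ℤ) ∣ r * κ - 1)
    (hn : ((p * q : ℕ) : ℤ) ∣ (ρ + l * (p * q) : ℕ) - r * c)
    (hT : r * T ≤ ρ + l * (p * q)) (hT' : ρ + l * (p * q) < r * T + p * q) (he : e < p * q)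
    (hx₀ : x₀ < q) (hy₀ : y₀ < p)
    (hc : ((p * q : ℕ) : ℤ) ∣ e * κ - c + x₀ * p + y₀ * q) :
    classSum ρ l (p * q) (expand ℤ r (cyclotomic (p * q) ℤ) * X ^ e) = cutCoeff a b p q T x₀ y₀ := by
  have hcop : Nat.Coprime p q := (Nat.coprime_primes hp hq).2 hpq
  have hmono : ∀ i : ℕ, classSum ρ l (p * q) (X ^ (r * i + e)) =
      if i ≤ T ∧ ((p * q : ℕ) : ℤ) ∣ i - (x₀ * p + y₀ * q) then 1 else 0 := by
    intro i
    rw [classSum_X_pow hρ]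
    refine if_congr ?_ rfl rfl
    set n := ρ + l * (p * q)
    set N := p * q
    constructor
    · rintro ⟨h1, h2⟩
      constructor
      · by_contra hcon
        have : r * (T + 1) ≤ r * i := Nat.mul_le_mul_left _ (by omega)
        rw [mul_add] at this
        omega
      · have e1 : (i : ℤ) - (x₀ * p + y₀ * q) = κ * ((r * i + e : ℕ) - (n : ℤ)) + κ * ((n : ℤ) - r * c)
          + (r * κ - 1) * (c - i) - (e * κ - c + x₀ * p + y₀ * q) := by push_cast; ring
        rw [e1]
        exact dvd_sub (dvd_add (dvd_add (h2.mul_left _) (hn.mul_left _)) (hκ.mul_right _)) hc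
    · rintro ⟨h1, h2⟩
      have h3 : (N : ℤ) ∣ (r * i + e : ℕ) - (n : ℤ) := by
        have e1 : ((r * i + e : ℕ) : ℤ) - (n : ℤ) = r * ((i : ℤ) - (x₀ * p + y₀ * q)) +
          r * (e * κ - c + x₀ * p + y₀ * q) - e * (r * κ - 1) - ((n : ℤ) - r * c) := by push_cast; ring
        rw [e1]
        exact dvd_sub (dvd_sub (dvd_add (h2.mul_left _) (hc.mul_left _)) (hκ.mul_left _)) hn
      refine ⟨?_, h3⟩
      by_contra hcon
      have h4 : r * i ≤ r * T := Nat.mul_le_mul_left _ h1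
      have := Int.le_of_dvd (by omega) h3
      omega
  rw [cyclotomic_two_primes_eq hp hq hpq hab ha hb]
  simp only [map_sub, map_sum, map_pow, expand_X, sub_mul, sum_mul, ← pow_mul, ← pow_add, hmono, cutCoeff]
  congr 1
  · rw [show (if x₀ < a ∧ y₀ < b ∧ x₀ * p + y₀ * q ≤ T then (1 : ℤ) else 0) =
      if x₀ ∈ range a ∧ y₀ ∈ range b ∧ x₀ * p + y₀ * q ≤ T then 1 else 0 by simp only [mem_range],
      ← sum_sum_ite_eq (fun x y => x * p + y * q ≤ T)]
    refine sum_congr rfl fun x hx => sum_congr rfl fun y hy => ?_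
    rw [mem_range] at hx hy
    refine if_congr (and_congr_right fun _ => Iff.trans ?_
      (dvd_combination_iff hcop (hx.trans_le ha) hx₀ (hy.trans_le hb) hy₀)) rfl rfl
    rw [show ((x * p + y * q : ℕ) : ℤ) - (x₀ * p + y₀ * q) = ((x : ℤ) - x₀) * p + ((y : ℤ) - y₀) * q by
      push_cast; ring]
  · rw [show (if a ≤ x₀ ∧ b ≤ y₀ ∧ x₀ * p + y₀ * q ≤ T + p * q then (1 : ℤ) else 0) =
      if x₀ ∈ Ico a q ∧ y₀ ∈ Ico b p ∧ x₀ * p + y₀ * q ≤ T + p * q then 1 else 0 by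
        simp only [mem_Ico, hx₀, hy₀, and_true],
      ← sum_sum_ite_eq (fun x y => x * p + y * q ≤ T + p * q)]
    refine sum_congr rfl fun x hx => sum_congr rfl fun y hy => ?_
    rw [mem_Ico] at hx hy
    have h1 : a * p ≤ x * p := Nat.mul_le_mul_right _ hx.1
    have h2 : b * q ≤ y * q := Nat.mul_le_mul_right _ hy.1
    refine if_congr (and_congr (by omega) (Iff.trans ?_
      (dvd_combination_iff hcop hx.2 hx₀ hy.2 hy₀))) rfl rfl
    rw [show ((x * p + y * q - p * q : ℕ) : ℤ) - (x₀ * p + y₀ * q) =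
      (((x : ℤ) - x₀) * p + ((y : ℤ) - y₀) * q) - (p * q : ℕ) by
      rw [Nat.cast_sub (by omega)]; push_cast; ring, dvd_sub_self_right]

lemma neg_coeff_cyclotomic {p q r a b T ρ l : ℕ} {κ c : ℤ} (hp : p.Prime) (hq : q.Prime)
    (hr : r.Prime) (hpq : p < q) (hqr : q < r) (hab : a * p + b * q = p * q + 1) (ha : a ≤ q) (hb : b ≤ p)
    (hρ : ρ < p * q) (hr' : p * q ≤ r) (hκ : ((p * q : ℕ) : ℤ) ∣ r * κ - 1)
    (hn : ((p * q : ℕ) : ℤ) ∣ (ρ + l * (p * q) : ℕ) - r * c)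
    (hT : r * T ≤ ρ + l * (p * q)) (hT' : ρ + l * (p * q) < r * T + p * q)
    (x y y' : ℕ → ℕ) (hx : ∀ m < p, x m < q) (hy : ∀ m < p, y m < p) (hy' : ∀ m < p, y' m < p)
    (hc : ∀ m < p, ((p * q : ℕ) : ℤ) ∣ m * κ - c + x m * p + y m * q)
    (hc' : ∀ m < p, ((p * q : ℕ) : ℤ) ∣ (m + q : ℕ) * κ - c + x m * p + y' m * q) :
    -(cyclotomic (p * q * r) ℤ).coeff (ρ + l * (p * q)) =
      ∑ m ∈ range p, (cutCoeff a b p q T (x m) (y' m) - cutCoeff a b p q T (x m) (y m)) := by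
  rw [← classSum_mul_X_pow_sub_one hρ, cyclotomic_three_primes_mul hp hq hr hpq.ne (hpq.trans hqr).ne hqr.ne,
    sum_mul, mul_sum, map_sum]
  have h2 : 2 ≤ p := hp.two_le
  have h3 : 2 * q ≤ p * q := Nat.mul_le_mul_right _ h2
  refine sum_congr rfl fun m hm => ?_
  rw [mem_range] at hm
  rw [mul_sub, mul_one, ← pow_add, mul_sub, map_sub,
    classSum_expand_cyclotomic hp hq hpq.ne hab ha hb hρ hr' hκ hn hT hT' (by omega) (hx m hm)
      (hy m hm) (hc m hm),
    classSum_expand_cyclotomic hp hq hpq.ne hab ha hb hρ hr' hκ hn hT hT' (by omega) (hx m hm)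
      (hy' m hm) (hc' m hm)]

end CoefficientFormula

section LargeCoefficient

open Finset Polynomial

lemma cutCoeff_le_one (a b p q T x y : ℕ) : cutCoeff a b p q T x y ≤ 1 := by
  unfold cutCoeff; split_ifs <;> norm_num

lemma neg_one_le_cutCoeff (a b p q T x y : ℕ) : -1 ≤ cutCoeff a b p q T x y := by
  unfold cutCoeff; split_ifs <;> norm_num

lemma cutCoeff_nonneg {a b p q T x y : ℕ} (h : x < a ∨ y < b) : 0 ≤ cutCoeff a b p q T x y := by
  unfold cutCoeff
  rw [if_neg (by omega : ¬ (a ≤ x ∧ b ≤ y ∧ x * p + y * q ≤ T + p * q))]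
  split_ifs <;> norm_num

lemma cutCoeff_nonpos {a b p q T x y : ℕ} (h : T < x * p + y * q) : cutCoeff a b p q T x y ≤ 0 := by
  unfold cutCoeff
  rw [if_neg (by omega : ¬ (x < a ∧ y < b ∧ x * p + y * q ≤ T))]
  split_ifs <;> norm_num

lemma cutCoeff_eq_one {a b p q T x y : ℕ} (hx : x < a) (hy : y < b) (h : x * p + y * q ≤ T) :
    cutCoeff a b p q T x y = 1 := by
  unfold cutCoeff
  rw [if_neg (by omega : ¬ (a ≤ x ∧ b ≤ y ∧ x * p + y * q ≤ T + p * q)), if_pos ⟨hx, hy, h⟩]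
  norm_num

lemma cutCoeff_eq_neg_one {a b p q T x y : ℕ} (hx : a ≤ x) (hy : b ≤ y)
    (h : x * p + y * q ≤ T + p * q) : cutCoeff a b p q T x y = -1 := by
  unfold cutCoeff
  rw [if_neg (by omega : ¬ (x < a ∧ y < b ∧ x * p + y * q ≤ T)), if_pos ⟨hx, hy, h⟩]
  norm_num

lemma sum_step_function {s₁ s₂ s₃ : ℕ} (h₁ : s₁ ≤ s₃) (h₂ : s₃ ≤ s₂) (n : ℕ) :
    ∑ m ∈ range n, (if m < s₁ then (1 : ℤ) else if m < s₃ then 0 else if m < s₂ then -2 else 1) =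
      min n s₁ - 2 * (min n s₂ - min n s₃ : ℤ) + (n - min n s₂) := by
  induction n with
  | zero => simp
  | succ n ih =>
    rw [sum_range_succ, ih]
    push_cast
    split_ifs <;> omega

lemma cutCoeff_difference_bound {p q a h β μ m : ℕ} (hm : m < p) (hμ0 : 0 < μ) (hμp : μ < p)
    (hβμ : β < μ) (hab : a * p + μ * q = p * q + 1) (hh : 2 * p * h ≤ q)
    (hh' : q < 2 * p * h + 2 * p) (hq : 4 * p * p + 4 ≤ q) (e1 : μ ≤ 3 * β)
    (e2 : 3 * μ ≤ 2 * p + β) :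
    (if m < μ - β then (1 : ℤ) else if m < min (2 * β) (min (2 * (p - μ) + 1) μ) then 0 else
      if m < max (2 * β) (max (2 * (p - μ) + 1) (max μ (p - β))) then -2 else 1) ≤
    cutCoeff a μ p q ((μ - 1 - β) * q) (m * h)
      (if m + β ≤ μ - 1 then μ - 1 - β - m else μ - 1 + p - β - m) -
    cutCoeff a μ p q ((μ - 1 - β) * q) (m * h) (if m ≤ μ - 1 then μ - 1 - m else μ - 1 + p - m) := by
  obtain ⟨y₀, rfl⟩ : ∃ y₀, μ = y₀ + 1 := ⟨μ - 1, by omega⟩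
  obtain ⟨τ, rfl⟩ : ∃ τ, y₀ = β + τ := ⟨y₀ - β, by omega⟩
  simp only [show β + τ + 1 - 1 = β + τ by omega, show β + τ - β = τ by omega]
  have hp0 : 0 < p := by omega
  -- the size of `m * h * p`
  have z1 : 2 * (m * h * p) ≤ m * q := by
    calc 2 * (m * h * p) = m * (2 * p * h) := by ring
      _ ≤ m * q := Nat.mul_le_mul_left _ hh
  have z2 : m * q + 4 ≤ 2 * (m * h * p) + q := by
    have : m * q ≤ m * (2 * p * h + 2 * p) := Nat.mul_le_mul_left _ hh'.le
    have h2 : m * (2 * p) ≤ p * (2 * p) := Nat.mul_le_mul_right _ hm.le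
    have h3 : m * (2 * p * h + 2 * p) = 2 * (m * h * p) + m * (2 * p) := by ring
    have h4 : 4 * p * p = 2 * (p * (2 * p)) := by ring
    omega
  obtain ⟨ν, hν⟩ : ∃ ν, p = β + τ + 1 + ν := ⟨p - (β + τ + 1), by omega⟩
  have hap : a * p = ν * q + 1 := by
    have : p * q = (β + τ + 1) * q + ν * q := by rw [← add_mul, ← hν]
    omega
  have hlt : m ≤ 2 * ν → m * h < a := by
    intro hmν
    refine Nat.lt_of_mul_lt_mul_right (a := p) ?_
    have : m * q ≤ 2 * ν * q := Nat.mul_le_mul_right _ hmν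
    rw [mul_assoc] at this
    omega
  have hge : 2 * ν + 1 ≤ m → a ≤ m * h := by
    intro hmν
    refine Nat.le_of_mul_le_mul_right (?_ : a * p ≤ m * h * p) hp0
    have : (2 * ν + 1) * q ≤ m * q := Nat.mul_le_mul_right _ hmν
    rw [add_mul, mul_assoc] at this
    omega
  have hpν : p - (β + τ + 1) = ν := by omega
  rw [hpν]
  -- the coefficients attached to `m` vanish or are nonpositive for small `m`
  have hA : m ≤ β + τ → m + 1 ≤ 2 * β →
      cutCoeff a (β + τ + 1) p q (τ * q) (m * h) (β + τ - m) ≤ 0 := by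
    intro h1 h2
    refine cutCoeff_nonpos ?_
    have h3 : (m + 1) * q ≤ 2 * β * q := Nat.mul_le_mul_right _ h2
    have h4 : (β + τ - m) * q + m * q = β * q + τ * q := by
      rw [← add_mul, ← add_mul]; congr 1; omega
    rw [add_mul, mul_assoc] at h3
    omega
  by_cases c1 : m < τ + 1
  · rw [if_pos (by omega), if_pos (by omega), if_pos (by omega)]
    have h1 := hA (by omega) (by omega)
    rw [cutCoeff_eq_one (hlt (by omega)) (by omega)]
    · linarith
    · have : (τ - m) * q + m * q = τ * q := by rw [← add_mul]; congr 1; omega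
      omega
  rw [if_neg (by omega)]
  by_cases c2 : m < min (2 * β) (min (2 * ν + 1) (β + τ + 1))
  · rw [if_pos c2, if_neg (by omega), if_pos (by omega)]
    have h1 := hA (by omega) (by omega)
    have h2 : 0 ≤ cutCoeff a (β + τ + 1) p q (τ * q) (m * h) (β + τ + p - β - m) :=
      cutCoeff_nonneg (Or.inl (hlt (by omega)))
    linarith
  rw [if_neg c2]
  by_cases c3 : m < max (2 * β) (max (2 * ν + 1) (max (β + τ + 1) (p - β)))
  · rw [if_pos c3]
    have := cutCoeff_le_one a (β + τ + 1) p q (τ * q) (m * h)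
      (if m ≤ β + τ then β + τ - m else β + τ + p - m)
    have := neg_one_le_cutCoeff a (β + τ + 1) p q (τ * q) (m * h)
      (if m + β ≤ β + τ then τ - m else β + τ + p - β - m)
    linarith
  · rw [if_neg c3, if_neg (by omega), if_neg (by omega)]
    have h2 : 0 ≤ cutCoeff a (β + τ + 1) p q (τ * q) (m * h) (β + τ + p - β - m) :=
      cutCoeff_nonneg (Or.inr (by omega))
    have h5 : cutCoeff a (β + τ + 1) p q (τ * q) (m * h) (β + τ + p - m) = -1 := by
      refine cutCoeff_eq_neg_one (hge (by omega)) (by omega) ?_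
      have h3 : (β + τ + p - m) * q + m * q = β * q + τ * q + p * q := by
        rw [← add_mul, ← add_mul, ← add_mul]; congr 1; omega
      have h4 : 2 * β * q ≤ m * q := Nat.mul_le_mul_right _ (by omega)
      rw [mul_assoc] at h4
      omega
    linarith

theorem exists_large_coefficient {p β μ ε : ℕ} (hp : p.Prime) (hβμ : β * μ % p = 1)
    (h1 : p ≤ 3 * β + ε) (h2 : 3 * β ≤ p + ε) (h3 : 2 * p ≤ 3 * μ + ε) (h4 : 3 * μ ≤ 2 * p + ε)
    (hε : 20 * ε + 100 ≤ p) :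
    ∃ q r : ℕ, q.Prime ∧ r.Prime ∧ p < q ∧ q < r ∧
      ∃ n, 2 * (p : ℤ) ≤ 3 * -(cyclotomic (p * q * r) ℤ).coeff n + 12 * ε + 9 := by
  have : NeZero p := ⟨hp.ne_zero⟩
  have hβp : IsUnit (β : ZMod p) := by
    rw [ZMod.isUnit_iff_coprime]
    refine ((Nat.Prime.coprime_iff_not_dvd hp).2 fun h => ?_).symm
    have := Nat.mod_eq_zero_of_dvd (h.mul_right μ)
    omega
  obtain ⟨q, hqbig, hq, hqβ⟩ := Nat.forall_exists_prime_gt_and_eq_mod hβp (4 * p * p + 4)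
  have hpp : p ≤ 4 * p * p := Nat.le_mul_of_pos_left _ (by omega)
  have hpq : p < q := by omega
  rw [ZMod.natCast_eq_natCast_iff] at hqβ
  have hdvd : (p : ℤ) ∣ (q : ℤ) - β := (Nat.modEq_iff_dvd.1 hqβ.symm)
  obtain ⟨a, hab⟩ : ∃ a, a * p + μ * q = p * q + 1 := by
    have e1 : μ * q ≡ 1 [MOD p] := by
      calc μ * q ≡ μ * β [MOD p] := hqβ.mul_left μ
        _ = β * μ := mul_comm _ _
        _ ≡ 1 [MOD p] := by
          unfold Nat.ModEq; rw [hβμ, Nat.mod_eq_of_lt hp.one_lt]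
    have e2 : μ * q ≡ p * q + 1 [MOD p] := e1.trans (by
      have : (p * q + 1) % p = 1 % p := Nat.mul_add_mod _ _ _
      exact this.symm)
    have hle : μ * q ≤ p * q + 1 := (Nat.mul_le_mul_right q (by omega : μ ≤ p)).trans (Nat.le_succ _)
    obtain ⟨a, ha⟩ := (Nat.modEq_iff_dvd' hle).1 e2
    exact ⟨a, by rw [mul_comm a]; omega⟩
  have ha : a ≤ q := by
    refine Nat.le_of_mul_le_mul_right (?_ : a * p ≤ q * p) hp.pos
    have : 1 * 1 ≤ μ * q := Nat.mul_le_mul (by omega) (by omega)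
    rw [mul_comm q]; omega
  obtain ⟨h, hh, hh'⟩ : ∃ h, 2 * p * h ≤ q ∧ q < 2 * p * h + 2 * p :=
    ⟨q / (2 * p), Nat.mul_div_le _ _, Nat.lt_mul_div_succ q (by omega)⟩
  have hh0 : 0 < h := by
    rcases Nat.eq_zero_or_pos h with rfl | h0
    · have : 2 * p ≤ 4 * p * p := by nlinarith
      omega
    · exact h0
  have hhp : h * p * 2 ≤ q := by linarith
  have hhq : h < q := by nlinarith
  have hκpos : h * p < q := by omega
  have : NeZero (p * q) := ⟨mul_ne_zero hp.ne_zero hq.ne_zero⟩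
  have hκ : IsUnit ((q - h * p : ℕ) : ZMod (p * q)) := by
    rw [ZMod.isUnit_iff_coprime]
    refine Nat.Coprime.mul_right ?_ ?_
    · rw [Nat.coprime_comm, Nat.Prime.coprime_iff_not_dvd hp]
      intro hd
      have : p ∣ q := by
        have := (Nat.dvd_add_right hd).2 (Dvd.intro_left h rfl)
        rwa [Nat.sub_add_cancel hκpos.le] at this
      exact hpq.ne ((Nat.prime_dvd_prime_iff_eq hp hq).1 this)
    · have : 0 < h * p := Nat.mul_pos hh0 hp.pos
      exact (Nat.coprime_of_lt_prime (by omega) (by omega) hq).symm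
  obtain ⟨r, hrbig, hr, hrκ⟩ := Nat.forall_exists_prime_gt_and_eq_mod
    (hκ.unit⁻¹).isUnit (p * q)
  have hqr : q < r := lt_of_le_of_lt (Nat.le_mul_of_pos_left _ hp.pos) hrbig
  have hrκ' : ((p * q : ℕ) : ℤ) ∣ r * ((q : ℤ) - h * p) - 1 := by
    rw [← ZMod.intCast_zmod_eq_zero_iff_dvd]
    have e1 : ((r * (q - h * p : ℕ) : ℤ) : ZMod (p * q)) = 1 := by
      push_cast
      rw [hrκ]
      have := hκ.unit.inv_mul
      rwa [IsUnit.unit_spec] at this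
    rw [Nat.cast_sub hκpos.le] at e1
    push_cast at e1 ⊢
    rw [e1, sub_self]
  refine ⟨q, r, hq, hr, hpq, hqr, ?_⟩
  set T := (μ - 1 - β) * q with hTdef
  set n := r * T + r * (β * q) % (p * q) with hndef
  have hN0 : 0 < p * q := Nat.mul_pos hp.pos hq.pos
  have hn : n % (p * q) + n / (p * q) * (p * q) = n := by
    rw [mul_comm (n / (p * q))]; exact Nat.mod_add_div n (p * q)
  have hTc : (T : ℤ) + β * q = (μ - 1 : ℤ) * q := by
    rw [hTdef, Nat.cast_mul, Nat.cast_sub (by omega), Nat.cast_sub (by omega)]; push_cast; ring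
  have hcoef := neg_coeff_cyclotomic (p := p) (q := q) (r := r) (a := a) (b := μ) (T := T)
    (ρ := n % (p * q)) (l := n / (p * q)) (κ := (q : ℤ) - h * p) (c := (μ - 1 : ℤ) * q)
    hp hq hr hpq hqr hab ha (by omega) (Nat.mod_lt _ hN0) hrbig.le hrκ'
    (by
      rw [hn, hndef]
      have e1 := Nat.mod_add_div (r * (β * q)) (p * q)
      refine ⟨-(r * (β * q) / (p * q) : ℕ), ?_⟩
      zify at e1
      push_cast
      linear_combination e1 + r * hTc)
    (by rw [hn]; exact Nat.le_add_right _ _)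
    (by
      rw [hn, hndef]
      exact Nat.add_lt_add_left (Nat.mod_lt _ hN0) _)
    (fun m => m * h) (fun m => if m ≤ μ - 1 then μ - 1 - m else μ - 1 + p - m)
    (fun m => if m + β ≤ μ - 1 then μ - 1 - β - m else μ - 1 + p - β - m)
    (fun m hm => by
      have : m * h ≤ p * h := Nat.mul_le_mul_right _ hm.le
      show m * h < q
      linarith)
    (fun m hm => by split_ifs <;> omega)
    (fun m hm => by split_ifs <;> omega)
    (fun m hm => by
      split_ifs with hm'
      · refine ⟨0, ?_⟩
        rw [Nat.cast_sub hm', Nat.cast_sub (by omega)]; push_cast; ring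
      · refine ⟨1, ?_⟩
        rw [Nat.cast_sub (by omega), Nat.cast_add, Nat.cast_sub (by omega)]; push_cast; ring)
    (fun m hm => by
      obtain ⟨g, hg⟩ := hdvd
      split_ifs with hm'
      · refine ⟨g - h, ?_⟩
        rw [Nat.cast_sub (by omega), Nat.cast_sub (by omega), Nat.cast_sub (by omega)]
        push_cast
        linear_combination (q : ℤ) * hg
      · refine ⟨g - h + 1, ?_⟩
        rw [Nat.cast_sub (by omega), Nat.cast_sub (by omega), Nat.cast_add (μ - 1), Nat.cast_sub (by omega)]
        push_cast
        linear_combination (q : ℤ) * hg)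
  refine ⟨_, le_of_le_of_eq ?_ (by rw [hcoef])⟩
  have hsum := sum_le_sum fun m (hm : m ∈ range p) =>
    cutCoeff_difference_bound (a := a) (h := h) (β := β) (mem_range.1 hm) (by omega : 0 < μ) (by omega)
      (by omega) hab hh hh' (by omega) (by omega) (by omega)
  rw [sum_step_function (by omega) (by omega)] at hsum
  rw [← hTdef] at hsum
  omega

end LargeCoefficient

lemma natAbs_coeff_le_cycHeight (n k : ℕ) :
    ((Polynomial.cyclotomic n ℤ).coeff k).natAbs ≤ cycHeight n := by
  by_cases hk : k ≤ (Polynomial.cyclotomic n ℤ).natDegree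
  · exact Finset.le_sup (f := fun k => ((Polynomial.cyclotomic n ℤ).coeff k).natAbs)
      (Finset.mem_range.2 (Nat.lt_succ_of_le hk))
  · rw [Polynomial.coeff_eq_zero_of_natDegree_lt (by omega)]
    simp

/-- A near factorization of `p` yields inverse residues close to `p / 3` and `2 * p / 3`. -/
lemma exists_inverse_residues {p A B E : ℕ} (hp : p.Prime) (hA : A ≤ E) (hB : B ≤ E) (hE : 2 * E + 4 ≤ p)
    (h : (p % 3 = 2 ∧ p + 9 = A * B) ∨ (p % 3 = 1 ∧ p = A * B + 9)) :
    ∃ β μ : ℕ, β * μ % p = 1 ∧ p ≤ 3 * β + E ∧ 3 * β ≤ p + E ∧ 2 * p ≤ 3 * μ + E ∧ 3 * μ ≤ 2 * p + E := by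
  have hcop : IsCoprime (p : ℤ) 9 := by
    have : Nat.Coprime p 9 := Nat.Coprime.pow_right 2
      ((Nat.coprime_primes hp Nat.prime_three).2 (by omega))
    exact_mod_cast Nat.isCoprime_iff_coprime.2 this
  have key : ∀ (β μ : ℕ) (u v : ℤ), 3 * (β : ℤ) = p + u → 3 * (μ : ℤ) = 2 * p + v →
      (p : ℤ) ∣ u * v - 9 → β * μ % p = 1 := by
    rintro β μ u v hu hv ⟨g, hg⟩
    have h1 : (p : ℤ) ∣ ((β * μ : ℕ) : ℤ) - 1 := by
      refine hcop.dvd_of_dvd_mul_left ⟨2 * p + v + 2 * u + g, ?_⟩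
      push_cast
      linear_combination 3 * (μ : ℤ) * hu + (p + u) * hv + hg
    have h2 : 1 ≡ β * μ [MOD p] := (Nat.modEq_iff_dvd.2 (by exact_mod_cast h1))
    rw [← h2, Nat.mod_eq_of_lt hp.one_lt]
  have hAB : A % 3 * (B % 3) % 3 = A * B % 3 := (Nat.mul_mod A B 3).symm
  have hA3 : A % 3 = 0 ∨ A % 3 = 1 ∨ A % 3 = 2 := by omega
  have hB3 : B % 3 = 0 ∨ B % 3 = 1 ∨ B % 3 = 2 := by omega
  rcases h with ⟨h3, h9⟩ | ⟨h3, h9⟩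
  · have hz : (p : ℤ) + 9 = A * B := by exact_mod_cast h9
    have hcases : (A % 3 = 1 ∧ B % 3 = 2) ∨ (A % 3 = 2 ∧ B % 3 = 1) := by
      have : A * B % 3 = 2 := by omega
      rw [this] at hAB
      rcases hA3 with a | a | a <;> rcases hB3 with b | b | b <;> rw [a, b] at hAB <;> omega
    rcases hcases with ⟨a, b⟩ | ⟨a, b⟩
    · exact ⟨(p + A) / 3, (2 * p + B) / 3, key _ _ A B (by omega) (by omega)
        ⟨1, by linear_combination -hz⟩, by omega, by omega, by omega, by omega⟩
    · exact ⟨(p + B) / 3, (2 * p + A) / 3, key _ _ B A (by omega) (by omega)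
        ⟨1, by linear_combination -hz⟩, by omega, by omega, by omega, by omega⟩
  · have hz : (p : ℤ) = A * B + 9 := by exact_mod_cast h9
    have hcases : (A % 3 = 1 ∧ B % 3 = 1) ∨ (A % 3 = 2 ∧ B % 3 = 2) := by
      have : A * B % 3 = 1 := by omega
      rw [this] at hAB
      rcases hA3 with a | a | a <;> rcases hB3 with b | b | b <;> rw [a, b] at hAB <;> omega
    rcases hcases with ⟨a, b⟩ | ⟨a, b⟩
    · exact ⟨(p - A) / 3, (2 * p + B) / 3, key _ _ (-A) B (by omega) (by omega)
        ⟨-1, by linear_combination hz⟩, by omega, by omega, by omega, by omega⟩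
    · exact ⟨(p + A) / 3, (2 * p - B) / 3, key _ _ A (-B) (by omega) (by omega)
        ⟨-1, by linear_combination hz⟩, by omega, by omega, by omega, by omega⟩

theorem stmt_10 :
    ∃ c₁ : ℝ, 0 < c₁ ∧ ∀ N : ℕ, ∃ p : ℕ, N < p ∧ p.Prime ∧
      ∃ q r : ℕ, q.Prime ∧ r.Prime ∧ p < q ∧ q < r ∧
        2 * (p : ℝ) / 3 - c₁ * Real.sqrt p < (cycHeight (p * q * r) : ℝ) := by
  obtain ⟨C, hC, hprimes⟩ := exists_prime_near_balanced_product
  refine ⟨4 * C + 4, by positivity, fun N => ?_⟩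
  obtain ⟨p, A, B, hp, hNp, hA, hB, hfact⟩ := hprimes (N + (20 * C + 100) ^ 2)
  have hsq : √(p : ℝ) * √p = p := Real.mul_self_sqrt (Nat.cast_nonneg p)
  have hsqrt : (20 * C + 100 : ℝ) ≤ √p := by
    refine Real.le_sqrt_of_sq_le ?_
    have : (20 * C + 100) ^ 2 ≤ p := by omega
    exact_mod_cast this
  have hC0 : (0 : ℝ) ≤ C := Nat.cast_nonneg C
  have hfloor : (⌊(C : ℝ) * √p⌋₊ : ℝ) ≤ C * √p := Nat.floor_le (by positivity)
  have hbig : 20 * ⌊(C : ℝ) * √p⌋₊ + 100 ≤ p := by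
    have : (20 * ⌊(C : ℝ) * √p⌋₊ + 100 : ℝ) ≤ p := by nlinarith
    exact_mod_cast this
  obtain ⟨β, μ, hβμ, h1, h2, h3, h4⟩ := exists_inverse_residues hp (Nat.le_floor hA) (Nat.le_floor hB)
    (by omega) hfact
  obtain ⟨q, r, hq, hr, hpq, hqr, n, hn⟩ := exists_large_coefficient hp hβμ h1 h2 h3 h4 hbig
  refine ⟨p, by omega, hp, q, r, hq, hr, hpq, hqr, ?_⟩
  have hcoeff := natAbs_coeff_le_cycHeight (p * q * r) n
  have hlow : 2 * p ≤ 3 * cycHeight (p * q * r) + 12 * ⌊(C : ℝ) * √p⌋₊ + 9 := by omega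
  have hlow' : (2 * p : ℝ) ≤ 3 * cycHeight (p * q * r) + 12 * ⌊(C : ℝ) * √p⌋₊ + 9 := by
    exact_mod_cast hlow
  nlinarith
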